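/- arXiv:1511.07253 — 4 statements merged into one kernel-verified Lean document; each statement's English description precedes it below -/
import Mathlib

section
/- In PG(5,5), there exist maximal partial line spreads of size 151 + 5k for every integer k with 0 ≤ k ≤ 49, of every size n with 399 ≤ n ≤ 647, and of size 651 (a spread). -/
/-- A partial line spread of PG(n-1, q): a set of lines (2-dimensional linear
subspaces of `F^n`) that are pairwise skew, i.e. pairwise intersecting only
in the zero subspace. -/
def IsPartialLineSpread (F : Type*) [Field F] (n : ℕ)
    (S : Set (Submodule F (Fin n → F))) : Prop :=
  (∀ l ∈ S, Module.finrank F ↥l = 2) ∧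
  (∀ l ∈ S, ∀ l' ∈ S, l ≠ l' → l ⊓ l' = ⊥)

/-- A maximal partial line spread: a partial line spread such that every line
of the space meets some line of the spread nontrivially (equivalently, it
cannot be extended to a larger partial line spread). -/
def IsMaximalPartialLineSpread (F : Type*) [Field F] (n : ℕ)
    (S : Set (Submodule F (Fin n → F))) : Prop :=
  IsPartialLineSpread F n S ∧
  ∀ m : Submodule F (Fin n → F), Module.finrank F ↥m = 2 → ∃ l ∈ S, m ⊓ l ≠ ⊥

/-! ### Coordinates coded by base five digits

A natural number below `5 ^ 6` stands for the vector of its base five digits, and a pair `(a, b)`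
of such numbers for the line spanned by the two vectors. -/

/-- The part of `axpy` at the digit of weight `w`. -/
def axpyDigit (w c b a : ℕ) : ℕ :=
  Nat.mul w (Nat.mod (Nat.add (Nat.mul c (Nat.div b w)) (Nat.div a w)) 5)

/-- The code of the vector `c • b + a`. Primitive operations make it fast to reduce. -/
def axpy (c b a : ℕ) : ℕ :=
  Nat.add (axpyDigit 1 c b a) <| Nat.add (axpyDigit 5 c b a) <| Nat.add (axpyDigit 25 c b a) <|
    Nat.add (axpyDigit 125 c b a) <| Nat.add (axpyDigit 625 c b a) (axpyDigit 3125 c b a)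

/-- The code of a vector whose last nonzero coordinate is `1`. -/
def isMonic (n : ℕ) : Bool :=
  [3125, 625, 125, 25, 5, 1].any fun w => Nat.beq (Nat.div n w) 1

/-- `force n f` is `f n`; by reduction, `n` is evaluated before `f` is applied. -/
def force {β : Type} (n : ℕ) (f : ℕ → β) : β :=
  Nat.rec (f 0) (fun k _ => f k.succ) n

/-- The points of the line `l`; they are monic when `l` is in echelon form. -/
def linePoints (l : ℕ × ℕ) : List ℕ :=
  force l.1 fun a => force l.2 fun b => b :: [0, 1, 2, 3, 4].map (axpy · b a)

/-- The points on the lines of a list. -/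
def points (ls : List (ℕ × ℕ)) : List ℕ := ls.flatMap linePoints

/-! ### Finite checks on codes

Sets of codes are stored as the bits of a natural number. -/

/-- Membership in a set of codes. -/
def hasBit (m p : ℕ) : Bool := Nat.beq (Nat.land 1 (Nat.shiftRight m p)) 1

/-- Insertion into a set of codes. -/
def setBit (m p : ℕ) : ℕ := Nat.lor m (Nat.shiftLeft 1 p)

/-- `forceList l f` is `f l`; by reduction, `l` is evaluated before `f` is applied. -/
def forceList {β : Type} (l : List ℕ) (f : List ℕ → β) : β :=
  List.rec (motive := fun _ => (List ℕ → β) → β) (fun g => g [])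
    (fun x _ ih g => force x fun y => ih fun t => g (y :: t)) l f

/-- The set `m` enlarged by the members of `l`, passed on to `f`. -/
def withMask {β : Type} (l : List ℕ) (f : ℕ → β) (m : ℕ) : β :=
  List.rec (motive := fun _ => ℕ → β) f
    (fun p _ ih m => force p fun q => force (setBit m q) ih) l m

/-- All members of `l` are monic, they are distinct, and none lies in `m`. -/
def freshMonic (l : List ℕ) (m : ℕ) : Bool :=
  List.rec (motive := fun _ => ℕ → Bool) (fun _ => true)
    (fun p _ ih m => force p fun q =>
      isMonic q && !hasBit m q && force (setBit m q) ih) l m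

/-- Among the lines with echelon basis `(a, b)`, `a` in `as` and `b` in `bs`, where the last
nonzero coordinate of `b` has weight `w`, each has a point in `m`. -/
def meetsLines (m w : ℕ) (as bs : List ℕ) : Bool :=
  as.all fun a => !Nat.beq (Nat.mod (Nat.div a w) 5) 0 || bs.all fun b =>
    [1, 2, 3, 4].any fun c => hasBit m (axpy c b a)

/-- The monic codes outside `m` whose last nonzero coordinate has index `i`. -/
def holes (m i : ℕ) : List ℕ := (List.range' (5 ^ i) (5 ^ i)).filter fun n => !hasBit m n

/-- Every line has a point in `m`. -/
def isBlocking (m : ℕ) : Bool :=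
  (List.range 6).all fun j => forceList (holes m j) fun bs => bs.isEmpty ||
    (List.range 6).all fun i => i ≤ j || meetsLines m (5 ^ j) (holes m i) bs

/-! ### Chains of line sets -/

/-- Lines `rest` together with exchanges `(six, l)`, each replacing the lines `six` by `l`. -/
structure Chain where
  rest : List (ℕ × ℕ)
  exchanges : List (List (ℕ × ℕ) × (ℕ × ℕ))

/-- The lines left after `k` exchanges. -/
def Chain.stage (c : Chain) (k : ℕ) : List (ℕ × ℕ) :=
  c.rest ++ (c.exchanges.take k).map Prod.snd ++ (c.exchanges.drop k).flatMap Prod.fst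

/-- The exchange replaces six lines by a line contained in their union. -/
def isExchange (x : List (ℕ × ℕ) × (ℕ × ℕ)) : Bool :=
  x.1.length == 6 && freshMonic (linePoints x.2) 0 &&
    withMask (points x.1) (fun m => (linePoints x.2).all fun p => hasBit m p) 0

/-- The chain starts with `n` pairwise skew lines, has `k` exchanges, and is blocking at its end. -/
def Chain.isValid (c : Chain) (n k : ℕ) : Bool :=
  c.rest.length + 6 * k == n && c.exchanges.length == k &&
    freshMonic (points (c.stage 0)) 0 && c.exchanges.all isExchange &&
    withMask (points (c.stage k)) isBlocking 0

/-! ### Chains from the regular spread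

The vector `(w, t, s)` with `w` in `F ^ 4` is viewed as `(w, t + s ω)` in three-dimensional space
over the field with 25 elements, `ω ^ 2 = 2`. -/

/-- Multiplication by `ω` on `F ^ 4`. -/
def mulOmega (n : ℕ) : ℕ :=
  2 * (n / 5 % 5) % 5 + 5 * (n % 5) + 25 * (2 * (n / 125 % 5) % 5) + 125 * (n / 25 % 5)

/-- Multiplication by `ω + t` on `F ^ 4`. -/
def mulOmegaAdd (t n : ℕ) : ℕ := axpy t n (mulOmega n)

/-- The monic multiple of a nonzero code. -/
def toMonic (n : ℕ) : ℕ := (((List.range 5).map (axpy · n 0)).find? isMonic).getD 0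

/-- The line of the regular spread through `(v, 1, 0)`. -/
def regularLine (v : ℕ) : ℕ × ℕ := (3125 + mulOmega v, 625 + v)

/-- The line in the hyperplane `s = 0` through `(u, 1, 0)` and `(e, 0, 0)`. -/
def affineLine (u e : ℕ) : ℕ × ℕ := (625 + u, e)

/-- The multiple of `affineLine u e` by `ω + t`. -/
def rotatedLine (u e t : ℕ) : ℕ × ℕ :=
  (3125 + 625 * t + mulOmegaAdd t u, toMonic (mulOmegaAdd t e))

/-- The exchanges of the group of the spread line of `e`: the line `affineLine u₀ e` and its
rotated lines form a regulus, and each rotated line is exchanged, together with five lines of the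
regular spread, for a line in the hyperplane with the same direction. -/
def groupExchanges (e u₀ : ℕ) (us : List ℕ) : List (List (ℕ × ℕ) × (ℕ × ℕ)) :=
  us.zipIdx.map fun (u, t) =>
    let l := affineLine u (toMonic (mulOmegaAdd t e))
    (rotatedLine u₀ e t :: (List.range 5).map fun c => regularLine (axpy c l.2 u), l)

/-- The chain with lines `ts` in the solid `s = t = 0`, further lines `affineLine u e` for `(u, e)`
in `as`, and the groups `(e, u₀, us)` in `gs`. -/
def regularChain (ts as : List (ℕ × ℕ)) (gs : List (ℕ × ℕ × List ℕ)) : Chain :=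
  let fixed := as.map (fun x => affineLine x.1 x.2) ++ gs.map fun g => affineLine g.2.1 g.1
  let xs := gs.flatMap fun g => groupExchanges g.1 g.2.1 g.2.2
  { rest := ts ++ fixed ++ withMask (points (fixed ++ xs.map Prod.snd)) (fun m =>
      ((List.range 625).filter fun v => !hasBit m (625 + v)).map regularLine) 0
    exchanges := xs }

/-! ### Correctness of the checks -/

theorem force_eq {β : Type} (n : ℕ) (f : ℕ → β) : force n f = f n := by
  cases n <;> rfl

theorem forceList_eq {β : Type} (l : List ℕ) (f : List ℕ → β) : forceList l f = f l := by
  induction l generalizing f with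
  | nil => rfl
  | cons x l ih =>
    change force x (fun y => forceList l fun t => f (y :: t)) = _
    rw [force_eq, ih]

theorem hasBit_eq_testBit (m p : ℕ) : hasBit m p = m.testBit p := by
  rw [Nat.testBit_eq_decide_div_mod_eq, ← Nat.shiftRight_eq_div_pow, ← Nat.and_one_is_mod,
    Nat.and_comm, Bool.eq_iff_iff, decide_eq_true_eq]
  exact iff_of_eq Nat.beq_eq

theorem hasBit_zero (p : ℕ) : hasBit 0 p = false := by
  rw [hasBit_eq_testBit, Nat.zero_testBit]

theorem hasBit_setBit (m p q : ℕ) : hasBit (setBit m p) q = true ↔ hasBit m q = true ∨ q = p := by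
  rw [hasBit_eq_testBit, hasBit_eq_testBit]
  change (m ||| 1 <<< p).testBit q = true ↔ _
  rw [Nat.testBit_or, Nat.one_shiftLeft, Nat.testBit_two_pow]
  rw [Bool.or_eq_true, decide_eq_true_eq, @eq_comm _ p q]

theorem withMask_eq {β : Type} (l : List ℕ) (f : ℕ → β) (m : ℕ) :
    ∃ m', withMask l f m = f m' ∧ ∀ p, hasBit m' p = true ↔ hasBit m p = true ∨ p ∈ l := by
  induction l generalizing m with
  | nil => exact ⟨m, rfl, by simp⟩
  | cons x l ih =>
    obtain ⟨m', h, hm'⟩ := ih (setBit m x)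
    refine ⟨m', ?_, fun p => ?_⟩
    · change force x (fun q => force (setBit m q) (withMask l f)) = _
      rw [force_eq, force_eq, h]
    · rw [hm', hasBit_setBit, List.mem_cons, or_assoc]

theorem freshMonic_sound {l : List ℕ} {m : ℕ} (h : freshMonic l m = true) :
    l.Nodup ∧ (∀ p ∈ l, isMonic p = true) ∧ ∀ p ∈ l, hasBit m p = false := by
  induction l generalizing m with
  | nil => simp
  | cons x l ih =>
    change (force x fun q => isMonic q && !hasBit m q && force (setBit m q) (freshMonic l)) = true
      at h
    rw [force_eq, force_eq] at h
    simp only [Bool.and_eq_true, Bool.not_eq_true'] at h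
    obtain ⟨⟨h₁, h₂⟩, h₃⟩ := h
    obtain ⟨i₁, i₂, i₃⟩ := ih h₃
    have key : ∀ p ∈ l, hasBit m p = false ∧ p ≠ x := fun p hp => by
      have := (hasBit_setBit m x p).not.1 (by simp [i₃ p hp])
      simpa using this
    refine ⟨List.nodup_cons.2 ⟨fun hx => (key x hx).2 rfl, i₁⟩, ?_, ?_⟩
    · simpa [h₁] using i₂
    · simpa [h₂] using fun p hp => (key p hp).1

theorem linePoints_eq (l : ℕ × ℕ) :
    linePoints l = l.2 :: [0, 1, 2, 3, 4].map (axpy · l.2 l.1) := by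
  rw [linePoints, force_eq, force_eq]

theorem isMonic_iff {n : ℕ} : isMonic n = true ↔ ∃ i : Fin 6, n / 5 ^ (i : ℕ) = 1 := by
  have h : ∀ w, Nat.div n w = n / w := fun _ => rfl
  simp [isMonic, Fin.exists_fin_succ, h]
  tauto

theorem axpy_div (c b a i : ℕ) (hi : i < 6) :
    axpy c b a / 5 ^ i % 5 = (c * (b / 5 ^ i) + a / 5 ^ i) % 5 := by
  have h : ∀ w, axpyDigit w c b a = w * ((c * (b / w) + a / w) % 5) := fun _ => rfl
  have h' : axpy c b a = axpyDigit 1 c b a + (axpyDigit 5 c b a + (axpyDigit 25 c b a +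
    (axpyDigit 125 c b a + (axpyDigit 625 c b a + axpyDigit 3125 c b a)))) := rfl
  rw [h']
  simp only [h]
  interval_cases i <;> norm_num <;> omega

/-! ### Vectors -/

section Vectors

variable (F : Type*) [Field F]

/-- The vector with a given code. -/
def codeVec (n : ℕ) : Fin 6 → F := fun i => ((n / 5 ^ (i : ℕ) : ℕ) : F)

/-- The line spanned by a pair of codes. -/
def codeLine (l : ℕ × ℕ) : Submodule F (Fin 6 → F) :=
  Submodule.span F {codeVec F l.1, codeVec F l.2}

variable {F}

/-- The last nonzero coordinate is `1`. -/
def MonicVec (v : Fin 6 → F) : Prop := ∃ i, v i = 1 ∧ ∀ j, i < j → v j = 0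

theorem MonicVec.ne_zero {v : Fin 6 → F} (h : MonicVec v) : v ≠ 0 := by
  rintro rfl
  obtain ⟨i, hi, -⟩ := h
  simp at hi

theorem MonicVec.eq_of_smul {v w : Fin 6 → F} (hv : MonicVec v) (hw : MonicVec w) {c : F}
    (h : w = c • v) : w = v := by
  obtain ⟨i, hi, hi'⟩ := hv
  obtain ⟨j, hj, hj'⟩ := hw
  have h' : ∀ k, w k = c * v k := fun k => by rw [h]; rfl
  suffices c = 1 by rw [h, this, one_smul]
  rcases lt_trichotomy i j with hij | rfl | hij
  · simp [h', hi' j hij] at hj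
  · simpa [h', hi] using hj
  · have := hj' i hij
    rw [h', hi, mul_one] at this
    simp [h', this] at hj

theorem codeVec_monic {n : ℕ} (h : isMonic n = true) : MonicVec (codeVec F n) := by
  obtain ⟨i, hi⟩ := isMonic_iff.1 h
  refine ⟨i, by simp [codeVec, hi], fun j hij => ?_⟩
  have : n / 5 ^ (j : ℕ) = 0 := by
    obtain ⟨k, hk⟩ := Nat.exists_eq_add_of_lt (Fin.lt_def.1 hij)
    rw [hk, add_assoc, pow_add, ← Nat.div_div_eq_div_mul, hi]
    exact Nat.div_eq_of_lt (Nat.one_lt_pow (by omega) (by norm_num))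
  simp [codeVec, this]

/-- A two-dimensional subspace has an echelon basis. -/
theorem exists_echelon {m : Submodule F (Fin 6 → F)} (hm : Module.finrank F ↥m = 2) :
    ∃ i j : Fin 6, j < i ∧ ∃ a ∈ m, ∃ b ∈ m, a i = 1 ∧ (∀ k, i < k → a k = 0) ∧ a j = 0 ∧
      b j = 1 ∧ ∀ k, j < k → b k = 0 := by
  have monic : ∀ v ∈ m, v ≠ 0 → ∃ i, v i ≠ 0 ∧ (∀ k, i < k → v k = 0) ∧
      (v i)⁻¹ • v ∈ m := by
    intro v hv hv0
    classical
    have hne : (Finset.univ.filter fun i => v i ≠ 0).Nonempty := by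
      obtain ⟨i, hi⟩ := Function.ne_iff.1 hv0
      exact ⟨i, by simpa using hi⟩
    refine ⟨_, (Finset.mem_filter.1 (Finset.max'_mem _ hne)).2, fun k hk => ?_,
      m.smul_mem _ hv⟩
    by_contra hk0
    exact absurd (Finset.le_max' _ k (by simpa using hk0)) (not_le.2 hk)
  have hex : ∃ i : Fin 6, ∃ v ∈ m, v i ≠ 0 := by
    by_contra! hcon
    have : m = ⊥ := (Submodule.eq_bot_iff _).2 fun v hv => funext fun i => hcon i v hv
    rw [this, finrank_bot] at hm
    omega
  classical
  have hne : (Finset.univ.filter fun i : Fin 6 => ∃ v ∈ m, v i ≠ 0).Nonempty := by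
    obtain ⟨i, hi⟩ := hex
    exact ⟨i, by simpa using hi⟩
  set i := (Finset.univ.filter fun i : Fin 6 => ∃ v ∈ m, v i ≠ 0).max' hne with hi
  obtain ⟨v, hv, hvi⟩ := (Finset.mem_filter.1 (Finset.max'_mem _ hne)).2
  rw [← hi] at hvi
  have htop : ∀ w ∈ m, ∀ k, i < k → w k = 0 := fun w hw k hk => by
    by_contra hk0
    exact absurd (Finset.le_max' _ k (by simpa using ⟨w, hw, hk0⟩)) (not_le.2 hk)
  have hspan : ¬ m ≤ Submodule.span F {v} := fun hle => by
    have := (Submodule.finrank_mono hle).trans (finrank_span_le_card ({v} : Set (Fin 6 → F)))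
    simp [hm] at this
  obtain ⟨w, hw, hwv⟩ := Set.not_subset.1 hspan
  set w' := w - (w i * (v i)⁻¹) • v with hw'
  have hw'm : w' ∈ m := sub_mem hw (m.smul_mem _ hv)
  have hw'i : w' i = 0 := by simp [hw', hvi]
  have hw'0 : w' ≠ 0 := fun h0 => hwv (by
    rw [sub_eq_zero.1 h0]
    exact Submodule.smul_mem _ _ (Submodule.mem_span_singleton_self v))
  obtain ⟨j, hj, hj', hjm⟩ := monic w' hw'm hw'0
  have hji : j < i := by
    rcases lt_trichotomy j i with h | h | h
    · exact h
    · exact absurd (h ▸ hw'i) hj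
    · exact absurd (htop w' hw'm j h) hj
  set b := (w' j)⁻¹ • w' with hb
  have hbj : b j = 1 := by simp [hb, hj]
  have hbi : b i = 0 := by simp [hb, hw'i]
  set a := (v i)⁻¹ • v - ((v i)⁻¹ * v j) • b with ha
  have ham : a ∈ m := sub_mem (m.smul_mem _ hv) (m.smul_mem _ hjm)
  refine ⟨i, j, hji, a, ham, b, hjm, ?_, fun k hk => htop a ham k hk, ?_, hbj, fun k hk => ?_⟩
  · simp [ha, hbi, hvi]
  · simp [ha, hbj]
  · simp [hb, hj' k hk]

variable [CharP F 5]

theorem codeVec_axpy (c b a : ℕ) :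
    codeVec F (axpy c b a) = codeVec F a + (c : F) • codeVec F b := by
  funext i
  have h := axpy_div c b a i i.2
  simp only [codeVec, Pi.add_apply, Pi.smul_apply, smul_eq_mul]
  rw [CharP.cast_eq_mod F 5, h, ← CharP.cast_eq_mod F 5]
  push_cast
  ring

theorem lt_of_isMonic {n : ℕ} (h : isMonic n = true) : n < 5 ^ 6 := by
  obtain ⟨i, hi⟩ := isMonic_iff.1 h
  fin_cases i <;> norm_num at hi ⊢ <;> omega

theorem natCast_mod_inj {a b : ℕ} (h : (a : F) = b) : a % 5 = b % 5 :=
  (CharP.natCast_eq_natCast F 5).1 h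

theorem codeVec_injective {a b : ℕ} (ha : a < 5 ^ 6) (hb : b < 5 ^ 6)
    (h : codeVec F a = codeVec F b) : a = b := by
  have h' : ∀ i : Fin 6, a / 5 ^ (i : ℕ) % 5 = b / 5 ^ (i : ℕ) % 5 := fun i =>
    natCast_mod_inj (F := F) (congrFun h i)
  have h0 := h' 0
  have h1 := h' 1
  have h2 := h' 2
  have h3 := h' 3
  have h4 := h' 4
  have h5 := h' 5
  norm_num at h0 h1 h2 h3 h4 h5 ha hb
  omega

theorem eq_of_smul_codeVec {p q : ℕ} (hp : isMonic p = true) (hq : isMonic q = true) {c : F}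
    (h : codeVec F q = c • codeVec F p) : q = p :=
  codeVec_injective (lt_of_isMonic hq) (lt_of_isMonic hp)
    ((codeVec_monic hp).eq_of_smul (codeVec_monic hq) h)

/-- Every vector has a code. -/
theorem exists_codeVec (hF : ∀ x : F, ∃ k < 5, ((k : ℕ) : F) = x) (v : Fin 6 → F) :
    ∃ n < 5 ^ 6, codeVec F n = v := by
  choose d hd hdv using hF
  have hd' := fun i => hd (v i)
  refine ⟨d (v 0) + 5 * (d (v 1) + 5 * (d (v 2) + 5 * (d (v 3) + 5 * (d (v 4) + 5 * d (v 5))))),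
    ?_, funext fun i => ?_⟩
  · have := hd' 0
    have := hd' 1
    have := hd' 2
    have := hd' 3
    have := hd' 4
    have := hd' 5
    norm_num
    omega
  · conv_rhs => rw [← hdv (v i)]
    refine (CharP.natCast_eq_natCast F 5).2 ?_
    have := hd' 0
    have := hd' 1
    have := hd' 2
    have := hd' 3
    have := hd' 4
    have := hd' 5
    unfold Nat.ModEq
    have hi : i = 0 ∨ i = 1 ∨ i = 2 ∨ i = 3 ∨ i = 4 ∨ i = 5 := by decide +revert
    rcases hi with rfl | rfl | rfl | rfl | rfl | rfl <;> norm_num <;> omega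

theorem codeVec_mem_codeLine {l : ℕ × ℕ} {p : ℕ} (hp : p ∈ linePoints l) :
    codeVec F p ∈ codeLine F l := by
  have ha : codeVec F l.1 ∈ codeLine F l := Submodule.subset_span (by simp)
  have hb : codeVec F l.2 ∈ codeLine F l := Submodule.subset_span (by simp)
  rw [linePoints_eq, List.mem_cons, List.mem_map] at hp
  rcases hp with rfl | ⟨c, -, rfl⟩
  · exact hb
  · rw [codeVec_axpy]
    exact add_mem ha (Submodule.smul_mem _ _ hb)

theorem exists_linePoint (hF : ∀ x : F, ∃ k < 5, ((k : ℕ) : F) = x) {l : ℕ × ℕ}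
    {v : Fin 6 → F} (hv : v ∈ codeLine F l) :
    ∃ p ∈ linePoints l, ∃ c : F, v = c • codeVec F p := by
  obtain ⟨x, y, rfl⟩ := Submodule.mem_span_pair.1 hv
  rw [linePoints_eq]
  by_cases hx : x = 0
  · exact ⟨l.2, by simp, y, by simp [hx]⟩
  · obtain ⟨k, hk, hkx⟩ := hF (x⁻¹ * y)
    refine ⟨axpy k l.2 l.1, ?_, x, ?_⟩
    · refine List.mem_cons_of_mem _ (List.mem_map.2 ⟨k, ?_, rfl⟩)
      interval_cases k <;> simp
    · rw [codeVec_axpy, hkx, smul_add, smul_smul, mul_inv_cancel_left₀ hx]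

/-! ### Line sets -/

/-- The lines have pairwise distinct points, all monic. -/
def Skew (ls : List (ℕ × ℕ)) : Prop :=
  (points ls).Nodup ∧ ∀ p ∈ points ls, isMonic p = true

theorem finrank_codeLine {l : ℕ × ℕ} (hn : (linePoints l).Nodup)
    (hm : ∀ p ∈ linePoints l, isMonic p = true) : Module.finrank F ↥(codeLine F l) = 2 := by
  have hb : l.2 ∈ linePoints l := by simp [linePoints_eq]
  have ha : axpy 0 l.2 l.1 ∈ linePoints l := by simp [linePoints_eq]
  have hab : axpy 0 l.2 l.1 ≠ l.2 := by
    rw [linePoints_eq, List.nodup_cons] at hn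
    intro h
    exact hn.1 (by rw [← h]; simp [h])
  have hav : codeVec F (axpy 0 l.2 l.1) = codeVec F l.1 := by simp [codeVec_axpy]
  have hli : LinearIndependent F ![codeVec F l.2, codeVec F l.1] := by
    rw [LinearIndependent.pair_iff' (codeVec_monic (hm _ hb)).ne_zero]
    intro c hc
    exact hab (eq_of_smul_codeVec (hm _ hb) (hm _ ha) (hav.trans hc.symm))
  have := finrank_span_eq_card hli
  rwa [Matrix.range_cons, Matrix.range_cons, Matrix.range_empty, Set.union_empty,
    Set.singleton_union, Set.pair_comm, Fintype.card_fin] at this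

theorem Skew.eq_of_mem (hF : ∀ x : F, ∃ k < 5, ((k : ℕ) : F) = x) {ls : List (ℕ × ℕ)}
    (h : Skew ls) {l l' : ℕ × ℕ} (hl : l ∈ ls) (hl' : l' ∈ ls) {v : Fin 6 → F} (hv : v ≠ 0)
    (hvl : v ∈ codeLine F l) (hvl' : v ∈ codeLine F l') : l = l' := by
  obtain ⟨p, hp, c, hc⟩ := exists_linePoint hF hvl
  obtain ⟨q, hq, d, hd⟩ := exists_linePoint hF hvl'
  have hc0 : c ≠ 0 := by
    rintro rfl
    exact hv (by simp [hc])
  have hpq : p = q := by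
    refine eq_of_smul_codeVec (F := F) (c := c⁻¹ * d) (h.2 _ (List.mem_flatMap.2 ⟨_, hl', hq⟩))
      (h.2 _ (List.mem_flatMap.2 ⟨_, hl, hp⟩)) ?_
    rw [mul_smul, ← hd, hc, inv_smul_smul₀ hc0]
  by_contra hne
  have : Std.Symm (Function.onFun List.Disjoint linePoints) :=
    ⟨fun _ _ hxy => List.Disjoint.symm hxy⟩
  have hdis := (List.nodup_flatMap.1 h.1).2.forall hl hl' hne
  exact hdis hp (hpq ▸ hq)

theorem Skew.line {ls : List (ℕ × ℕ)} (h : Skew ls) {l : ℕ × ℕ} (hl : l ∈ ls) :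
    Module.finrank F ↥(codeLine F l) = 2 :=
  finrank_codeLine ((List.nodup_flatMap.1 h.1).1 l hl)
    fun p hp => h.2 p (List.mem_flatMap.2 ⟨l, hl, hp⟩)

theorem Skew.isPartialLineSpread (hF : ∀ x : F, ∃ k < 5, ((k : ℕ) : F) = x)
    {ls : List (ℕ × ℕ)} (h : Skew ls) :
    IsPartialLineSpread F 6 (codeLine F '' {l | l ∈ ls}) := by
  constructor
  · rintro _ ⟨l, hl, rfl⟩
    exact h.line hl
  · rintro _ ⟨l, hl, rfl⟩ _ ⟨l', hl', rfl⟩ hne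
    refine (Submodule.eq_bot_iff _).2 fun v hv => ?_
    by_contra hv0
    exact hne (congrArg _ (h.eq_of_mem hF hl hl' hv0 hv.1 hv.2))

theorem Skew.ncard (hF : ∀ x : F, ∃ k < 5, ((k : ℕ) : F) = x) {ls : List (ℕ × ℕ)}
    (h : Skew ls) : (codeLine F '' {l | l ∈ ls}).ncard = ls.length := by
  have hb : ∀ l, l.2 ∈ linePoints l := fun l => by simp [linePoints_eq]
  have hnd : ls.Nodup := (List.nodup_flatMap.1 h.1).2.imp fun {a b} hab he =>
    hab (hb a) (by rw [show a = b from he]; exact hb b)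
  rw [Set.InjOn.ncard_image]
  · rw [← List.toFinset_card_of_nodup hnd, ← Set.ncard_coe_finset]
    simp
  · intro l hl l' hl' he
    have hv := codeVec_mem_codeLine (F := F) (hb l)
    refine h.eq_of_mem hF hl hl' (codeVec_monic (h.2 _ ?_)).ne_zero hv (by rw [← he]; exact hv)
    exact List.mem_flatMap.2 ⟨l, hl, hb l⟩

/-! ### Blocking sets -/

theorem div_pow_eq_one {n : ℕ} (hn : n < 5 ^ 6) {i : Fin 6} (h1 : codeVec F n i = 1)
    (h0 : ∀ k, i < k → codeVec F n k = 0) : n / 5 ^ (i : ℕ) = 1 := by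
  have h1' : n / 5 ^ (i : ℕ) % 5 = 1 % 5 := natCast_mod_inj (F := F) (by simpa [codeVec] using h1)
  have h0' : ∀ k, i < k → n / 5 ^ (k : ℕ) % 5 = 0 % 5 := fun k hk =>
    natCast_mod_inj (F := F) (by simpa [codeVec] using h0 k hk)
  simp only [Fin.forall_fin_succ] at h0'
  fin_cases i <;> simp [Fin.lt_def] at h1' h0' hn ⊢ <;> omega

theorem mem_holes {m n i : ℕ} (h : n / 5 ^ i = 1) (hn : hasBit m n = false) : n ∈ holes m i := by
  have hpos : 0 < 5 ^ i := by positivity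
  have := Nat.div_add_mod n (5 ^ i)
  have := Nat.mod_lt n hpos
  rw [h] at *
  simp only [holes, List.mem_filter, List.mem_range'_1, hn]
  refine ⟨⟨by omega, by omega⟩, rfl⟩

theorem exists_mem_of_isBlocking (hF : ∀ x : F, ∃ k < 5, ((k : ℕ) : F) = x) {t : ℕ}
    (ht : isBlocking t = true) {m : Submodule F (Fin 6 → F)} (hm : Module.finrank F ↥m = 2) :
    ∃ p, hasBit t p = true ∧ codeVec F p ∈ m := by
  obtain ⟨i, j, hji, a, ham, b, hbm, hai, ha0, haj, hbj, hb0⟩ := exists_echelon hm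
  obtain ⟨x, hx, rfl⟩ := exists_codeVec hF a
  obtain ⟨y, hy, rfl⟩ := exists_codeVec hF b
  by_contra! hcon
  have hfree : ∀ p, codeVec F p ∈ m → hasBit t p = false := fun p hp => by
    by_contra hp'
    exact hcon p (by simpa using hp') hp
  have hxi := mem_holes (div_pow_eq_one hx hai ha0) (hfree x ham)
  have hyj := mem_holes (div_pow_eq_one hy hbj hb0) (hfree y hbm)
  have hxj : x / 5 ^ (j : ℕ) % 5 = 0 % 5 :=
    natCast_mod_inj (F := F) (by simpa [codeVec] using haj)
  have h := List.all_eq_true.1 ht j (List.mem_range.2 j.2)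
  rw [forceList_eq, Bool.or_eq_true] at h
  rcases h with h | h
  · rw [List.isEmpty_iff.1 h] at hyj
    simp at hyj
  have h := List.all_eq_true.1 h i (List.mem_range.2 i.2)
  have hij : ¬ (i : ℕ) ≤ j := not_le.2 hji
  simp only [hij, decide_false, Bool.false_or] at h
  have h := List.all_eq_true.1 h x hxi
  have hz : (!Nat.beq (Nat.mod (Nat.div x (5 ^ (j : ℕ))) 5) 0) = false := by
    change (!Nat.beq (x / 5 ^ (j : ℕ) % 5) 0) = false
    rw [hxj]
    rfl
  rw [hz, Bool.false_or] at h
  obtain ⟨c, -, hc⟩ := List.any_eq_true.1 (List.all_eq_true.1 h y hyj)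
  refine hcon _ hc ?_
  rw [codeVec_axpy]
  exact add_mem ham (m.smul_mem _ hbm)

end Vectors

/-! ### Chains -/

theorem List.Nodup.exchange {α : Type*} {l₁ l₂ l₂' l₃ : List α} (h : (l₁ ++ (l₂ ++ l₃)).Nodup)
    (hn : l₂'.Nodup) (hs : l₂' ⊆ l₂) : (l₁ ++ (l₂' ++ l₃)).Nodup := by
  simp only [List.nodup_append', List.disjoint_append_right] at h ⊢
  exact ⟨h.1, ⟨hn, h.2.1.2.1, fun _ hx => h.2.1.2.2 (hs hx)⟩,
    fun _ hx hx' => h.2.2.1 hx (hs hx'), h.2.2.2⟩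

theorem isExchange_sound {x : List (ℕ × ℕ) × (ℕ × ℕ)} (h : isExchange x = true) :
    x.1.length = 6 ∧ (linePoints x.2).Nodup ∧ linePoints x.2 ⊆ points x.1 := by
  simp only [isExchange, Bool.and_eq_true, beq_iff_eq] at h
  obtain ⟨⟨h₁, h₂⟩, h₃⟩ := h
  refine ⟨h₁, (freshMonic_sound h₂).1, fun p hp => ?_⟩
  obtain ⟨m, hm, hm'⟩ := withMask_eq (points x.1)
    (fun m => (linePoints x.2).all fun p => hasBit m p) 0
  rw [hm, List.all_eq_true] at h₃
  simpa [hasBit_zero] using (hm' p).1 (h₃ p hp)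

theorem points_append (l₁ l₂ : List (ℕ × ℕ)) : points (l₁ ++ l₂) = points l₁ ++ points l₂ :=
  List.flatMap_append

/-- Exchanging lines keeps the points distinct and only uncovers points. -/
theorem stage_points (xs : List (List (ℕ × ℕ) × (ℕ × ℕ)))
    (hx : ∀ x ∈ xs, isExchange x = true) (r : List (ℕ × ℕ)) (k : ℕ)
    (h : (points ((Chain.mk r xs).stage 0)).Nodup) :
    (points ((Chain.mk r xs).stage k)).Nodup ∧
      points ((Chain.mk r xs).stage k) ⊆ points ((Chain.mk r xs).stage 0) ∧
      points ((Chain.mk r xs).stage xs.length) ⊆ points ((Chain.mk r xs).stage k) := by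
  induction xs generalizing r k with
  | nil => simpa [Chain.stage] using h
  | cons x xs ih =>
    obtain ⟨-, hn, hs⟩ := isExchange_sound (hx x (by simp))
    have hp : points [x.2] = linePoints x.2 := by simp [points]
    have hmid : (points ((Chain.mk (r ++ [x.2]) xs).stage 0)).Nodup := by
      simp only [Chain.stage, List.take_zero, List.drop_zero, List.map_nil, List.append_nil,
        List.flatMap_cons, points_append, List.append_assoc, hp] at h ⊢
      exact h.exchange hn hs
    have hsub : points ((Chain.mk (r ++ [x.2]) xs).stage 0) ⊆
        points ((Chain.mk r (x :: xs)).stage 0) := by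
      simp only [Chain.stage, List.take_zero, List.drop_zero, List.map_nil, List.append_nil,
        List.flatMap_cons, points_append, List.append_assoc, hp]
      exact List.append_subset_of_subset_of_subset (List.subset_append_left _ _)
        (List.append_subset_of_subset_of_subset
          (fun _ hy => List.mem_append_right _ (List.mem_append_left _ (hs hy)))
          (fun _ hy => List.mem_append_right _ (List.mem_append_right _ hy)))
    have hstage : ∀ k, (Chain.mk r (x :: xs)).stage (k + 1) = (Chain.mk (r ++ [x.2]) xs).stage k :=
      fun k => by simp [Chain.stage]
    have ih' := fun k => ih (fun y hy => hx y (List.mem_cons_of_mem _ hy)) (r ++ [x.2]) k hmid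
    rw [List.length_cons, hstage]
    cases k with
    | zero => exact ⟨h, fun _ hy => hy, fun _ hy => hsub ((ih' 0).2.2 hy)⟩
    | succ k =>
      rw [hstage]
      exact ⟨(ih' k).1, fun _ hy => hsub ((ih' k).2.1 hy), (ih' k).2.2⟩

theorem length_flatMap_fst (xs : List (List (ℕ × ℕ) × (ℕ × ℕ)))
    (hx : ∀ x ∈ xs, isExchange x = true) : (xs.flatMap Prod.fst).length = 6 * xs.length := by
  induction xs with
  | nil => rfl
  | cons x xs ih =>
    rw [List.flatMap_cons, List.length_append, (isExchange_sound (hx x (by simp))).1,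
      ih fun y hy => hx y (List.mem_cons_of_mem _ hy), List.length_cons]
    ring

/-- A valid chain yields maximal partial line spreads. -/
theorem Chain.exists_spread {F : Type*} [Field F] [CharP F 5]
    (hF : ∀ x : F, ∃ k < 5, ((k : ℕ) : F) = x) {c : Chain} {n k : ℕ}
    (h : c.isValid n k = true) {N : ℕ} (hN : ∃ j ≤ k, N + 5 * j = n) :
    ∃ S : Set (Submodule F (Fin 6 → F)), IsMaximalPartialLineSpread F 6 S ∧ S.ncard = N := by
  obtain ⟨j, hjk, hj⟩ := hN
  simp only [Chain.isValid, Bool.and_eq_true, beq_iff_eq, List.all_eq_true] at h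
  obtain ⟨⟨⟨⟨hn, hk⟩, hfresh⟩, hx⟩, hblock⟩ := h
  obtain ⟨hnd, hmonic, -⟩ := freshMonic_sound hfresh
  obtain ⟨hnd', hsub, hsup⟩ := stage_points c.exchanges hx c.rest j hnd
  have hskew : Skew (c.stage j) := ⟨hnd', fun p hp => hmonic p (hsub hp)⟩
  obtain ⟨t, ht, ht'⟩ := withMask_eq (points (c.stage k)) isBlocking 0
  rw [ht] at hblock
  refine ⟨_, ⟨hskew.isPartialLineSpread hF, fun m hm => ?_⟩, (hskew.ncard hF).trans ?_⟩
  · obtain ⟨p, hp, hpm⟩ := exists_mem_of_isBlocking hF hblock hm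
    have hp' : p ∈ points (c.stage k) := by simpa [hasBit_zero] using (ht' p).1 hp
    have hpj : p ∈ points (c.stage j) := hsup (by rw [hk]; exact hp')
    obtain ⟨l, hl, hpl⟩ := List.mem_flatMap.1 hpj
    refine ⟨_, ⟨l, hl, rfl⟩, fun hbot => ?_⟩
    have : codeVec F p ∈ m ⊓ codeLine F l := ⟨hpm, codeVec_mem_codeLine hpl⟩
    rw [hbot, Submodule.mem_bot] at this
    exact (codeVec_monic (hskew.2 p hpj)).ne_zero this
  · rw [Chain.stage, List.length_append, List.length_append, List.length_map,
      length_flatMap_fst _ fun x hx' => hx x (List.mem_of_mem_drop hx'), List.length_take,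
      List.length_drop]
    omega

/-! ### The data -/

/-- The lines of the solid outside the groups of `spreadGroups`. -/
def spreadLines : List (ℕ × ℕ) := [
  (5, 1), (125, 25), (130, 26), (135, 27), (140, 28), (145, 29)]

/-- Twenty groups, whose affine lines have distinct directions and cover 600 points. -/
def spreadGroups : List (ℕ × ℕ × List ℕ) := [
  (30, 125, [51, 48, 91, 89, 55]), (31, 130, [53, 49, 94, 87, 57]),
  (32, 135, [50, 45, 92, 85, 59]), (33, 140, [52, 46, 90, 88, 56]),
  (34, 145, [54, 47, 93, 86, 58]), (35, 375, [26, 98, 116, 114, 30]),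
  (36, 390, [27, 96, 115, 113, 31]), (37, 380, [28, 99, 119, 112, 32]),
  (38, 395, [29, 97, 118, 111, 33]), (39, 385, [25, 95, 117, 110, 34]),
  (40, 250, [101, 73, 41, 39, 105]), (41, 260, [100, 70, 42, 35, 109]),
  (42, 270, [104, 72, 43, 36, 108]), (43, 255, [103, 74, 44, 37, 107]),
  (44, 265, [102, 71, 40, 38, 106]), (45, 500, [76, 123, 66, 64, 80]),
  (46, 520, [79, 122, 68, 61, 83]), (47, 515, [77, 121, 65, 63, 81]),
  (48, 510, [75, 120, 67, 60, 84]), (49, 505, [78, 124, 69, 62, 82])]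

/-- Four groups whose affine lines cover no affine line in the direction of another group. -/
def fewGroups : List (ℕ × ℕ × List ℕ) := [
  (43, 256, [24, 108, 73, 22, 71]), (44, 127, [72, 0, 70, 95, 14]),
  (45, 269, [86, 104, 10, 98, 75]), (46, 23, [84, 47, 27, 12, 87])]

/-- A maximal partial spread of the solid with 22 lines, without seven of its lines. -/
def solidLines15 : List (ℕ × ℕ) := [
  (131, 41), (25, 1), (200, 8), (175, 7), (139, 37), (135, 42), (125, 38), (144, 31), (134, 33),
  (140, 35), (145, 36), (130, 39), (127, 30), (147, 34), (126, 40)]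

/-- Three lines of the regular spread. -/
def threeLines : List (ℕ × ℕ) := [
  (138, 47), (143, 48), (148, 49)]

/-- A maximal partial spread of the solid with 20 lines, without seven of its lines. -/
def solidLines13 : List (ℕ × ℕ) := [
  (131, 26), (135, 41), (149, 34), (129, 32), (139, 25), (125, 37), (5, 1), (140, 28), (145, 29),
  (132, 31), (134, 36), (144, 38), (126, 40)]

/-- A maximal partial spread of the solid with 19 lines, without seven of its lines. -/
def solidLines12 : List (ℕ × ℕ) := [
  (25, 1), (175, 7), (129, 41), (142, 32), (130, 39), (145, 36), (127, 30), (132, 31), (147, 34),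
  (139, 37), (144, 38), (136, 42)]

/-- A maximal partial spread of the solid with 18 lines, without seven of its lines. -/
def solidLines11 : List (ℕ × ℕ) := [
  (142, 32), (145, 36), (134, 29), (225, 9), (130, 40), (127, 30), (132, 31), (147, 34), (129, 35),
  (139, 37), (136, 42)]

/-- Affine lines through all but one point of the solid left uncovered. -/
def affineData1 : List (ℕ × ℕ) := [
  (453, 5), (125, 6), (329, 9), (59, 234), (83, 168), (42, 174), (123, 132), (253, 32), (35, 137),
  (107, 142), (21, 129), (20, 164), (86, 199), (14, 244), (92, 165), (111, 231), (58, 149),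
  (22, 158), (78, 201), (57, 235), (10, 136), (89, 153), (75, 249)]

/-- Seven groups for `affineData1`. -/
def groups1 : List (ℕ × ℕ × List ℕ) := [
  (43, 7, [24, 61, 73, 3, 8]), (44, 517, [98, 69, 15, 0, 81]), (45, 9, [115, 110, 85, 18, 26]),
  (46, 148, [102, 93, 13, 17, 100]), (47, 379, [101, 37, 112, 39, 41]),
  (48, 4, [66, 16, 117, 121, 80]), (49, 269, [38, 54, 36, 40, 108])]

/-- Affine lines through all but two points of the solid left uncovered. -/
def affineData2 : List (ℕ × ℕ) := [
  (303, 5), (29, 6), (177, 9), (4, 225), (65, 234), (123, 168), (109, 174), (108, 132), (61, 142),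
  (8, 129), (73, 164), (94, 199), (25, 244), (24, 165), (41, 231), (63, 149), (115, 158),
  (40, 201), (31, 235), (117, 136), (119, 153), (74, 249)]

/-- Seven groups for `affineData2`. -/
def groups2 : List (ℕ × ℕ × List ℕ) := [
  (43, 9, [81, 45, 113, 103, 56]), (44, 268, [90, 68, 107, 5, 19]),
  (45, 510, [12, 93, 46, 114, 92]), (46, 394, [50, 106, 22, 39, 20]),
  (47, 16, [100, 62, 120, 1, 59]), (48, 387, [15, 44, 17, 10, 11]),
  (49, 146, [96, 101, 32, 99, 53])]

/-- Affine lines through all but three points of the solid left uncovered. -/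
def affineData3 : List (ℕ × ℕ) := [
  (69, 225), (13, 234), (21, 168), (114, 174), (12, 132), (377, 32), (3, 137), (108, 142),
  (14, 129), (95, 164), (85, 199), (103, 244), (11, 165), (48, 231), (96, 149), (27, 158),
  (32, 201), (100, 235), (47, 136), (49, 153), (2, 249)]

/-- Seven groups for `affineData3`. -/
def groups3 : List (ℕ × ℕ × List ℕ) := [
  (43, 397, [26, 101, 65, 22, 0]), (44, 6, [50, 74, 91, 7, 97]), (45, 16, [86, 89, 51, 115, 110]),
  (46, 266, [119, 73, 38, 58, 54]), (47, 501, [61, 116, 105, 37, 92]),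
  (48, 257, [88, 80, 82, 99, 55]), (49, 143, [70, 62, 41, 57, 28])]

/-- Affine lines through all but four points of the solid left uncovered. -/
def affineData4 : List (ℕ × ℕ) := [
  (129, 5), (78, 6), (453, 9), (74, 225), (21, 234), (95, 168), (72, 174), (109, 132), (389, 32),
  (106, 137), (112, 142), (6, 165), (98, 231), (81, 149), (64, 158), (40, 201), (103, 235),
  (122, 136), (70, 153), (101, 249)]

/-- Seven groups for `affineData4`. -/
def groups4 : List (ℕ × ℕ × List ℕ) := [
  (43, 394, [105, 27, 110, 9, 0]), (44, 519, [73, 38, 104, 2, 46]),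
  (45, 516, [90, 45, 111, 82, 51]), (46, 257, [68, 113, 75, 15, 115]),
  (47, 10, [19, 12, 26, 94, 7]), (48, 501, [5, 102, 79, 29, 36]), (49, 268, [55, 4, 71, 119, 20])]

/-! ### Validity -/

theorem isValid_spread : Chain.isValid
    (regularChain spreadLines [] spreadGroups) 651 100 = true := by
  decide +kernel

theorem isValid_few647 : Chain.isValid
    (regularChain (solidLines15 ++ threeLines) [] fewGroups) 647 20 = true := by
  decide +kernel

theorem isValid_few645 : Chain.isValid
    (regularChain (solidLines13 ++ threeLines) [] fewGroups) 645 20 = true := by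
  decide +kernel

theorem isValid_few644 : Chain.isValid
    (regularChain (solidLines12 ++ threeLines) [] fewGroups) 644 20 = true := by
  decide +kernel

theorem isValid_few643 : Chain.isValid
    (regularChain (solidLines11 ++ threeLines) [] fewGroups) 643 20 = true := by
  decide +kernel

theorem isValid_affine1 : Chain.isValid
    (regularChain solidLines15 affineData1 groups1) 555 35 = true := by
  decide +kernel

theorem isValid_affine2 : Chain.isValid
    (regularChain solidLines15 affineData2 groups2) 559 35 = true := by
  decide +kernel

theorem isValid_affine3 : Chain.isValid
    (regularChain solidLines15 affineData3 groups3) 563 35 = true := by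
  decide +kernel

theorem isValid_affine4 : Chain.isValid
    (regularChain solidLines15 affineData4 groups4) 567 35 = true := by
  decide +kernel

/-- In PG(5,5), there exist maximal partial line spreads of size 151 + 5*k for
every integer k with 0 ≤ k ≤ 49, of every size n with 399 ≤ n ≤ 647, and of
size 651 (a spread). -/
theorem stmt13 (F : Type*) [Field F] [Fintype F] (hq : Fintype.card F = 5) :
    (∀ k : ℕ, k ≤ 49 → ∃ S : Set (Submodule F (Fin 6 → F)),
      IsMaximalPartialLineSpread F 6 S ∧ S.ncard = 151 + 5 * k) ∧
    (∀ n : ℕ, 399 ≤ n → n ≤ 647 → ∃ S : Set (Submodule F (Fin 6 → F)),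
      IsMaximalPartialLineSpread F 6 S ∧ S.ncard = n) ∧
    (∃ S : Set (Submodule F (Fin 6 → F)),
      IsMaximalPartialLineSpread F 6 S ∧ S.ncard = 651) := by
  have : Fact (Nat.Prime 5) := ⟨by norm_num⟩
  have : CharP F 5 := charP_of_card_eq_prime hq
  have hF : ∀ x : F, ∃ k < 5, ((k : ℕ) : F) = x := fun x => by
    obtain ⟨z, rfl⟩ := (ZMod.castHom_bijective F hq).2 x
    exact ⟨z.val, z.val_lt, by simp⟩
  have spread : ∀ N : ℕ, (∃ j ≤ 100, N + 5 * j = 651) →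
      ∃ S : Set (Submodule F (Fin 6 → F)), IsMaximalPartialLineSpread F 6 S ∧ S.ncard = N :=
    fun _ => Chain.exists_spread hF isValid_spread
  refine ⟨fun k hk => spread _ ⟨100 - k, by omega, by omega⟩, fun n h₁ h₂ => ?_,
    spread _ ⟨0, by omega, rfl⟩⟩
  have hmod : n % 5 < 5 := Nat.mod_lt _ (by norm_num)
  rcases lt_or_ge 567 n with hlarge | hsmall <;> interval_cases hr : n % 5
  · exact Chain.exists_spread hF isValid_few645 ⟨(645 - n) / 5, by omega, by omega⟩
  · exact spread _ ⟨(651 - n) / 5, by omega, by omega⟩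
  · exact Chain.exists_spread hF isValid_few647 ⟨(647 - n) / 5, by omega, by omega⟩
  · exact Chain.exists_spread hF isValid_few643 ⟨(643 - n) / 5, by omega, by omega⟩
  · exact Chain.exists_spread hF isValid_few644 ⟨(644 - n) / 5, by omega, by omega⟩
  · rcases lt_or_ge 555 n with h | h
    · exact Chain.exists_spread hF isValid_few645 ⟨(645 - n) / 5, by omega, by omega⟩
    · exact Chain.exists_spread hF isValid_affine1 ⟨(555 - n) / 5, by omega, by omega⟩
  · exact spread _ ⟨(651 - n) / 5, by omega, by omega⟩
  · exact Chain.exists_spread hF isValid_affine4 ⟨(567 - n) / 5, by omega, by omega⟩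
  · rcases lt_or_ge 563 n with h | h
    · exact Chain.exists_spread hF isValid_few643 ⟨(643 - n) / 5, by omega, by omega⟩
    · exact Chain.exists_spread hF isValid_affine3 ⟨(563 - n) / 5, by omega, by omega⟩
  · rcases lt_or_ge 559 n with h | h
    · exact Chain.exists_spread hF isValid_few644 ⟨(644 - n) / 5, by omega, by omega⟩
    · exact Chain.exists_spread hF isValid_affine2 ⟨(559 - n) / 5, by omega, by omega⟩
end

section
/- In PG(5,7), there exist maximal partial line spreads of size 393 + 7k for every integer k with 0 ≤ k ≤ 163. -/
/-- A family of injective maps from a plane into `V`, whose images pairwise meet only in zero and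
together cover a hyperplane, gives a maximal partial line spread. -/
theorem exists_isMaximalPartialLineSpread_of_family {F ι P V : Type*} [Field F] [AddCommGroup P]
    [Module F P] [AddCommGroup V] [Module F V] [FiniteDimensional F V] {n : ℕ}
    (hP : Module.finrank F P = 2) (hV : Module.finrank F V = n) (φ : ι → P →ₗ[F] V)
    (hinj : ∀ i, Function.Injective (φ i))
    (hdisj : ∀ i j p p', p ≠ 0 → p' ≠ 0 → φ i p = φ j p' → i = j)
    (h : V →ₗ[F] F) (hcov : ∀ v, v ≠ 0 → h v = 0 → ∃ i p, φ i p = v) :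
    ∃ S : Set (Submodule F (Fin n → F)),
      IsMaximalPartialLineSpread F n S ∧ S.ncard = Nat.card ι := by
  let e : V ≃ₗ[F] (Fin n → F) := LinearEquiv.ofFinrankEq _ _ (by simp [hV])
  let ℓ : ι → Submodule F (Fin n → F) := fun i => LinearMap.range (e.toLinearMap ∘ₗ φ i)
  have hinj' : ∀ i, Function.Injective (e.toLinearMap ∘ₗ φ i) := fun i =>
    e.injective.comp (hinj i)
  have hrank : ∀ i, Module.finrank F (ℓ i) = 2 := fun i => by
    rw [LinearMap.finrank_range_of_inj (hinj' i), hP]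
  have hmeet : ∀ i j, ℓ i ⊓ ℓ j ≠ ⊥ → i = j := by
    intro i j hij
    obtain ⟨v, ⟨⟨p, rfl⟩, ⟨p', hp'⟩⟩, hv⟩ := Submodule.exists_mem_ne_zero_of_ne_bot hij
    refine hdisj i j p p' ?_ ?_ (e.injective hp'.symm)
    · rintro rfl
      exact hv (map_zero _)
    · rintro rfl
      exact hv (hp'.symm.trans (map_zero _))
  have hne : ∀ i, ℓ i ≠ ⊥ := fun i hi => by
    have := hrank i
    rw [hi, finrank_bot] at this
    omega
  refine ⟨Set.range ℓ, ⟨⟨?_, ?_⟩, ?_⟩, ?_⟩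
  · rintro _ ⟨i, rfl⟩
    exact hrank i
  · rintro _ ⟨i, rfl⟩ _ ⟨j, rfl⟩ hij
    by_contra hb
    exact hij (congrArg ℓ (hmeet i j hb))
  · intro m hm
    let g : m →ₗ[F] F := h ∘ₗ e.symm.toLinearMap ∘ₗ m.subtype
    have hg : LinearMap.ker g ≠ ⊥ := LinearMap.ker_ne_bot_of_finrank_lt (by simp [hm])
    obtain ⟨⟨w, hw⟩, hker, hw0⟩ := Submodule.exists_mem_ne_zero_of_ne_bot hg
    have hw0' : w ≠ 0 := fun h0 => hw0 (Subtype.ext h0)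
    obtain ⟨i, p, hp⟩ := hcov (e.symm w) (by simpa using hw0') hker
    refine ⟨ℓ i, ⟨i, rfl⟩, fun hb => hw0' ?_⟩
    rw [← Submodule.mem_bot F, ← hb]
    exact ⟨hw, p, by simp [hp]⟩
  · rw [← Set.image_univ, Set.ncard_image_of_injective _ (fun i j hij => hmeet i j ?_),
      Set.ncard_univ]
    rw [← hij, inf_idem]
    exact hne i

namespace LineSpread

/-- The quadratic algebra obtained by adjoining a square root of `-1`. -/
abbrev Quad (F : Type*) [Field F] : Type _ := QuadraticAlgebra F (-1) 0

section Lines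

variable {F : Type*} [Field F]

/-- The map `y ↦ b y` from `⟨1, θ⟩` to the cubic algebra `F[θ]`, `θ ^ 3 = 2`, followed by the
projection to the coefficients of `1` and `θ`. -/
def liftX (b : F × F × F) : Quad F →ₗ[F] Quad F where
  toFun y := ⟨b.1 * y.re + 2 * b.2.2 * y.im, b.2.1 * y.re + b.1 * y.im⟩
  map_add' y y' := by ext <;> simp <;> ring
  map_smul' r y := by ext <;> simp <;> ring

/-- The map `y ↦ b y` from `⟨1, θ⟩` to the cubic algebra `F[θ]`, `θ ^ 3 = 2`, followed by the
projection to the coefficient of `θ ^ 2`. -/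
def liftT (b : F × F × F) : Quad F →ₗ[F] F where
  toFun y := b.2.2 * y.re + b.2.1 * y.im
  map_add' y y' := by simp; ring
  map_smul' r y := by simp; ring

@[simp] theorem liftX_re (b : F × F × F) (y : Quad F) :
    (liftX b y).re = b.1 * y.re + 2 * b.2.2 * y.im := rfl

@[simp] theorem liftX_im (b : F × F × F) (y : Quad F) :
    (liftX b y).im = b.2.1 * y.re + b.1 * y.im := rfl

theorem liftT_apply (b : F × F × F) (y : Quad F) :
    liftT b y = b.2.2 * y.re + b.2.1 * y.im := rfl

theorem cubic_norm_ne_zero (hF : ∀ r s : F, r ^ 3 + 2 * s ^ 3 = 0 → r = 0 ∧ s = 0)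
    {y : Quad F} (hy : y ≠ 0) : y.re ^ 3 + 2 * y.im ^ 3 ≠ 0 := fun h =>
  hy (QuadraticAlgebra.ext (hF _ _ h).1 (hF _ _ h).2)

theorem lift_injective (hF : ∀ r s : F, r ^ 3 + 2 * s ^ 3 = 0 → r = 0 ∧ s = 0)
    {y : Quad F} (hy : y ≠ 0) {b b' : F × F × F} (hX : liftX b y = liftX b' y)
    (hT : liftT b y = liftT b' y) : b = b' := by
  have hN := cubic_norm_ne_zero hF hy
  obtain ⟨b0, b1, b2⟩ := b
  obtain ⟨c0, c1, c2⟩ := b'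
  have h0 := congrArg QuadraticAlgebra.re hX
  have h1 := congrArg QuadraticAlgebra.im hX
  simp only [liftX_re, liftX_im, liftT_apply] at h0 h1 hT
  ext
  · refine mul_left_cancel₀ hN ?_
    linear_combination y.re ^ 2 * h0 + 2 * y.im ^ 2 * h1 - 2 * y.re * y.im * hT
  · refine mul_left_cancel₀ hN ?_
    linear_combination -y.re * y.im * h0 + y.re ^ 2 * h1 + 2 * y.im ^ 2 * hT
  · refine mul_left_cancel₀ hN ?_
    linear_combination y.im ^ 2 * h0 - y.re * y.im * h1 + y.re ^ 2 * hT

theorem lift_surjective (hF : ∀ r s : F, r ^ 3 + 2 * s ^ 3 = 0 → r = 0 ∧ s = 0)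
    {y : Quad F} (hy : y ≠ 0) (x : Quad F) (t : F) :
    ∃ b, liftX b y = x ∧ liftT b y = t := by
  have hN := mul_inv_cancel₀ (cubic_norm_ne_zero hF hy)
  set n := (y.re ^ 3 + 2 * y.im ^ 3)⁻¹
  refine ⟨((y.re ^ 2 * x.re + 2 * y.im ^ 2 * x.im - 2 * y.re * y.im * t) * n,
    (-y.re * y.im * x.re + y.re ^ 2 * x.im + 2 * y.im ^ 2 * t) * n,
    (y.im ^ 2 * x.re - y.re * y.im * x.im + y.re ^ 2 * t) * n), ?_, ?_⟩
  · ext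
    · rw [liftX_re]
      linear_combination x.re * hN
    · rw [liftX_im]
      linear_combination x.im * hN
  · rw [liftT_apply]
    linear_combination t * hN

/-- A generator of the kernel of `liftT b`, if that kernel is one-dimensional. -/
def pivot (b : F × F × F) : Quad F := ⟨b.2.1, -b.2.2⟩

theorem liftT_pivot (b : F × F × F) : liftT b (pivot b) = 0 := by
  rw [liftT_apply]
  simp only [pivot]
  ring

theorem pivot_ne_zero {b : F × F × F} (hb : b.2.2 ≠ 0) : pivot b ≠ 0 := fun h =>
  hb (neg_eq_zero.mp (congrArg QuadraticAlgebra.im h))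

theorem eq_smul_pivot {b : F × F × F} (hb : b.2.2 ≠ 0) {y : Quad F} (hy : liftT b y = 0) :
    y = (-y.im / b.2.2) • pivot b := by
  rw [liftT_apply] at hy
  ext
  · simp only [QuadraticAlgebra.re_smul, pivot, smul_eq_mul]
    field_simp
    linear_combination hy
  · simp only [QuadraticAlgebra.im_smul, pivot, smul_eq_mul]
    field_simp

/-- The graph of `y ↦ (liftX b y, liftT b y)`, with coordinates ordered `(x, y, z)`. -/
def graph (b : F × F × F) : Quad F →ₗ[F] Quad F × Quad F × Quad F :=
  (liftX b).prod (LinearMap.id.prod (Algebra.linearMap F (Quad F) ∘ₗ liftT b))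

@[simp] theorem graph_apply (b : F × F × F) (y : Quad F) :
    graph b y = (liftX b y, y, algebraMap F (Quad F) (liftT b y)) := rfl

/-- The `Quad F`-span of `(x, y, 1)`. -/
def cone (x y : Quad F) : Quad F →ₗ[F] Quad F × Quad F × Quad F :=
  (LinearMap.mulLeft F x).prod ((LinearMap.mulLeft F y).prod LinearMap.id)

@[simp] theorem cone_apply (x y z : Quad F) : cone x y z = (x * z, y * z, z) := rfl

/-- The points of `liftT b y = 1`, parametrized by their imaginary part. -/
def unitPoint (b : F × F × F) (u : F) : Quad F := ⟨(1 - b.2.1 * u) / b.2.2, u⟩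

theorem liftT_unitPoint {b : F × F × F} (hb : b.2.2 ≠ 0) (u : F) :
    liftT b (unitPoint b u) = 1 := by
  rw [liftT_apply]
  simp only [unitPoint]
  field_simp
  ring

theorem eq_unitPoint {b : F × F × F} (hb : b.2.2 ≠ 0) {y : Quad F} (hy : liftT b y = 1) :
    y = unitPoint b y.im := by
  rw [liftT_apply] at hy
  ext
  · simp only [unitPoint]
    field_simp
    linear_combination hy
  · rfl

/-- The ratio `x / y` at the point of the graph of `b` with `z = 0`. -/
def slope (b : F × F × F) : Quad F := liftX b (pivot b) / pivot b

/-- The parameter of the graph through `(slope b, 1, 0)`. -/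
def special (b : F × F × F) : F × F × F := ((slope b).re, (slope b).im, 0)

theorem liftX_special (b : F × F × F) {u : Quad F} (hu : u.im = 0) :
    liftX (special b) u = slope b * u := by
  ext <;> simp [special, hu]

theorem liftT_special (b : F × F × F) (u : Quad F) :
    liftT (special b) u = (slope b).im * u.im := by
  rw [liftT_apply]
  simp [special]

theorem slope_eq_of_special_eq {b b' : F × F × F} (h : special b = special b') :
    slope b = slope b' :=
  QuadraticAlgebra.ext (congrArg Prod.fst h) (congrArg (fun v => v.2.1) h)

theorem eq_algebraMap_re {u : Quad F} (hu : u.im = 0) : u = algebraMap F (Quad F) u.re :=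
  QuadraticAlgebra.ext rfl hu

end Lines

section Family

variable {F : Type*} [Field F] [Fact (∀ r : F, r ^ 2 ≠ -1 + 0 * r)]

theorem slope_mul_pivot {b : F × F × F} (hb : b.2.2 ≠ 0) :
    slope b * pivot b = liftX b (pivot b) := div_mul_cancel₀ _ (pivot_ne_zero hb)

theorem slope_im_ne_zero (hF : ∀ r s : F, r ^ 3 + 2 * s ^ 3 = 0 → r = 0 ∧ s = 0)
    {b : F × F × F} (hb : b.2.2 ≠ 0) : (slope b).im ≠ 0 := by
  intro h
  have hmul := slope_mul_pivot hb
  have h0 := congrArg QuadraticAlgebra.re hmul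
  have h1 := congrArg QuadraticAlgebra.im hmul
  simp only [QuadraticAlgebra.re_mul, QuadraticAlgebra.im_mul, liftX_re, liftX_im, pivot, h]
    at h0 h1
  refine hb (neg_eq_zero.mp (hF b.2.1 (-b.2.2) ?_).2)
  linear_combination -b.2.2 * h0 - b.2.1 * h1

theorem eq_of_lift_pivot_eq (hF : ∀ r s : F, r ^ 3 + 2 * s ^ 3 = 0 → r = 0 ∧ s = 0)
    {b b' : F × F × F} (hb : b.2.2 ≠ 0) (hX : liftX b' (pivot b) = slope b * pivot b)
    (hT : liftT b' (pivot b) = 0) : b = b' :=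
  lift_injective hF (pivot_ne_zero hb) (by rw [hX, slope_mul_pivot hb])
    (by rw [hT, liftT_pivot])

theorem eq_of_slope_eq (hF : ∀ r s : F, r ^ 3 + 2 * s ^ 3 = 0 → r = 0 ∧ s = 0)
    {b b' : F × F × F} (hb : b.2.2 ≠ 0) (hb' : b'.2.2 ≠ 0) (h : slope b = slope b') {s : F}
    (hs : pivot b = algebraMap F (Quad F) s * pivot b') : b = b' := by
  rw [← Algebra.smul_def] at hs
  refine eq_of_lift_pivot_eq hF hb ?_ ?_
  · rw [hs, map_smul, h, ← slope_mul_pivot hb', mul_smul_comm]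
  · rw [hs, map_smul, liftT_pivot, smul_zero]

theorem graph_ne_smul_graph_special (hF : ∀ r s : F, r ^ 3 + 2 * s ^ 3 = 0 → r = 0 ∧ s = 0)
    {b b' : F × F × F} (hb : b.2.2 ≠ 0) (hne : b ≠ b') {p p' : Quad F} (hp' : p' ≠ 0) :
    graph b' p ≠ pivot b • graph (special b) p' := by
  intro h
  simp only [graph_apply, Prod.smul_mk, smul_eq_mul, Prod.mk.injEq] at h
  obtain ⟨hx, rfl, hz⟩ := h
  by_cases hu : p'.im = 0
  · rw [liftX_special b hu] at hx
    rw [liftT_special, hu, mul_zero, map_zero, mul_zero,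
      map_eq_zero_iff _ QuadraticAlgebra.algebraMap_injective] at hz
    have hr : p'.re ≠ 0 := fun h0 => hp' (QuadraticAlgebra.ext h0 hu)
    have hpiv : pivot b * p' = p'.re • pivot b := by
      rw [Algebra.smul_def, ← eq_algebraMap_re hu, mul_comm]
    refine hne (eq_of_lift_pivot_eq hF hb ?_ ?_)
    · rw [mul_left_comm, hpiv, map_smul, mul_smul_comm] at hx
      exact smul_right_injective _ hr hx
    · rw [hpiv, map_smul] at hz
      exact (smul_eq_zero.mp hz).resolve_left hr
  · have him := congrArg QuadraticAlgebra.im hz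
    rw [liftT_special] at him
    simp [pivot, hb, hu, slope_im_ne_zero hF hb] at him

theorem eq_of_smul_graph_special_eq
    (hF : ∀ r s : F, r ^ 3 + 2 * s ^ 3 = 0 → r = 0 ∧ s = 0)
    {b b' : F × F × F} (hb : b.2.2 ≠ 0) (hb' : b'.2.2 ≠ 0) {p p' : Quad F} (hp : p ≠ 0)
    (h : pivot b • graph (special b) p = pivot b' • graph (special b') p') : b = b' := by
  simp only [graph_apply, Prod.smul_mk, smul_eq_mul, Prod.mk.injEq] at h
  obtain ⟨hx, hy, hz⟩ := h
  have hm := pivot_ne_zero hb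
  have hm' := pivot_ne_zero hb'
  by_cases hu : p.im = 0
  · have hu' : p'.im = 0 := by
      rw [liftT_special, hu, mul_zero, map_zero, mul_zero, eq_comm] at hz
      have := (mul_eq_zero.mp hz).resolve_left hm'
      rw [map_eq_zero_iff _ QuadraticAlgebra.algebraMap_injective, liftT_special] at this
      exact (mul_eq_zero.mp this).resolve_left (slope_im_ne_zero hF hb')
    rw [liftX_special b hu, liftX_special b' hu', mul_left_comm, mul_left_comm (pivot b'),
      ← hy] at hx
    refine eq_of_slope_eq hF hb hb' (mul_right_cancel₀ (mul_ne_zero hm hp) hx)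
      (s := p'.re / p.re) ?_
    rw [map_div₀, ← eq_algebraMap_re hu, ← eq_algebraMap_re hu', div_mul_eq_mul_div, eq_div_iff hp,
      hy, mul_comm]
  · have ht : algebraMap F (Quad F) (liftT (special b) p) ≠ 0 := by
      rw [Ne, map_eq_zero_iff _ QuadraticAlgebra.algebraMap_injective, liftT_special]
      exact mul_ne_zero (slope_im_ne_zero hF hb) hu
    obtain ⟨s, hs⟩ : ∃ s, s = liftT (special b') p' / liftT (special b) p := ⟨_, rfl⟩
    have hs' : algebraMap F (Quad F) (liftT (special b') p') =
        algebraMap F (Quad F) s * algebraMap F (Quad F) (liftT (special b) p) := by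
      rw [hs, map_div₀, div_mul_cancel₀ _ ht]
    have hpiv : pivot b = algebraMap F (Quad F) s * pivot b' := by
      refine mul_right_cancel₀ ht ?_
      rw [hz, hs']
      ring
    have hs0 : s ≠ 0 := by
      rintro rfl
      exact hm (by rw [hpiv, map_zero, zero_mul])
    have hp' : p' = s • p := by
      rw [Algebra.smul_def]
      refine mul_left_cancel₀ hm' ?_
      rw [← hy, hpiv]
      ring
    refine eq_of_slope_eq hF hb hb' (slope_eq_of_special_eq (lift_injective hF hp ?_ ?_)) hpiv
    · refine mul_left_cancel₀ hm ?_
      rw [hx, hp', map_smul, hpiv, Algebra.smul_def]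
      ring
    · rw [← map_mul, QuadraticAlgebra.algebraMap_inj, hp', map_smul, smul_eq_mul] at hs'
      exact (mul_left_cancel₀ hs0 hs').symm

/-- A graph meeting the `Quad F`-line through a point of a graph of `b` in `z = 1`, up to a
multiple, is that graph. -/
theorem eq_of_smul_graph_eq_cone (hF : ∀ r s : F, r ^ 3 + 2 * s ^ 3 = 0 → r = 0 ∧ s = 0)
    {b b' : F × F × F} {m y p z : Quad F} (hm : m ≠ 0) (hp : p ≠ 0) (hy : liftT b y = 1)
    (h : m • graph b' p = cone (liftX b y) y z) : b = b' := by
  simp only [graph_apply, cone_apply, Prod.smul_mk, smul_eq_mul, Prod.mk.injEq] at h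
  obtain ⟨hx, hy', rfl⟩ := h
  have hpy : p = liftT b' p • y := by
    rw [Algebra.smul_def]
    refine mul_left_cancel₀ hm ?_
    rw [hy']
    ring
  refine lift_injective hF hp ?_ ?_
  · refine mul_left_cancel₀ hm ?_
    rw [hx]
    conv_lhs => rw [hpy, map_smul, Algebra.smul_def]
    ring
  · conv_lhs => rw [hpy, map_smul, hy, smul_eq_mul, mul_one]

variable (Q : Finset (F × F × F))

/-- Labels of the lines of the spread obtained by modifying the graphs labelled by `Q`. -/
abbrev Index : Type _ := Unit ⊕ {b // b ∉ Q} ⊕ Quad F ⊕ Q ⊕ (Q × F)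

/-- The spread: the line `y = z = 0`, the graphs not labelled by `Q`, the `Quad F`-lines through
the points `(x, 0, 1)`, and for every `b ∈ Q` a family of lines covering the points of the graph
of `b`: a multiple of a special graph for the point with `z = 0`, and the `Quad F`-lines through
the other points. -/
def line : Index Q → Quad F →ₗ[F] Quad F × Quad F × Quad F
  | .inl _ => LinearMap.inl F _ _
  | .inr (.inl b) => graph b.1
  | .inr (.inr (.inl w)) => cone w 0
  | .inr (.inr (.inr (.inl b))) => pivot b.1 • graph (special b.1)
  | .inr (.inr (.inr (.inr (b, u)))) => cone (liftX b.1 (unitPoint b.1 u)) (unitPoint b.1 u)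

variable {Q}

theorem line_injective (hQ : ∀ b ∈ Q, b.2.2 ≠ 0) (i : Index Q) :
    Function.Injective (line Q i) := by
  rw [← LinearMap.ker_eq_bot, LinearMap.ker_eq_bot']
  intro p hp
  rcases i with i | b | w | ⟨b, hb⟩ | ⟨b, u⟩
  · exact congrArg Prod.fst hp
  · exact congrArg (fun v => v.2.1) hp
  · exact congrArg (fun v => v.2.2) hp
  · have h : pivot b * p = 0 := congrArg (fun v => v.2.1) hp
    exact (mul_eq_zero.mp h).resolve_left (pivot_ne_zero (hQ b hb))
  · exact congrArg (fun v => v.2.2) hp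

theorem line_disjoint (hF : ∀ r s : F, r ^ 3 + 2 * s ^ 3 = 0 → r = 0 ∧ s = 0)
    (hQ : ∀ b ∈ Q, b.2.2 ≠ 0) (i j : Index Q) (p p' : Quad F) (hp : p ≠ 0) (hp' : p' ≠ 0)
    (h : line Q i p = line Q j p') : i = j := by
  have hsec : ∀ b ∈ Q, ∀ u, unitPoint b u ≠ 0 := fun b hb u h0 => by
    have := liftT_unitPoint (hQ b hb) u
    rw [h0, map_zero] at this
    exact zero_ne_one this
  have hgc : ∀ b ∉ Q, ∀ b' ∈ Q, ∀ u, ∀ p p' : Quad F, p ≠ 0 →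
      graph b p ≠ cone (liftX b' (unitPoint b' u)) (unitPoint b' u) p' := by
    intro b hb b' hb' u p p' hp h
    have := eq_of_smul_graph_eq_cone hF one_ne_zero hp (liftT_unitPoint (hQ b' hb') u)
      ((one_smul _ _).trans h)
    exact hb (this ▸ hb')
  have hsc : ∀ b ∈ Q, ∀ b' ∈ Q, ∀ u, ∀ p p' : Quad F, p ≠ 0 →
      pivot b • graph (special b) p ≠
        cone (liftX b' (unitPoint b' u)) (unitPoint b' u) p' := by
    intro b hb b' hb' u p p' hp h
    have := eq_of_smul_graph_eq_cone hF (pivot_ne_zero (hQ b hb)) hp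
      (liftT_unitPoint (hQ b' hb') u) h
    exact hQ b' hb' (by rw [this]; rfl)
  have hgs : ∀ b ∉ Q, ∀ b' ∈ Q, ∀ p p' : Quad F, p' ≠ 0 →
      graph b p ≠ pivot b' • graph (special b') p' := fun b hb b' hb' p p' hp' =>
    graph_ne_smul_graph_special hF (hQ b' hb') (fun h => hb (by rwa [← h])) hp'
  rcases i with i | ⟨b, hb⟩ | w | ⟨b, hb⟩ | ⟨⟨b, hb⟩, u⟩ <;>
    rcases j with j | ⟨b', hb'⟩ | w' | ⟨b', hb'⟩ | ⟨⟨b', hb'⟩, u'⟩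
  · rfl
  · exact absurd (congrArg (fun v => v.2.1) h).symm hp'
  · exact absurd (congrArg (fun v => v.2.2) h).symm hp'
  · exact absurd (congrArg (fun v => v.2.1) h).symm
      (mul_ne_zero (pivot_ne_zero (hQ b' hb')) hp')
  · exact absurd (congrArg (fun v => v.2.1) h).symm
      (mul_ne_zero (hsec b' hb' u') hp')
  · exact absurd (congrArg (fun v => v.2.1) h) hp
  · simp only [line, graph_apply, Prod.mk.injEq] at h
    obtain ⟨hx, rfl, hz⟩ := h
    have := lift_injective hF hp hx (QuadraticAlgebra.algebraMap_injective hz)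
    subst this
    rfl
  · exact absurd ((congrArg (fun v => v.2.1) h).trans (zero_mul p')) hp
  · exact absurd h (hgs b hb b' hb' p p' hp')
  · exact absurd h (hgc b hb b' hb' u' p p' hp)
  · exact absurd (congrArg (fun v => v.2.2) h) hp
  · exact absurd ((zero_mul p).symm.trans (congrArg (fun v => v.2.1) h)).symm hp'
  · have hz : p = p' := congrArg (fun v => v.2.2) h
    have hx : w * p = w' * p' := congrArg Prod.fst h
    rw [← hz] at hx
    rw [mul_right_cancel₀ hp hx]
  · exact absurd ((zero_mul p).symm.trans (congrArg (fun v => v.2.1) h)).symm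
      (mul_ne_zero (pivot_ne_zero (hQ b' hb')) hp')
  · exact absurd ((zero_mul p).symm.trans (congrArg (fun v => v.2.1) h)).symm
      (mul_ne_zero (hsec b' hb' u') hp')
  · exact absurd (congrArg (fun v => v.2.1) h)
      (mul_ne_zero (pivot_ne_zero (hQ b hb)) hp)
  · exact absurd h.symm (hgs b' hb' b hb p' p hp)
  · exact absurd ((congrArg (fun v => v.2.1) h).trans (zero_mul p'))
      (mul_ne_zero (pivot_ne_zero (hQ b hb)) hp)
  · have := eq_of_smul_graph_special_eq hF (hQ b hb) (hQ b' hb') hp h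
    subst this
    rfl
  · exact absurd h (hsc b hb b' hb' u' p p' hp)
  · exact absurd (congrArg (fun v => v.2.1) h)
      (mul_ne_zero (hsec b hb u) hp)
  · exact absurd h.symm (hgc b' hb' b hb u p' p hp')
  · exact absurd ((congrArg (fun v => v.2.1) h).trans (zero_mul p'))
      (mul_ne_zero (hsec b hb u) hp)
  · exact absurd h.symm (hsc b' hb' b hb u p' p hp')
  · simp only [line, cone_apply, Prod.mk.injEq] at h
    obtain ⟨hx, hy, rfl⟩ := h
    have hx' := mul_right_cancel₀ hp hx
    have hy' := mul_right_cancel₀ hp hy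
    have hu : u = u' := congrArg QuadraticAlgebra.im hy'
    have hbb : b = b' := by
      refine lift_injective hF (hsec b hb u) ?_ ?_
      · rw [hx', hy']
      · rw [liftT_unitPoint (hQ b hb), hy', liftT_unitPoint (hQ b' hb')]
    subst hu hbb
    rfl

theorem exists_line_eq (hF : ∀ r s : F, r ^ 3 + 2 * s ^ 3 = 0 → r = 0 ∧ s = 0)
    (hQ : ∀ b ∈ Q, b.2.2 ≠ 0) (v : Quad F × Quad F × Quad F) (hv : v.2.2.im = 0) :
    ∃ i p, line Q i p = v := by
  obtain ⟨x, y, z⟩ := v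
  obtain ⟨t, rfl⟩ : ∃ t, z = algebraMap F (Quad F) t := ⟨_, eq_algebraMap_re hv⟩
  by_cases hy : y = 0
  · subst hy
    by_cases ht : t = 0
    · exact ⟨.inl (), x, by simp only [line, ht, map_zero]; rfl⟩
    · have ht' : algebraMap F (Quad F) t ≠ 0 := by
        rwa [Ne, map_eq_zero_iff _ QuadraticAlgebra.algebraMap_injective]
      exact ⟨.inr (.inr (.inl (x / algebraMap F (Quad F) t))), algebraMap F (Quad F) t,
        by simp only [line, cone_apply, zero_mul, div_mul_cancel₀ _ ht']⟩
  obtain ⟨b, rfl, rfl⟩ := lift_surjective hF hy x t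
  by_cases hb : b ∈ Q
  · by_cases ht : liftT b y = 0
    · obtain ⟨r, hr⟩ : ∃ r : F, y = r • pivot b := ⟨_, eq_smul_pivot (hQ b hb) ht⟩
      refine ⟨.inr (.inr (.inr (.inl ⟨b, hb⟩))), algebraMap F (Quad F) r, ?_⟩
      simp only [line, LinearMap.smul_apply, graph_apply, Prod.smul_mk, smul_eq_mul,
        Prod.mk.injEq]
      refine ⟨?_, ?_, ?_⟩
      · rw [liftX_special b (QuadraticAlgebra.algebraMap_im _), hr, map_smul,
          ← slope_mul_pivot (hQ b hb), Algebra.smul_def]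
        ring
      · rw [hr, Algebra.smul_def, mul_comm]
      · rw [liftT_special, ht]
        simp
    · have hy1 : liftT b ((liftT b y)⁻¹ • y) = 1 := by
        rw [map_smul, smul_eq_mul, inv_mul_cancel₀ ht]
      refine ⟨.inr (.inr (.inr (.inr (⟨b, hb⟩, ((liftT b y)⁻¹ • y).im)))),
        algebraMap F (Quad F) (liftT b y), ?_⟩
      simp only [line, cone_apply]
      rw [← eq_unitPoint (hQ b hb) hy1, map_smul, mul_comm, ← Algebra.smul_def,
        smul_inv_smul₀ ht, mul_comm, ← Algebra.smul_def, smul_inv_smul₀ ht]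
  · exact ⟨.inr (.inl ⟨b, hb⟩), y, rfl⟩

end Family

end LineSpread

/-- In PG(5,7), there exist maximal partial line spreads of size 393 + 7k for
every integer k with 0 ≤ k ≤ 163. -/
theorem stmt14 (F : Type*) [Field F] [Fintype F] (hq : Fintype.card F = 7) :
    ∀ k : ℕ, k ≤ 163 → ∃ S : Set (Submodule F (Fin 6 → F)),
      IsMaximalPartialLineSpread F 6 S ∧ S.ncard = 393 + 7 * k := by
  intro k hk
  let e : ZMod 7 ≃+* F := ZMod.ringEquivOfPrime F (by norm_num) hq
  have hsq : ∀ r : ZMod 7, r ^ 2 ≠ -1 := by decide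
  have hcub : ∀ r s : ZMod 7, r ^ 3 + 2 * s ^ 3 = 0 → r = 0 ∧ s = 0 := by decide
  have : Fact (∀ r : F, r ^ 2 ≠ -1 + 0 * r) := ⟨fun r hr => hsq (e.symm r) (by
    rw [← map_pow, hr]
    simp)⟩
  have hF : ∀ r s : F, r ^ 3 + 2 * s ^ 3 = 0 → r = 0 ∧ s = 0 := by
    intro r s h
    have h2 : e.symm 2 = 2 := map_ofNat e.symm 2
    simpa using hcub (e.symm r) (e.symm s) (by simpa [h2] using congrArg e.symm h)
  classical
  obtain ⟨Q, hQsub, hQk⟩ : ∃ Q ⊆ (Finset.univ : Finset F) ×ˢ (Finset.univ : Finset F) ×ˢ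
      (Finset.univ.erase (0 : F)), Q.card = k := by
    refine Finset.exists_subset_card_eq ?_
    simp [Finset.card_product, hq]
    omega
  have hQ : ∀ b ∈ Q, b.2.2 ≠ 0 := fun b hb => by simpa using hQsub hb
  obtain ⟨S, hS, hcard⟩ := exists_isMaximalPartialLineSpread_of_family (n := 6)
    (QuadraticAlgebra.finrank_eq_two (-1 : F) 0)
    (by simp [QuadraticAlgebra.finrank_eq_two]) (LineSpread.line Q)
    (LineSpread.line_injective hQ) (LineSpread.line_disjoint hF hQ)
    (QuadraticAlgebra.imₗ _ _ ∘ₗ LinearMap.snd F _ _ ∘ₗ LinearMap.snd F _ _)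
    (fun v _ hv => LineSpread.exists_line_eq hF hQ v hv)
  refine ⟨S, hS, hcard.trans ?_⟩
  have : Fintype (LineSpread.Quad F) := Fintype.ofEquiv _ (QuadraticAlgebra.equivProd _ _).symm
  have hquad : Fintype.card (LineSpread.Quad F) = 49 := by
    rw [Fintype.card_congr (QuadraticAlgebra.equivProd _ _), Fintype.card_prod, hq]
  have hcompl : Fintype.card {b // b ∉ Q} = 343 - k := by
    rw [Fintype.card_subtype_compl]
    simp [hq, hQk]
  rw [Nat.card_eq_fintype_card]
  simp only [Fintype.card_sum, Fintype.card_prod, Fintype.card_unit, Fintype.card_coe, hquad,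
    hcompl, hQk, hq]
  omega
end

section
/- In PG(5,q), for q = 3, 4, 5, there exist maximal partial line spreads of every integer size n with 2q^3·log q ≤ n ≤ (q^6−1)/(q^2−1) − δ, where log is the natural logarithm and δ = 3 for q = 3, δ = 3 for q = 4, and δ = 4 for q = 5. -/
namespace LineSpread

open Module Submodule

section Family

variable {F V : Type*} [Field F] [AddCommGroup V] [Module F V]

/-- A finite family of pairwise skew lines of a space of dimension `n` that meets every line is a
maximal partial line spread. -/
theorem exists_maximal_of_family {n : ℕ} (hn : 0 < n) (hV : finrank F V = n) {ι : Type*} [Finite ι]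
    (ℓ : ι → Submodule F V) (hℓ : ∀ i, finrank F (ℓ i) = 2)
    (hdisj : ∀ i j, i ≠ j → Disjoint (ℓ i) (ℓ j))
    (hmeet : ∀ m : Submodule F V, finrank F m = 2 → ∃ i, ¬ Disjoint m (ℓ i)) :
    ∃ S : Set (Submodule F (Fin n → F)), IsMaximalPartialLineSpread F n S ∧
      S.ncard = Nat.card ι := by
  have : FiniteDimensional F V := Module.finite_of_finrank_pos (hV ▸ hn)
  let e : V ≃ₗ[F] (Fin n → F) := LinearEquiv.ofFinrankEq _ _ (by simp [hV])
  let g : ι → Submodule F (Fin n → F) := fun i => (ℓ i).map (e : V →ₗ[F] _)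
  have hg : ∀ i j, i ≠ j → Disjoint (g i) (g j) := fun i j hij =>
    (Submodule.disjoint_map e.injective (hdisj i j hij))
  have hr : ∀ i, finrank F (g i) = 2 := fun i => by
    rw [← hℓ i]; exact e.finrank_map_eq (ℓ i)
  have hinj : Function.Injective g := by
    intro i j hij
    by_contra hne
    have h := hg i j hne
    rw [← hij, disjoint_self] at h
    have h2 := hr i
    rw [h] at h2
    simp at h2
  refine ⟨Set.range g, ⟨⟨?_, ?_⟩, ?_⟩, ?_⟩
  · rintro _ ⟨i, rfl⟩
    exact hr i
  · rintro _ ⟨i, rfl⟩ _ ⟨j, rfl⟩ hne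
    exact (hg i j fun h => hne (h ▸ rfl)).eq_bot
  · intro m hm
    obtain ⟨i, hi⟩ := hmeet (m.map (e.symm : _ →ₗ[F] V)) (by
      rw [← hm]; exact e.symm.finrank_map_eq m)
    refine ⟨g i, ⟨i, rfl⟩, fun h => hi ?_⟩
    have h' := Submodule.disjoint_map e.symm.injective (disjoint_iff.2 h)
    have h3 : (g i).map (e.symm : _ →ₗ[F] V) = ℓ i := by
      ext x; simp [g]
    rw [← h3]
    exact h'
  · rw [Set.ncard, Set.encard, ENat.card_congr (Equiv.ofInjective g hinj).symm]
    rfl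

end Family

section Construction

variable {F K E : Type*} [Field F] [Field K] [Algebra F K] [AddCommGroup E] [Module F E]
  [Module K E] [IsScalarTower F K E]

/-- The points of `E × K` on the `K`-line through `(a, 1)`. -/
def scalarLine (F : Type*) {K E : Type*} [Field F] [Field K] [Algebra F K] [AddCommGroup E]
    [Module F E] [Module K E] [IsScalarTower F K E] (a : E) : Submodule F (E × K) :=
  LinearMap.range (((LinearMap.toSpanSingleton K E a).restrictScalars F).prod
    (LinearMap.id : K →ₗ[F] K))

theorem mem_scalarLine {a : E} {x : E × K} : x ∈ scalarLine F a ↔ x.1 = x.2 • a := by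
  constructor
  · rintro ⟨w, rfl⟩
    simp
  · intro h
    exact ⟨x.2, by ext <;> simp [h]⟩

theorem finrank_scalarLine (hK : finrank F K = 2) (a : E) :
    finrank F (scalarLine F a : Submodule F (E × K)) = 2 := by
  rw [← hK]
  exact LinearMap.finrank_range_of_inj fun x y h => (Prod.ext_iff.1 h).2

theorem exists_ne_zero_mem_of_finrank_eq_two {F K E : Type*} [Field F] [Field K] [Algebra F K]
    [AddCommGroup E] [Module F E] (hK : finrank F K = 2) {m : Submodule F (E × K)}
    (hm : finrank F m = 2) : ∃ x ∈ m, x ≠ 0 ∧ ∃ c : F, x.2 = algebraMap F K c := by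
  have : FiniteDimensional F K := Module.finite_of_finrank_pos (by omega)
  have : FiniteDimensional F m := Module.finite_of_finrank_pos (by omega)
  let g : m →ₗ[F] K ⧸ (F ∙ (1 : K)) :=
    (mkQ (F ∙ (1 : K))) ∘ₗ (LinearMap.snd F E K) ∘ₗ m.subtype
  have hq : finrank F (K ⧸ (F ∙ (1 : K))) < finrank F m := by
    have h1 := finrank_quotient_add_finrank (F ∙ (1 : K))
    rw [finrank_span_singleton one_ne_zero] at h1
    omega
  obtain ⟨x, hx, hx0⟩ :=
    exists_mem_ne_zero_of_ne_bot (LinearMap.ker_ne_bot_of_finrank_lt hq (f := g))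
  refine ⟨x, x.2, by simpa using hx0, ?_⟩
  have h2 : (x : E × K).2 ∈ F ∙ (1 : K) := by simpa [g] using hx
  obtain ⟨c, hc⟩ := mem_span_singleton.1 h2
  exact ⟨c, by rw [← hc, Algebra.smul_def, mul_one]⟩

theorem exists_mem_linearIndependent_of_finrank_eq_two {V : Type*} [AddCommGroup V] [Module F V]
    {m : Submodule F V} (hm : finrank F m = 2) {x : V} (hx : x ≠ 0) :
    ∃ y ∈ m, LinearIndependent F ![x, y] := by
  by_contra! h
  have h1 : m ≤ F ∙ x := fun y hy => by
    have := h y hy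
    rw [LinearIndependent.pair_iff' hx] at this
    push Not at this
    obtain ⟨a, ha⟩ := this
    exact mem_span_singleton.2 ⟨a, ha⟩
  have := Submodule.finrank_mono h1
  rw [finrank_span_singleton hx] at this
  omega

theorem not_disjoint_of_mem {V : Type*} [AddCommGroup V] [Module F V]
    {m l : Submodule F V} {x : V} (hx : x ≠ 0) (hm : x ∈ m) (hl : x ∈ l) : ¬ Disjoint m l :=
  fun h => hx (disjoint_def.1 h x hm hl)

theorem exists_maximal_of_entries [Finite E] (hK : finrank F K = 2) (hE : finrank F E = 4)
    {ι κ : Type*} [Finite ι] [Finite κ] (U : Set E) (p d : ι → E) (w : ι → K) (u v : κ → E)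
    (hd : ∀ i, w i • d i ≠ 0)
    (hdd : ∀ i j (c : F), w i • d i = c • w j • d j → i = j)
    (hu : ∀ k, LinearIndependent F ![u k, v k])
    (huu : ∀ k l, k ≠ l → Disjoint (span F {u k, v k}) (span F {u l, v l}))
    (hdu : ∀ i k, w i • d i ∉ span F {u k, v k})
    (hpU : ∀ i (s : F), p i + s • d i ∈ U)
    (hpp : ∀ i j (s s' : F), p i + s • d i = p j + s' • d j → p i = p j ∧ d i = d j)
    (hU : ∀ a ∈ U, ∃ i, ∃ s : F, w i = 1 ∧ a = p i + s • d i)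
    (Cov : E → Prop)
    (hCov : ∀ t, Cov t → (∃ k, t ∈ span F {u k, v k}) ∨ ∃ i, ∃ c : F, t = c • w i • d i)
    (hLine : ∀ t t', ¬ Cov t → ¬ Cov t' → LinearIndependent F ![t, t'] →
      ∃ s : F, Cov (t + s • t'))
    (hTrans : ∀ t, ¬ Cov t → t ≠ 0 → ∀ z : K, z ∉ Set.range (algebraMap F K) →
      ∀ x : E, ∃ s : F, x + s • z • t ∉ U) :
    ∃ S : Set (Submodule F (Fin 6 → F)), IsMaximalPartialLineSpread F 6 S ∧
      S.ncard = Nat.card {a // a ∉ U} + (Nat.card ι + Nat.card κ) := by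
  have : FiniteDimensional F K := Module.finite_of_finrank_pos (by omega)
  have : FiniteDimensional F E := Module.finite_of_finrank_pos (by omega)
  have hw : ∀ i, w i ≠ 0 := fun i h => hd i (by rw [h, zero_smul])
  let b : ι → Submodule F (E × K) := fun i => span F {(w i • d i, 0), (w i • p i, w i)}
  let l : κ → Submodule F (E × K) := fun k => (span F {u k, v k}).map (LinearMap.inl F E K)
  let ℓ : {a // a ∉ U} ⊕ (ι ⊕ κ) → Submodule F (E × K) :=
    Sum.elim (fun a => scalarLine F a.1) (Sum.elim b l)
  have mem_b : ∀ {i x}, x ∈ b i ↔ ∃ r s : F, x = (w i • (r • d i + s • p i), s • w i) := by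
    intro i x
    simp only [b, mem_span_pair]
    refine exists₂_congr fun r s => ?_
    rw [eq_comm, Prod.smul_mk, Prod.smul_mk, Prod.mk_add_mk, smul_zero, zero_add, smul_add,
      smul_comm r, smul_comm s]
  have mem_l : ∀ {k x}, x ∈ l k ↔ x.1 ∈ span F {u k, v k} ∧ x.2 = 0 := by
    intro k x
    simp only [l, mem_map]
    constructor
    · rintro ⟨y, hy, rfl⟩
      exact ⟨hy, rfl⟩
    · rintro ⟨h1, h2⟩
      exact ⟨x.1, h1, Prod.ext rfl h2.symm⟩
  have hpoint : ∀ a : E, ∃ i, ((a, (1 : K)) : E × K) ∈ ℓ i := by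
    intro a
    by_cases ha : a ∈ U
    · obtain ⟨i, s, h1, h2⟩ := hU a ha
      refine ⟨.inr (.inl i), mem_b.2 ⟨s, 1, ?_⟩⟩
      rw [h1, h2, one_smul, one_smul, one_smul, add_comm]
    · exact ⟨.inl ⟨a, ha⟩, mem_scalarLine.2 (one_smul _ _).symm⟩
  have hpoint0 : ∀ t : E, Cov t → ∃ i, ((t, (0 : K)) : E × K) ∈ ℓ i := by
    intro t ht
    obtain ⟨k, hk⟩ | ⟨i, c, hc⟩ := hCov t ht
    · exact ⟨.inr (.inr k), mem_l.2 ⟨hk, rfl⟩⟩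
    · refine ⟨.inr (.inl i), mem_b.2 ⟨c, 0, ?_⟩⟩
      rw [hc, zero_smul, zero_smul, add_zero, smul_comm]
  have hsl : ∀ (a : {a // a ∉ U}) i, Disjoint (scalarLine F a.1) (b i) := by
    intro a i
    rw [disjoint_def]
    intro x hx hxb
    obtain ⟨r, s, rfl⟩ := mem_b.1 hxb
    have h := mem_scalarLine.1 hx
    simp only [smul_assoc s (w i)] at h
    rw [smul_comm s (w i)] at h
    have h := smul_right_injective E (hw i) h
    by_cases hs : s = 0
    · subst hs
      have hd0 : d i ≠ 0 := fun h0 => hd i (by rw [h0, smul_zero])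
      simp only [zero_smul, add_zero] at h
      rw [h]; simp
    · exfalso
      apply a.2
      have : a.1 = p i + (s⁻¹ * r) • d i := by
        rw [mul_smul]
        apply smul_right_injective E hs
        simp only [smul_add, smul_inv_smul₀ hs]
        rw [← h, add_comm]
      rw [this]; exact hpU _ _
  have hss : ∀ a a' : E, a ≠ a' → Disjoint (scalarLine F a : Submodule F (E × K))
      (scalarLine F a') := by
    intro a a' hne
    rw [disjoint_def]
    intro x hx hx'
    rw [mem_scalarLine] at hx hx'
    have h0 : x.2 • (a - a') = 0 := by rw [smul_sub, ← hx, ← hx', sub_self]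
    have h2 : x.2 = 0 := (smul_eq_zero.1 h0).resolve_right (sub_ne_zero.2 hne)
    exact Prod.ext (by rw [hx, h2, zero_smul]; rfl) h2
  have hsk : ∀ (a : E) k, Disjoint (scalarLine F a) (l k) := by
    intro a k
    rw [disjoint_def]
    intro x hx hx'
    rw [mem_scalarLine] at hx
    have h2 := (mem_l.1 hx').2
    exact Prod.ext (by rw [hx, h2, zero_smul]; rfl) h2
  have hbl : ∀ i k, Disjoint (b i) (l k) := by
    intro i k
    rw [disjoint_def]
    intro x hx hx'
    obtain ⟨r, s, rfl⟩ := mem_b.1 hx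
    obtain ⟨h1, h2⟩ := mem_l.1 hx'
    have hs : s = 0 := (smul_eq_zero.1 h2).resolve_right (hw i)
    subst hs
    have hr : r = 0 := by
      by_contra hr
      simp only [zero_smul, add_zero] at h1
      rw [smul_comm] at h1
      exact hdu i k ((smul_mem_iff _ hr).1 h1)
    subst hr
    simp
  have hbb : ∀ i j, i ≠ j → Disjoint (b i) (b j) := by
    intro i j hij
    rw [disjoint_def]
    intro x hx hx'
    obtain ⟨r, s, rfl⟩ := mem_b.1 hx
    obtain ⟨r', s', h⟩ := mem_b.1 hx'
    rw [Prod.mk.injEq] at h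
    obtain ⟨h1, h2⟩ := h
    by_cases hs : s = 0
    · subst hs
      have hs' : s' = 0 := by
        rw [zero_smul, eq_comm] at h2
        exact (smul_eq_zero.1 h2).resolve_right (hw j)
      subst hs'
      simp only [zero_smul, add_zero] at h1 ⊢
      by_cases hr : r = 0
      · simp [hr]
      · exfalso
        refine hij (hdd i j (r⁻¹ * r') ?_)
        rw [smul_comm (w i), smul_comm (w j)] at h1
        rw [mul_smul, ← h1, inv_smul_smul₀ hr]
    · exfalso
      have hs' : s' ≠ 0 := by
        rintro rfl
        rw [zero_smul] at h2
        exact (smul_eq_zero.1 h2).elim hs (hw i)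
      have key : ∀ {i : ι} {r s : F}, s ≠ 0 →
          w i • (r • d i + s • p i) = (s • w i) • (p i + (s⁻¹ * r) • d i) := by
        intro i r s hs
        rw [smul_assoc, smul_comm s, smul_add s, mul_smul, smul_inv_smul₀ hs, add_comm]
      rw [key hs, key hs', h2] at h1
      have h3 := smul_right_injective E (smul_ne_zero hs' (hw j)) h1
      obtain ⟨-, h4⟩ := hpp i j _ _ h3
      refine hij (hdd i j (s⁻¹ * s') ?_)
      rw [h4, mul_smul, ← smul_assoc s', ← h2, smul_assoc s, inv_smul_smul₀ hs]
  have hll : ∀ k k', k ≠ k' → Disjoint (l k) (l k') := fun k k' h =>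
    Submodule.disjoint_map LinearMap.inl_injective (huu k k' h)
  have hV : finrank F (E × K) = 6 := by rw [finrank_prod, hE, hK]
  refine (exists_maximal_of_family (n := 6) (by norm_num) hV ℓ ?_ ?_ ?_).imp fun S hS =>
    ⟨hS.1, by rw [hS.2, Nat.card_sum, Nat.card_sum]⟩
  · rintro (a | i | k)
    · exact finrank_scalarLine hK a.1
    · have hli : LinearIndependent F ![((w i • d i, 0) : E × K), (w i • p i, w i)] := by
        rw [LinearIndependent.pair_iff]
        intro s t h
        have h2 := congrArg Prod.snd h
        simp only [Prod.smul_mk, Prod.mk_add_mk, smul_zero, zero_add, Prod.snd_zero] at h2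
        have ht : t = 0 := (smul_eq_zero.1 h2).resolve_right (hw i)
        subst ht
        have h1 := congrArg Prod.fst h
        simp only [Prod.smul_mk, zero_smul, add_zero, Prod.fst_zero] at h1
        exact ⟨(smul_eq_zero.1 h1).resolve_right (hd i), rfl⟩
      have h := finrank_span_eq_card hli
      rw [Matrix.range_cons_cons_empty, Fintype.card_fin] at h
      exact h
    · have h := finrank_span_eq_card (hu k)
      rw [Matrix.range_cons_cons_empty, Fintype.card_fin] at h
      have h2 := LinearEquiv.finrank_eq (Submodule.equivMapOfInjective (LinearMap.inl F E K)
        LinearMap.inl_injective (span F {u k, v k}))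
      exact h2.symm.trans h
  · rintro (a | i | k) (a' | j | k') hne
    · exact hss _ _ fun h => hne (congrArg _ (Subtype.ext h))
    · exact hsl a j
    · exact hsk a k'
    · exact (hsl a' i).symm
    · exact hbb i j fun h => hne (h ▸ rfl)
    · exact hbl i k'
    · exact (hsk a' k).symm
    · exact (hbl j k).symm
    · exact hll k k' fun h => hne (h ▸ rfl)
  · intro m hm
    have hone : ∀ x ∈ m, ∀ c : F, c ≠ 0 → x.2 = algebraMap F K c → ∃ i, ¬ Disjoint m (ℓ i) := by
      intro x hx c hc0 hc
      obtain ⟨i, hi⟩ := hpoint (c⁻¹ • x.1)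
      refine ⟨i, not_disjoint_of_mem (x := c⁻¹ • x) ?_ (m.smul_mem _ hx) ?_⟩
      · intro h
        have h2 := congrArg Prod.snd h
        rw [Prod.smul_snd, hc, Algebra.smul_def, ← map_mul, inv_mul_cancel₀ hc0, map_one] at h2
        exact one_ne_zero h2
      · have h2 : c⁻¹ • x.2 = 1 := by
          rw [hc, Algebra.smul_def, ← map_mul, inv_mul_cancel₀ hc0, map_one]
        rwa [← h2] at hi
    obtain ⟨x, hx, hx0, c, hc⟩ := exists_ne_zero_mem_of_finrank_eq_two hK hm
    by_cases hc0 : c = 0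
    swap
    · exact hone x hx c hc0 hc
    obtain ⟨t, z⟩ := x
    simp only [hc0, map_zero] at hc
    subst hc
    have ht0 : t ≠ 0 := fun h => hx0 (by rw [h]; rfl)
    by_cases ht : Cov t
    · obtain ⟨i, hi⟩ := hpoint0 t ht
      exact ⟨i, not_disjoint_of_mem hx0 hx hi⟩
    obtain ⟨⟨y, z⟩, hy, hli⟩ := exists_mem_linearIndependent_of_finrank_eq_two hm hx0
    by_cases hz : z ∈ Set.range (algebraMap F K)
    · obtain ⟨c, rfl⟩ := hz
      by_cases hc0 : c = 0
      swap
      · exact hone _ hy c hc0 rfl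
      subst hc0
      rw [map_zero] at hy hli
      have hli' : LinearIndependent F ![y, t] := by
        rw [LinearIndependent.pair_iff] at hli ⊢
        intro a b hab
        have := hli b a (by simpa [add_comm] using hab)
        exact this.symm
      by_cases hyc : Cov y
      · obtain ⟨i, hi⟩ := hpoint0 y hyc
        exact ⟨i, not_disjoint_of_mem (by simpa using hli.ne_zero 1) hy hi⟩
      obtain ⟨s, hs⟩ := hLine y t hyc ht hli'
      obtain ⟨i, hi⟩ := hpoint0 _ hs
      refine ⟨i, not_disjoint_of_mem ?_ ?_ hi⟩
      · intro h
        have h1 := congrArg Prod.fst h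
        have := (LinearIndependent.pair_iff.1 hli') 1 s (by simpa using h1)
        exact one_ne_zero this.1
      · convert m.add_mem hy (m.smul_mem s hx) using 1
        simp
    · have hz0 : z ≠ 0 := fun h => hz ⟨0, by rw [h, map_zero]⟩
      have hzi : z⁻¹ ∉ Set.range (algebraMap F K) := by
        rintro ⟨c, hc⟩
        exact hz ⟨c⁻¹, by rw [map_inv₀, hc, inv_inv]⟩
      obtain ⟨s, hs⟩ := hTrans t ht ht0 z⁻¹ hzi (z⁻¹ • y)
      refine ⟨.inl ⟨_, hs⟩, not_disjoint_of_mem (x := (y + s • t, z)) ?_ ?_ ?_⟩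
      · exact fun h => hz0 (congrArg Prod.snd h)
      · convert m.add_mem hy (m.smul_mem s hx) using 1
        simp
      · refine mem_scalarLine.2 ?_
        change y + s • t = z • (z⁻¹ • y + s • z⁻¹ • t)
        rw [smul_add, smul_inv_smul₀ hz0, smul_comm s, smul_inv_smul₀ hz0]

end Construction

/-- Arithmetic of a field with `q` elements on the codes `0, …, q - 1`, together with the
coefficients of `ω ^ 2 = c₀ + c₁ * ω` defining a quadratic extension `K`. -/
structure Arith where
  /-- The number of elements of the base field. -/
  q : ℕ
  /-- Addition of codes. -/
  add : ℕ → ℕ → ℕ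
  /-- Multiplication of codes. -/
  mul : ℕ → ℕ → ℕ
  /-- The constant coefficient of `ω ^ 2`. -/
  c₀ : ℕ
  /-- The linear coefficient of `ω ^ 2`. -/
  c₁ : ℕ

namespace Arith

variable (A : Arith)

/-- The number of elements of `K`. -/
def Q : ℕ := A.q * A.q

/-- Addition in `K`, where `a + b * ω` has the code `a + q * b`. -/
def kadd (a b : ℕ) : ℕ := A.add (a % A.q) (b % A.q) + A.q * A.add (a / A.q) (b / A.q)

/-- Multiplication in `K`. -/
def kmul (a b : ℕ) : ℕ :=
  A.add (A.mul (a % A.q) (b % A.q)) (A.mul A.c₀ (A.mul (a / A.q) (b / A.q))) +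
    A.q * A.add (A.add (A.mul (a % A.q) (b / A.q)) (A.mul (a / A.q) (b % A.q)))
      (A.mul A.c₁ (A.mul (a / A.q) (b / A.q)))

/-- Addition in `K × K`, where `(x, y)` has the code `x + Q * y`. -/
def eadd (x y : ℕ) : ℕ := A.kadd (x % A.Q) (y % A.Q) + A.Q * A.kadd (x / A.Q) (y / A.Q)

/-- Multiplication of an element of `K × K` by a scalar from `K`. -/
def emul (w x : ℕ) : ℕ := A.kmul w (x % A.Q) + A.Q * A.kmul w (x / A.Q)

/-- The codes whose leading digit to the base `q` is `1`. -/
def canonList : List ℕ :=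
  1 :: (List.range' A.q A.q ++ (List.range' A.Q A.Q ++ List.range' (A.q * A.Q) (A.q * A.Q)))

/-- The leading digit of `x` to the base `q` is `1`: the code `x` represents a point of the
projective space over the base field on `K × K`. -/
def canon (x : ℕ) : Bool :=
  (A.q * A.Q).ble x && x.blt (2 * (A.q * A.Q)) || A.Q.ble x && x.blt (2 * A.Q) ||
    A.q.ble x && x.blt (2 * A.q) || x.beq 1

/-- Every nonzero vector has exactly one canonical multiple. -/
def canonCheck : Bool :=
  (List.range (A.Q * A.Q)).all fun e =>
    (e.beq 0 || (List.range A.q).any fun c => A.canon (A.emul c e)) &&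
      (!A.canon e || (List.range' 2 (A.q - 2)).all fun c => !A.canon (A.emul c e))

/-- The points of the affine line through `p` with direction `d`. -/
def affine (p d : ℕ) : List ℕ := (List.range A.q).map fun s => A.eadd p (A.emul s d)

/-- The points of the projective line through `l.1` and `l.2`. -/
def linePts (l : ℕ × ℕ) : List ℕ := l.1 :: A.affine l.2 l.1

variable {A}

theorem lt_Q (hq : 2 ≤ A.q) {s : ℕ} (hs : s < 2 * A.q) : s < A.Q :=
  hs.trans_le (Nat.mul_le_mul_right _ hq)

theorem lt_of_canon (hq : 2 ≤ A.q) {x : ℕ} (hx : A.canon x = true) : x < A.Q * A.Q := by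
  have h3 : 2 * (A.q * A.Q) ≤ A.Q * A.Q := by
    rw [← mul_assoc]
    exact Nat.mul_le_mul_right _ (Nat.mul_le_mul_right _ hq)
  have h4 : A.Q ≤ A.q * A.Q := Nat.le_mul_of_pos_left _ (by omega)
  have h5 : A.q ≤ A.Q := Nat.le_mul_of_pos_left _ (by omega)
  simp only [canon, Bool.or_eq_true, Bool.and_eq_true, Nat.ble_eq, Nat.blt_eq,
    Nat.beq_eq] at hx
  omega

theorem mem_canonList {x : ℕ} (hx : A.canon x = true) : x ∈ A.canonList := by
  simp only [canon, Bool.or_eq_true, Bool.and_eq_true, Nat.ble_eq, Nat.blt_eq,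
    Nat.beq_eq] at hx
  simp only [canonList, List.mem_cons, List.mem_append, List.mem_range'_1]
  omega

end Arith

/-- The list has no repetitions and no member that is a bit of the mask. -/
def fresh : List ℕ → ℕ → Bool
  | [], _ => true
  | x :: l, m => !m.testBit x && fresh l (m ||| 1 <<< x)

/-- The members of a list as a bit mask. -/
def mask : List ℕ → ℕ
  | [] => 0
  | x :: l => mask l ||| 1 <<< x

theorem testBit_or_one_shiftLeft (m x y : ℕ) :
    (m ||| 1 <<< x).testBit y = true ↔ m.testBit y = true ∨ y = x := by
  rw [Nat.testBit_or, Bool.or_eq_true, Nat.one_shiftLeft, Nat.testBit_two_pow]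
  rw [decide_eq_true_eq, eq_comm (a := x)]

theorem nodup_of_fresh {l : List ℕ} {m : ℕ} (h : fresh l m = true) :
    l.Nodup ∧ ∀ x ∈ l, ¬ m.testBit x = true := by
  induction l generalizing m with
  | nil => simp
  | cons x l ih =>
    rw [fresh, Bool.and_eq_true] at h
    obtain ⟨h1, h2⟩ := ih h.2
    simp only [testBit_or_one_shiftLeft, not_or] at h2
    refine ⟨List.nodup_cons.2 ⟨fun hx => (h2 x hx).2 rfl, h1⟩, ?_⟩
    rintro y (_ | ⟨_, hy⟩)
    · simpa using h.1
    · exact (h2 y hy).1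

theorem testBit_mask {l : List ℕ} {x : ℕ} : (mask l).testBit x = true ↔ x ∈ l := by
  induction l with
  | nil => simp [mask]
  | cons y l ih => rw [mask, testBit_or_one_shiftLeft, ih, List.mem_cons, or_comm]

/-- Affine lines `(p, d)` of `K × K` with point set `U` that can be used together, provided that
all points of the projective space not covered by the configuration are among `holes`. -/
structure Master where
  /-- The points that may stay uncovered. -/
  holes : List ℕ
  /-- The affine lines. -/
  reguli : List (ℕ × ℕ)

/-- The lines replacing part of the Desarguesian spread: lines inside `K × K`, and affine lines
`(p, d)` together with the multipliers `w` for which the line through `w * d` and `w * (p, 1)` is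
used. -/
structure Config where
  /-- Pairs of points spanning the lines inside `K × K`. -/
  lines : List (ℕ × ℕ)
  /-- Affine lines with their multipliers. -/
  reguli : List ((ℕ × ℕ) × List ℕ)

/-- The points on the affine lines. -/
def Master.pts (A : Arith) (M : Master) : List ℕ := M.reguli.flatMap fun r => A.affine r.1 r.2

/-- The affine lines are pairwise disjoint, and their union contains no line whose direction is a
multiple of a hole by an element outside the base field. -/
def Master.check (A : Arith) (M : Master) : Bool :=
  let U := mask (M.pts A)
  M.reguli.all (fun r => r.1.blt (A.Q * A.Q) && r.2.blt (A.Q * A.Q)) && fresh (M.pts A) 0 &&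
  M.holes.all fun t => (List.range A.q).all fun c => (M.pts A).all fun x =>
    (A.affine x (A.emul (A.q + c) t)).any fun y => !U.testBit y

/-- The affine lines, each with a single multiplier. -/
def Config.entries (C : Config) : List ((ℕ × ℕ) × ℕ) :=
  C.reguli.flatMap fun r => r.2.map fun w => (r.1, w)

/-- The points of `K × K` that are covered. -/
def Config.pts (A : Arith) (C : Config) : List ℕ :=
  C.lines.flatMap A.linePts ++ C.entries.map fun e => A.emul e.2 e.1.2

/-- The lines of the configuration are pairwise skew, all points outside the holes are covered, no
line is contained in the set of uncovered points, and the spread has `n` lines. -/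
def Config.check (A : Arith) (M : Master) (C : Config) (n : ℕ) : Bool :=
  let cov := mask (C.pts A)
  let T := M.holes.filter fun t => !cov.testBit t
  C.lines.all (fun l => l.1.blt (A.Q * A.Q) && l.2.blt (A.Q * A.Q)) &&
  C.reguli.all (fun r => r.2.contains 1 && r.2.all fun w => w.blt A.Q) &&
  (C.pts A).all A.canon && fresh (C.pts A) 0 &&
  A.canonList.all (fun t => cov.testBit t || M.holes.contains t) &&
  (T.all fun t => T.all fun t' => t.beq t' || (A.affine t t').any fun x =>
    (List.range A.q).any fun c => cov.testBit (A.emul c x)) &&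
  (n + A.q * C.reguli.length).beq (A.Q * A.Q + (C.entries.length + C.lines.length))

/-- A coding of the elements of the fields `F ⊆ K` and of the plane `E` over `K` by natural
numbers. -/
structure Coding (A : Arith) (F K E : Type*) [Field F] [Field K] [Algebra F K] [AddCommGroup E]
    [Module F E] [Module K E] where
  /-- The element of `F` with the given code. -/
  dec : ℕ → F
  /-- The element of `K` with the given code. -/
  kdec : ℕ → K
  /-- The element of `E` with the given code. -/
  edec : ℕ → E
  two_le : 2 ≤ A.q
  dec_zero : dec 0 = 0
  dec_one : dec 1 = 1
  dec_surj : ∀ c, ∃ s < A.q, dec s = c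
  kdec_eq : ∀ s < A.q, kdec s = algebraMap F K (dec s)
  exists_kdec : ∀ z ∉ Set.range (algebraMap F K), ∃ c < A.q, ∃ b : F, b ≠ 0 ∧
    z = b • kdec (A.q + c)
  edec_zero : edec 0 = 0
  edec_inj : ∀ x < A.Q * A.Q, ∀ y < A.Q * A.Q, edec x = edec y → x = y
  edec_surj : ∀ t, ∃ x < A.Q * A.Q, edec x = t
  eadd_lt : ∀ x < A.Q * A.Q, ∀ y < A.Q * A.Q, A.eadd x y < A.Q * A.Q
  emul_lt : ∀ w < A.Q, ∀ y < A.Q * A.Q, A.emul w y < A.Q * A.Q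
  edec_eadd : ∀ x < A.Q * A.Q, ∀ y < A.Q * A.Q, edec (A.eadd x y) = edec x + edec y
  edec_emul : ∀ w < A.Q, ∀ y < A.Q * A.Q, edec (A.emul w y) = kdec w • edec y
  canonCheck : A.canonCheck = true

namespace Coding

variable {A : Arith} {F K E : Type*} [Field F] [Field K] [Algebra F K] [AddCommGroup E]
    [Module F E] [Module K E]

theorem natCard_eq (D : Coding A F K E) : Nat.card E = A.Q * A.Q := by
  have : Function.Bijective fun x : Fin (A.Q * A.Q) => D.edec x :=
    ⟨fun x y h => Fin.ext (D.edec_inj _ x.2 _ y.2 h), fun t =>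
      let ⟨x, hx, h⟩ := D.edec_surj t
      ⟨⟨x, hx⟩, h⟩⟩
  rw [← Nat.card_eq_of_bijective _ this, Nat.card_fin]

theorem edec_ne_zero (D : Coding A F K E) {x : ℕ} (hx : A.canon x = true) : D.edec x ≠ 0 := by
  intro h
  have h2 := D.two_le
  have hx' := Arith.lt_of_canon D.two_le hx
  rw [← D.edec_zero] at h
  obtain rfl := D.edec_inj x hx' 0 (by omega) h
  have : 0 < A.Q := Nat.mul_pos (by omega) (by omega)
  have : 0 < A.q * A.Q := Nat.mul_pos (by omega) (by omega)
  simp only [Arith.canon, Bool.or_eq_true, Bool.and_eq_true, Nat.ble_eq, Nat.blt_eq,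
    Nat.beq_eq] at hx
  omega

variable [IsScalarTower F K E] (D : Coding A F K E)

theorem edec_smul {s x : ℕ} (hs : s < A.q) (hx : x < A.Q * A.Q) :
    D.edec (A.emul s x) = D.dec s • D.edec x := by
  rw [D.edec_emul s (Arith.lt_Q D.two_le (by omega)) x hx, D.kdec_eq s hs, algebraMap_smul]

theorem eq_of_canon {x y : ℕ} (hx : A.canon x = true) (hy : A.canon y = true) {c : F}
    (h : D.edec x = c • D.edec y) : x = y := by
  have hx' := Arith.lt_of_canon D.two_le hx
  have hy' := Arith.lt_of_canon D.two_le hy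
  have h2 := D.two_le
  obtain ⟨s, hs, rfl⟩ := D.dec_surj c
  rw [← D.edec_smul hs hy'] at h
  have h3 := D.edec_inj x hx' _ (D.emul_lt s (Arith.lt_Q D.two_le (by omega)) y hy') h
  by_cases h1 : s = 1
  · rw [h1, D.edec_smul (by omega) hy', D.dec_one, one_smul] at h
    exact D.edec_inj x hx' y hy' h
  by_cases h0 : s = 0
  · exfalso
    rw [h0, D.edec_smul (by omega) hy', D.dec_zero, zero_smul] at h
    exact D.edec_ne_zero hx h
  have hc := D.canonCheck
  simp only [Arith.canonCheck, List.all_eq_true, List.mem_range, Bool.and_eq_true,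
    Bool.or_eq_true, List.mem_range'_1, Bool.not_eq_true'] at hc
  rcases (hc y hy').2 with h4 | h4
  · rw [hy] at h4; exact absurd h4 (by simp)
  · have := h4 s ⟨by omega, by omega⟩
    rw [← h3, hx] at this
    exact absurd this (by simp)

theorem exists_canon {t : E} (ht : t ≠ 0) :
    ∃ x, A.canon x = true ∧ ∃ c : F, c ≠ 0 ∧ D.edec x = c • t := by
  obtain ⟨e, he, rfl⟩ := D.edec_surj t
  have hc := D.canonCheck
  simp only [Arith.canonCheck, List.all_eq_true, List.mem_range, Bool.and_eq_true,
    Bool.or_eq_true, List.any_eq_true, Nat.beq_eq] at hc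
  rcases (hc e he).1 with rfl | ⟨s, hs, h⟩
  · exact absurd D.edec_zero ht
  · have h1 := D.edec_smul hs he
    refine ⟨_, h, D.dec s, fun h0 => D.edec_ne_zero h ?_, h1⟩
    rw [h1, h0, zero_smul]

theorem mem_affine {p d : ℕ} (hp : p < A.Q * A.Q) (hd : d < A.Q * A.Q) {x : ℕ}
    (hx : x ∈ A.affine p d) : x < A.Q * A.Q ∧ ∃ s : F, D.edec x = D.edec p + s • D.edec d := by
  simp only [Arith.affine, List.mem_map, List.mem_range] at hx
  obtain ⟨s, hs, rfl⟩ := hx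
  have h2 := D.two_le
  have := D.emul_lt s (Arith.lt_Q D.two_le (by omega)) d hd
  exact ⟨D.eadd_lt _ hp _ this, D.dec s, by rw [D.edec_eadd _ hp _ this, D.edec_smul hs hd]⟩

theorem exists_mem_affine {p d : ℕ} (hp : p < A.Q * A.Q) (hd : d < A.Q * A.Q) (s : F) :
    ∃ x ∈ A.affine p d, D.edec x = D.edec p + s • D.edec d := by
  obtain ⟨s, hs, rfl⟩ := D.dec_surj s
  have h2 := D.two_le
  refine ⟨_, List.mem_map.2 ⟨s, List.mem_range.2 hs, rfl⟩, ?_⟩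
  rw [D.edec_eadd _ hp _ (D.emul_lt s (Arith.lt_Q D.two_le (by omega)) d hd), D.edec_smul hs hd]

theorem mem_span_of_mem_linePts {l : ℕ × ℕ} (h1 : l.1 < A.Q * A.Q) (h2 : l.2 < A.Q * A.Q) {x : ℕ}
    (hx : x ∈ A.linePts l) : D.edec x ∈ span F {D.edec l.1, D.edec l.2} := by
  rcases List.mem_cons.1 hx with rfl | hx
  · exact subset_span (by simp)
  · obtain ⟨-, s, hs⟩ := D.mem_affine h2 h1 hx
    exact mem_span_pair.2 ⟨s, 1, by rw [hs, one_smul, add_comm]⟩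

theorem exists_mem_linePts {l : ℕ × ℕ} (h1 : l.1 < A.Q * A.Q) (h2 : l.2 < A.Q * A.Q) {t : E}
    (ht : t ∈ span F {D.edec l.1, D.edec l.2}) : ∃ x ∈ A.linePts l, ∃ c : F, t = c • D.edec x := by
  obtain ⟨a, b, rfl⟩ := mem_span_pair.1 ht
  by_cases hb : b = 0
  · exact ⟨l.1, List.mem_cons_self, a, by rw [hb, zero_smul, add_zero]⟩
  · obtain ⟨x, hx, h⟩ := D.exists_mem_affine h2 h1 (b⁻¹ * a)
    refine ⟨x, List.mem_cons_of_mem _ hx, b, ?_⟩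
    rw [h, smul_add, mul_smul, smul_inv_smul₀ hb, add_comm]

theorem linearIndependent_of_canon {l : ℕ × ℕ} (h1 : l.1 < A.Q * A.Q) (h2 : l.2 < A.Q * A.Q)
    (h : ∀ x ∈ A.linePts l, A.canon x = true) :
    LinearIndependent F ![D.edec l.1, D.edec l.2] := by
  rw [LinearIndependent.pair_iff' (D.edec_ne_zero (h _ List.mem_cons_self))]
  intro a ha
  obtain ⟨x, hx, hx'⟩ := D.exists_mem_affine h2 h1 (-a)
  refine D.edec_ne_zero (h x (List.mem_cons_of_mem _ hx)) ?_
  rw [hx', ← ha, neg_smul, add_neg_cancel]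

end Coding

theorem mem_entries {C : Config} {e : (ℕ × ℕ) × ℕ} :
    e ∈ C.entries ↔ ∃ r ∈ C.reguli, r.1 = e.1 ∧ e.2 ∈ r.2 := by
  simp only [Config.entries, List.mem_flatMap, List.mem_map]
  constructor
  · rintro ⟨r, hr, w, hw, rfl⟩
    exact ⟨r, hr, rfl, hw⟩
  · rintro ⟨r, hr, h, hw⟩
    exact ⟨r, hr, e.2, hw, Prod.ext h rfl⟩

theorem getElem_disjoint_of_nodup_flatMap {α β : Type*} {f : α → List β} {l : List α}
    (h : (l.flatMap f).Nodup) {i j : Fin l.length} (hij : i ≠ j) : (f l[i]).Disjoint (f l[j]) := by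
  have h' := List.pairwise_iff_getElem.1 (List.nodup_flatMap.1 h).2
  rcases lt_or_gt_of_ne hij with h1 | h1
  · exact h' i j i.2 j.2 h1
  · exact (h' j i j.2 i.2 h1).symm

theorem eq_of_mem_flatMap_of_nodup {α β : Type*} {f : α → List β} {l : List α}
    (h : (l.flatMap f).Nodup) {a b : α} (ha : a ∈ l) (hb : b ∈ l) {x : β} (hxa : x ∈ f a)
    (hxb : x ∈ f b) : a = b := by
  obtain ⟨i, hi, rfl⟩ := List.getElem_of_mem ha
  obtain ⟨j, hj, rfl⟩ := List.getElem_of_mem hb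
  by_contra hne
  have hij : (⟨i, hi⟩ : Fin l.length) ≠ ⟨j, hj⟩ := fun h => hne (by simp [Fin.mk.inj h])
  exact getElem_disjoint_of_nodup_flatMap h hij hxa hxb

/-- The soundness of the check. -/
theorem exists_maximal_of_check {A : Arith} {F K E : Type*} [Field F] [Field K] [Algebra F K]
    [AddCommGroup E] [Module F E] [Module K E] [IsScalarTower F K E] (D : Coding A F K E)
    (hK : finrank F K = 2) (hE : finrank F E = 4) {M : Master} {C : Config} {n : ℕ}
    (hM : M.check A = true) (hC : C.check A M n = true)
    (hsub : (C.reguli.map Prod.fst).Sublist M.reguli) :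
    ∃ S : Set (Submodule F (Fin 6 → F)), IsMaximalPartialLineSpread F 6 S ∧ S.ncard = n := by
  simp only [Master.check, Bool.and_eq_true, List.all_eq_true, Nat.blt_eq, List.any_eq_true,
    Bool.not_eq_true', List.mem_range] at hM
  obtain ⟨⟨hMlt, hMfresh⟩, hMholes⟩ := hM
  have hMnodup := (nodup_of_fresh hMfresh).1
  simp only [Config.check, Bool.and_eq_true, List.all_eq_true, Nat.blt_eq, List.any_eq_true,
    Bool.not_eq_true', List.mem_range, Nat.beq_eq, Bool.or_eq_true, List.contains_iff_mem,
    List.mem_filter, testBit_mask] at hC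
  obtain ⟨⟨⟨⟨⟨⟨hlines, hreg⟩, hcanon⟩, hfresh⟩, hhole⟩, hpair⟩, hcount⟩ := hC
  have hnodup := (nodup_of_fresh hfresh).1
  rw [Config.pts, List.nodup_append'] at hnodup
  obtain ⟨hnl, hne, hdisj⟩ := hnodup
  have hq := D.two_le
  have hqQ : A.q < A.Q := Arith.lt_Q hq (by omega)
  have hQQ : A.Q ≤ A.Q * A.Q := Nat.le_mul_of_pos_left _ (by omega)
  have : Finite E := Nat.finite_of_card_ne_zero (by rw [D.natCard_eq]; omega)
  have hmemM : ∀ r ∈ C.reguli, r.1 ∈ M.reguli := fun r hr =>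
    hsub.subset (List.mem_map_of_mem hr)
  let Upts : List ℕ := C.reguli.flatMap fun r => A.affine r.1.1 r.1.2
  have hUsub : Upts.Sublist (M.pts A) := by
    have h1 := hsub.flatMap (fun r => A.affine r.1 r.2)
    rwa [List.flatMap_map] at h1
  have hMpts : ∀ x ∈ M.pts A, x < A.Q * A.Q := by
    intro x hx
    obtain ⟨r, hr, hx⟩ := List.mem_flatMap.1 hx
    exact (D.mem_affine (hMlt r hr).1 (hMlt r hr).2 hx).1
  let U : Set E := D.edec '' {x | x ∈ Upts}
  have hcardU : U.ncard = A.q * C.reguli.length := by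
    have hinj : Set.InjOn D.edec {x | x ∈ Upts} := fun x hx y hy h =>
      D.edec_inj x (hMpts x (hUsub.subset hx)) y (hMpts y (hUsub.subset hy)) h
    rw [hinj.ncard_image]
    have : {x | x ∈ Upts} = (Upts.toFinset : Set ℕ) := by ext; simp
    rw [this, Set.ncard_coe_finset, List.toFinset_card_of_nodup (hMnodup.sublist hUsub),
      List.length_flatMap]
    simp [Arith.affine, mul_comm]
  let ι := Fin C.entries.length
  let κ := Fin C.lines.length
  let p : ι → E := fun i => D.edec C.entries[i].1.1
  let d : ι → E := fun i => D.edec C.entries[i].1.2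
  let w : ι → K := fun i => D.kdec C.entries[i].2
  let pt : ι → ℕ := fun i => A.emul C.entries[i].2 C.entries[i].1.2
  have hent : ∀ i : ι, ∃ r ∈ C.reguli, r.1 = C.entries[i].1 ∧ C.entries[i].2 ∈ r.2 := fun i =>
    mem_entries.1 (List.getElem_mem _)
  have hentM : ∀ i : ι, C.entries[i].1 ∈ M.reguli := fun i => by
    obtain ⟨r, hr, h, -⟩ := hent i
    exact h ▸ hmemM r hr
  have hwd : ∀ i, w i • d i = D.edec (pt i) := fun i => by
    obtain ⟨r, hr, -, h⟩ := hent i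
    exact (D.edec_emul _ ((hreg r hr).2 _ h) _ (hMlt _ (hentM i)).2).symm
  have hpt : ∀ i, pt i ∈ C.entries.map fun e => A.emul e.2 e.1.2 := fun i =>
    List.mem_map_of_mem (List.getElem_mem _)
  have hptc : ∀ i, A.canon (pt i) = true := fun i =>
    hcanon _ (List.mem_append_right _ (hpt i))
  have hlpts : ∀ k : κ, ∀ x ∈ A.linePts C.lines[k], x ∈ C.lines.flatMap A.linePts :=
    fun k x hx => List.mem_flatMap.2 ⟨_, List.getElem_mem _, hx⟩
  have hlc : ∀ k : κ, ∀ x ∈ A.linePts C.lines[k], A.canon x = true := fun k x hx =>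
    hcanon _ (List.mem_append_left _ (hlpts k x hx))
  have hl : ∀ k : κ, C.lines[k].1 < A.Q * A.Q ∧ C.lines[k].2 < A.Q * A.Q := fun k =>
    hlines _ (List.getElem_mem _)
  let Cov : E → Prop := fun t =>
    (∃ k : κ, t ∈ span F {D.edec C.lines[k].1, D.edec C.lines[k].2}) ∨
      ∃ i, ∃ c : F, t = c • w i • d i
  have hCovsmul : ∀ (c : F) (t : E), c ≠ 0 → Cov (c • t) → Cov t := by
    rintro c t hc (⟨k, hk⟩ | ⟨i, a, ha⟩)
    · exact .inl ⟨k, (smul_mem_iff _ hc).1 hk⟩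
    · exact .inr ⟨i, c⁻¹ * a, by rw [mul_smul, ← ha, inv_smul_smul₀ hc]⟩
  have hCovpts : ∀ x ∈ C.pts A, Cov (D.edec x) := by
    intro x hx
    rcases List.mem_append.1 hx with hx | hx
    · obtain ⟨l, hl', hx⟩ := List.mem_flatMap.1 hx
      obtain ⟨k, hk, rfl⟩ := List.getElem_of_mem hl'
      exact .inl ⟨⟨k, hk⟩, D.mem_span_of_mem_linePts (hl ⟨k, hk⟩).1 (hl ⟨k, hk⟩).2 hx⟩
    · obtain ⟨e, he, rfl⟩ := List.mem_map.1 hx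
      obtain ⟨i, hi, rfl⟩ := List.getElem_of_mem he
      exact .inr ⟨⟨i, hi⟩, 1, by rw [one_smul, hwd]; rfl⟩
  have hnotCov : ∀ t, t ≠ 0 → ¬ Cov t → ∃ e, A.canon e = true ∧ e ∈ M.holes ∧ e ∉ C.pts A ∧
      ∃ c : F, c ≠ 0 ∧ D.edec e = c • t := by
    intro t ht hcov
    obtain ⟨e, he, c, hc, h⟩ := D.exists_canon ht
    have h1 : e ∉ C.pts A := fun h2 => hcov (hCovsmul c t hc (h ▸ hCovpts e h2))
    exact ⟨e, he, (hhole e (Arith.mem_canonList he)).resolve_left h1, h1, c, hc, h⟩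
  have main := exists_maximal_of_entries (F := F) hK hE U p d w
    (fun k : κ => D.edec C.lines[k].1) (fun k => D.edec C.lines[k].2)
    (fun i => by rw [hwd]; exact D.edec_ne_zero (hptc i)) ?_
    (fun k => D.linearIndependent_of_canon (hl k).1 (hl k).2 (hlc k)) ?_ ?_ ?_ ?_ ?_ Cov
    (fun t ht => ht) ?_ ?_
  · obtain ⟨S, hS, hcS⟩ := main
    refine ⟨S, hS, ?_⟩
    have h1 := Set.ncard_add_ncard_compl U
    rw [hcardU, D.natCard_eq] at h1
    have h2 : Nat.card {a // a ∉ U} = Uᶜ.ncard := rfl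
    rw [hcS, h2, Nat.card_fin, Nat.card_fin]
    omega
  · intro i j c h
    rw [hwd, hwd] at h
    have h1 : A.emul C.entries[i.1].2 C.entries[i.1].1.2 =
        A.emul C.entries[j.1].2 C.entries[j.1].1.2 := D.eq_of_canon (hptc i) (hptc j) h
    have h2 := (hne.getElem_inj_iff (i := i.1) (hi := by simp [i.2]) (j := j.1)
      (hj := by simp [j.2])).1 (by simpa using h1)
    exact Fin.ext h2
  · intro k l hkl
    rw [disjoint_def]
    intro x hx hx'
    by_contra h0
    obtain ⟨e, he, c, hc⟩ := D.exists_mem_linePts (hl k).1 (hl k).2 hx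
    obtain ⟨e', he', c', hc'⟩ := D.exists_mem_linePts (hl l).1 (hl l).2 hx'
    have hc0 : c ≠ 0 := by
      rintro rfl
      exact h0 (by rw [hc, zero_smul])
    have h1 : e = e' := D.eq_of_canon (c := c⁻¹ * c') (hlc k e he) (hlc l e' he') (by
      rw [mul_smul, ← hc', hc, inv_smul_smul₀ hc0])
    subst h1
    exact getElem_disjoint_of_nodup_flatMap hnl hkl he he'
  · intro i k h
    rw [hwd] at h
    obtain ⟨e, he, c, hc⟩ := D.exists_mem_linePts (hl k).1 (hl k).2 h
    have h1 := D.eq_of_canon (hptc i) (hlc k e he) hc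
    exact hdisj (hlpts k e he) (h1 ▸ hpt i)
  · intro i s
    obtain ⟨r, hr, h, -⟩ := hent i
    obtain ⟨x, hx, hx'⟩ := D.exists_mem_affine (hMlt _ (hentM i)).1 (hMlt _ (hentM i)).2 s
    exact ⟨x, List.mem_flatMap.2 ⟨r, hr, h ▸ hx⟩, hx'⟩
  · intro i j s s' h
    have hi := hMlt _ (hentM i)
    have hj := hMlt _ (hentM j)
    obtain ⟨x, hx, hx'⟩ := D.exists_mem_affine hi.1 hi.2 s
    obtain ⟨y, hy, hy'⟩ := D.exists_mem_affine hj.1 hj.2 s'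
    have hxy : x = y := D.edec_inj x (D.mem_affine hi.1 hi.2 hx).1 y
      (D.mem_affine hj.1 hj.2 hy).1 (by rw [hx', hy']; exact h)
    subst hxy
    have h1 := eq_of_mem_flatMap_of_nodup hMnodup (hentM i) (hentM j) hx hy
    simp only [p, d, h1, and_self]
  · rintro _ ⟨x, hx, rfl⟩
    obtain ⟨r, hr, hx⟩ := List.mem_flatMap.1 hx
    have h1 : (r.1, 1) ∈ C.entries := mem_entries.2 ⟨r, hr, rfl, (hreg r hr).1⟩
    obtain ⟨i, hi, h2⟩ := List.getElem_of_mem h1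
    have hr' := hMlt _ (hmemM r hr)
    obtain ⟨-, s, hs⟩ := D.mem_affine hr'.1 hr'.2 hx
    refine ⟨⟨i, hi⟩, s, ?_, ?_⟩
    · change D.kdec C.entries[i].2 = 1
      rw [h2, D.kdec_eq 1 (by omega), D.dec_one, map_one]
    · change D.edec x = D.edec C.entries[i].1.1 + s • D.edec C.entries[i].1.2
      rw [h2, hs]
  · intro t t' ht ht' hli
    obtain ⟨e, he, heM, hep, c, hc, hec⟩ := hnotCov t (by simpa using hli.ne_zero 0) ht
    obtain ⟨e', he', heM', hep', c', hc', hec'⟩ := hnotCov t' (by simpa using hli.ne_zero 1) ht'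
    have h1 := hpair e ⟨heM, by rw [← Bool.not_eq_true, testBit_mask]; exact hep⟩ e'
      ⟨heM', by rw [← Bool.not_eq_true, testBit_mask]; exact hep'⟩
    rcases h1 with rfl | ⟨x, hx, a, ha, h2⟩
    · exfalso
      have h3 := (LinearIndependent.pair_iff.1 hli) c (-c') (by
        rw [neg_smul, ← hec, ← hec', add_neg_cancel])
      exact hc h3.1
    · have hel := Arith.lt_of_canon hq he
      have hel' := Arith.lt_of_canon hq he'
      obtain ⟨hxl, s, hs⟩ := D.mem_affine hel hel' hx
      have h3 := hCovpts _ h2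
      have h4 := D.edec_ne_zero (hcanon _ h2)
      rw [D.edec_smul ha hxl] at h3 h4
      have h5 := hCovsmul _ _ (fun h0 => h4 (by rw [h0, zero_smul])) h3
      refine ⟨c⁻¹ * s * c', hCovsmul c _ hc ?_⟩
      convert h5 using 1
      rw [hs, hec, hec', smul_add, ← mul_smul, ← mul_smul]
      congr 2
      field_simp
  · intro t ht ht0 z hz x
    by_cases hx : x ∈ U
    swap
    · exact ⟨0, by rwa [zero_smul, add_zero]⟩
    obtain ⟨x, hx, rfl⟩ := hx
    obtain ⟨e, he, heM, -, c, hc, hec⟩ := hnotCov t ht0 ht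
    obtain ⟨a, ha, b, hb, rfl⟩ := D.exists_kdec z hz
    have hel := Arith.lt_of_canon hq he
    have haq : A.q + a < A.Q := Arith.lt_Q hq (by omega)
    have hxM := hUsub.subset hx
    obtain ⟨y, hy, hyU⟩ := hMholes e heM a ha x hxM
    obtain ⟨hyl, s, hs⟩ := D.mem_affine (hMpts x hxM) (D.emul_lt _ haq e hel) hy
    refine ⟨s * c * b⁻¹, ?_⟩
    have h1 : D.edec x + (s * c * b⁻¹) • (b • D.kdec (A.q + a)) • t = D.edec y := by
      rw [hs, D.edec_emul _ haq e hel, hec, smul_assoc, ← mul_smul, smul_comm (D.kdec _) c,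
        ← mul_smul, mul_assoc, inv_mul_cancel₀ hb, mul_one]
    rw [h1]
    rintro ⟨y', hy', h2⟩
    have hy'M := hUsub.subset hy'
    have h3 := D.edec_inj y' (hMpts y' hy'M) y hyl h2
    rw [← Bool.not_eq_true, testBit_mask] at hyU
    exact hyU (h3 ▸ hy'M)

/-- A coding of the elements of a field by the natural numbers below `A.q`, under which
`X ^ 2 - c₁ * X - c₀` has no root. -/
structure BaseCoding (A : Arith) (F : Type*) [Field F] where
  /-- The element of `F` with the given code. -/
  dec : ℕ → F
  two_le : 2 ≤ A.q
  c₀_lt : A.c₀ < A.q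
  c₁_lt : A.c₁ < A.q
  dec_zero : dec 0 = 0
  dec_one : dec 1 = 1
  dec_inj : ∀ a < A.q, ∀ b < A.q, dec a = dec b → a = b
  dec_surj : ∀ c, ∃ s < A.q, dec s = c
  add_lt : ∀ a < A.q, ∀ b < A.q, A.add a b < A.q
  mul_lt : ∀ a < A.q, ∀ b < A.q, A.mul a b < A.q
  dec_add : ∀ a < A.q, ∀ b < A.q, dec (A.add a b) = dec a + dec b
  dec_mul : ∀ a < A.q, ∀ b < A.q, dec (A.mul a b) = dec a * dec b
  irreducible : ∀ r, r ^ 2 ≠ dec A.c₀ + dec A.c₁ * r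
  canonCheck : A.canonCheck = true

theorem add_mul_lt_mul {m n a b : ℕ} (ha : a < m) (hb : b < n) : a + m * b < m * n :=
  calc a + m * b < m + m * b := by omega
    _ = m * (b + 1) := by ring
    _ ≤ m * n := Nat.mul_le_mul_left _ hb

namespace BaseCoding

variable {A : Arith} {F : Type*} [Field F] (B : BaseCoding A F)

/-- The quadratic extension of the base field. -/
abbrev Ext : Type _ := QuadraticAlgebra F (B.dec A.c₀) (B.dec A.c₁)

instance : Fact (∀ r : F, r ^ 2 ≠ B.dec A.c₀ + B.dec A.c₁ * r) := ⟨B.irreducible⟩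

/-- The element of the quadratic extension with the given code. -/
def kdec (x : ℕ) : B.Ext := ⟨B.dec (x % A.q), B.dec (x / A.q)⟩

theorem q_pos (B : BaseCoding A F) : 0 < A.q := by have := B.two_le; omega

theorem kadd_lt (B : BaseCoding A F) {x y : ℕ} (hx : x < A.Q) (hy : y < A.Q) :
    A.kadd x y < A.Q :=
  add_mul_lt_mul (B.add_lt _ (Nat.mod_lt _ B.q_pos) _ (Nat.mod_lt _ B.q_pos))
    (B.add_lt _ (Nat.div_lt_of_lt_mul hx) _ (Nat.div_lt_of_lt_mul hy))

theorem kmul_lt (B : BaseCoding A F) {x y : ℕ} (hx : x < A.Q) (hy : y < A.Q) :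
    A.kmul x y < A.Q := by
  have hx0 := Nat.mod_lt x B.q_pos
  have hy0 := Nat.mod_lt y B.q_pos
  have hx1 : x / A.q < A.q := Nat.div_lt_of_lt_mul hx
  have hy1 : y / A.q < A.q := Nat.div_lt_of_lt_mul hy
  apply add_mul_lt_mul <;>
    simp (maxDischargeDepth := 6) only [B.add_lt, B.mul_lt, B.c₀_lt, B.c₁_lt, hx0, hy0, hx1, hy1]

theorem kdec_add_mul {a b : ℕ} (ha : a < A.q) : B.kdec (a + A.q * b) = ⟨B.dec a, B.dec b⟩ := by
  rw [kdec, Nat.add_mul_mod_self_left, Nat.mod_eq_of_lt ha, Nat.add_mul_div_left _ _ B.q_pos,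
    Nat.div_eq_of_lt ha, zero_add]

theorem kdec_kadd {x y : ℕ} (hx : x < A.Q) (hy : y < A.Q) :
    B.kdec (A.kadd x y) = B.kdec x + B.kdec y := by
  have hx0 := Nat.mod_lt x B.q_pos
  have hy0 := Nat.mod_lt y B.q_pos
  have hx1 : x / A.q < A.q := Nat.div_lt_of_lt_mul hx
  have hy1 : y / A.q < A.q := Nat.div_lt_of_lt_mul hy
  rw [Arith.kadd, B.kdec_add_mul (B.add_lt _ hx0 _ hy0), B.dec_add _ hx0 _ hy0,
    B.dec_add _ hx1 _ hy1]
  rfl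

theorem kdec_kmul {x y : ℕ} (hx : x < A.Q) (hy : y < A.Q) :
    B.kdec (A.kmul x y) = B.kdec x * B.kdec y := by
  have hx0 := Nat.mod_lt x B.q_pos
  have hy0 := Nat.mod_lt y B.q_pos
  have hx1 : x / A.q < A.q := Nat.div_lt_of_lt_mul hx
  have hy1 : y / A.q < A.q := Nat.div_lt_of_lt_mul hy
  rw [Arith.kmul, B.kdec_add_mul (by
    simp (maxDischargeDepth := 6) only [B.add_lt, B.mul_lt, B.c₀_lt, hx0, hy0, hx1, hy1])]
  ext <;> simp (maxDischargeDepth := 6) only [kdec, B.dec_add, B.dec_mul, B.add_lt, B.mul_lt,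
    B.c₀_lt, B.c₁_lt, hx0, hy0, hx1, hy1, QuadraticAlgebra.re_mul, QuadraticAlgebra.im_mul] <;> ring

theorem kdec_inj {x y : ℕ} (hx : x < A.Q) (hy : y < A.Q) (h : B.kdec x = B.kdec y) : x = y := by
  have h1 := B.dec_inj _ (Nat.mod_lt x B.q_pos) _ (Nat.mod_lt y B.q_pos)
    (congrArg QuadraticAlgebra.re h)
  have h2 := B.dec_inj _ (Nat.div_lt_of_lt_mul hx) _ (Nat.div_lt_of_lt_mul hy)
    (congrArg QuadraticAlgebra.im h)
  rw [← Nat.mod_add_div x A.q, ← Nat.mod_add_div y A.q, h1, h2]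

theorem kdec_surj (z : B.Ext) : ∃ x < A.Q, B.kdec x = z := by
  obtain ⟨a, ha, h1⟩ := B.dec_surj z.re
  obtain ⟨b, hb, h2⟩ := B.dec_surj z.im
  exact ⟨a + A.q * b, add_mul_lt_mul ha hb, by rw [B.kdec_add_mul ha, h1, h2]⟩

theorem kdec_zero : B.kdec 0 = 0 := by
  rw [kdec, Nat.zero_mod, Nat.zero_div, B.dec_zero]
  rfl

theorem Q_pos (B : BaseCoding A F) : 0 < A.Q := Nat.mul_pos B.q_pos B.q_pos

/-- The element of the plane over the quadratic extension with the given code. -/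
def edec (x : ℕ) : B.Ext × B.Ext := (B.kdec (x % A.Q), B.kdec (x / A.Q))

theorem edec_add_mul {a b : ℕ} (ha : a < A.Q) : B.edec (a + A.Q * b) = (B.kdec a, B.kdec b) := by
  rw [edec, Nat.add_mul_mod_self_left, Nat.mod_eq_of_lt ha, Nat.add_mul_div_left _ _ B.Q_pos,
    Nat.div_eq_of_lt ha, zero_add]

/-- The coding of the plane over the quadratic extension. -/
def coding : Coding A F B.Ext (B.Ext × B.Ext) where
  dec := B.dec
  kdec := B.kdec
  edec := B.edec
  two_le := B.two_le
  dec_zero := B.dec_zero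
  dec_one := B.dec_one
  dec_surj := B.dec_surj
  kdec_eq s hs := by
    rw [kdec, Nat.mod_eq_of_lt hs, Nat.div_eq_of_lt hs, B.dec_zero]
    rfl
  exists_kdec z hz := by
    have h0 : z.im ≠ 0 := fun h => hz ⟨z.re, by ext <;> simp [h]⟩
    obtain ⟨c, hc, h⟩ := B.dec_surj (z.im⁻¹ * z.re)
    refine ⟨c, hc, z.im, h0, ?_⟩
    have h1 := B.kdec_add_mul (b := 1) hc
    rw [mul_one, add_comm, h, B.dec_one] at h1
    rw [h1]
    ext <;> simp [h0]
  edec_zero := by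
    rw [edec, Nat.zero_mod, Nat.zero_div, B.kdec_zero]
    rfl
  edec_inj x hx y hy h := by
    have h1 := B.kdec_inj (Nat.mod_lt x B.Q_pos) (Nat.mod_lt y B.Q_pos) (congrArg Prod.fst h)
    have h2 := B.kdec_inj (Nat.div_lt_of_lt_mul hx) (Nat.div_lt_of_lt_mul hy)
      (congrArg Prod.snd h)
    rw [← Nat.mod_add_div x A.Q, ← Nat.mod_add_div y A.Q, h1, h2]
  edec_surj t := by
    obtain ⟨a, ha, h1⟩ := B.kdec_surj t.1
    obtain ⟨b, hb, h2⟩ := B.kdec_surj t.2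
    exact ⟨a + A.Q * b, add_mul_lt_mul ha hb, by rw [B.edec_add_mul ha, h1, h2]⟩
  eadd_lt x hx y hy :=
    add_mul_lt_mul (B.kadd_lt (Nat.mod_lt _ B.Q_pos) (Nat.mod_lt _ B.Q_pos))
      (B.kadd_lt (Nat.div_lt_of_lt_mul hx) (Nat.div_lt_of_lt_mul hy))
  emul_lt w hw y hy :=
    add_mul_lt_mul (B.kmul_lt hw (Nat.mod_lt _ B.Q_pos)) (B.kmul_lt hw (Nat.div_lt_of_lt_mul hy))
  edec_eadd x hx y hy := by
    have hx0 := Nat.mod_lt x B.Q_pos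
    have hy0 := Nat.mod_lt y B.Q_pos
    rw [Arith.eadd, B.edec_add_mul (B.kadd_lt hx0 hy0), B.kdec_kadd hx0 hy0,
      B.kdec_kadd (Nat.div_lt_of_lt_mul hx) (Nat.div_lt_of_lt_mul hy)]
    rfl
  edec_emul w hw y hy := by
    have hy0 := Nat.mod_lt y B.Q_pos
    rw [Arith.emul, B.edec_add_mul (B.kmul_lt hw hy0), B.kdec_kmul hw hy0,
      B.kdec_kmul hw (Nat.div_lt_of_lt_mul hy)]
    rfl
  canonCheck := B.canonCheck

theorem exists_maximal (B : BaseCoding A F) {M : Master} {C : Config} {n : ℕ}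
    (hM : M.check A = true) (hC : C.check A M n = true)
    (hsub : (C.reguli.map Prod.fst).Sublist M.reguli) :
    ∃ S : Set (Submodule F (Fin 6 → F)), IsMaximalPartialLineSpread F 6 S ∧ S.ncard = n := by
  have h2 : finrank F B.Ext = 2 := QuadraticAlgebra.finrank_eq_two _ _
  exact exists_maximal_of_check B.coding h2 (by rw [Module.finrank_prod, h2]) hM hC hsub

end BaseCoding

/-- The prime field with three elements, extended by a square root of `2`. -/
def arithThree : Arith := ⟨3, fun a b => (a + b) % 3, fun a b => a * b % 3, 2, 0⟩

/-- The field with four elements, where the codes `2` and `3` stand for a primitive element `α` and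
its square, extended by `ω` with `ω ^ 2 = α + ω`. -/
def arithFour : Arith :=
  ⟨4, Nat.xor, fun a b => if a = 0 ∨ b = 0 then 0 else (a + b - 2) % 3 + 1, 2, 1⟩

/-- The prime field with five elements, extended by a square root of `2`. -/
def arithFive : Arith := ⟨5, fun a b => (a + b) % 5, fun a b => a * b % 5, 2, 0⟩

theorem exists_code_of_inj {F : Type*} [Fintype F] {q : ℕ} (hq : Fintype.card F = q) {dec : ℕ → F}
    (h : ∀ a < q, ∀ b < q, dec a = dec b → a = b) (c : F) : ∃ s < q, dec s = c := by
  have : Function.Bijective fun x : Fin q => dec x :=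
    (Fintype.bijective_iff_injective_and_card _).2
      ⟨fun x y hxy => Fin.ext (h _ x.2 _ y.2 hxy), by rw [Fintype.card_fin, hq]⟩
  obtain ⟨s, hs⟩ := this.2 c
  exact ⟨s, s.2, hs⟩

section

variable {F : Type*} [Field F]

theorem natCast_inj_of_card {q : ℕ} [CharP F q] (a : ℕ) (ha : a < q) (b : ℕ)
    (hb : b < q) (h : (a : F) = b) : a = b :=
  ((CharP.natCast_eq_natCast F q).1 h).eq_of_lt_of_lt ha hb

theorem natCast_mod_card {q : ℕ} [CharP F q] (a : ℕ) : ((a % q : ℕ) : F) = a :=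
  (CharP.natCast_eq_natCast F q).2 (Nat.mod_modEq a q)

variable [Fintype F]

/-- The coding of the field with three elements. -/
def baseCodingThree (hF : Fintype.card F = 3) : BaseCoding arithThree F :=
  have : Fact (Nat.Prime 3) := ⟨Nat.prime_three⟩
  have : CharP F 3 := charP_of_card_eq_prime hF
  { dec := fun a => a
    two_le := by decide
    c₀_lt := by decide
    c₁_lt := by decide
    dec_zero := Nat.cast_zero
    dec_one := Nat.cast_one
    dec_inj := natCast_inj_of_card (q := 3)
    dec_surj := exists_code_of_inj hF (natCast_inj_of_card (q := 3))
    add_lt := fun _ _ _ _ => Nat.mod_lt _ (by decide)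
    mul_lt := fun _ _ _ _ => Nat.mod_lt _ (by decide)
    dec_add := fun a _ b _ => (natCast_mod_card (a + b)).trans (Nat.cast_add a b)
    dec_mul := fun a _ b _ => (natCast_mod_card (a * b)).trans (Nat.cast_mul a b)
    irreducible := by
      intro r hr
      have h3 : (3 : F) = 0 := by exact_mod_cast CharP.cast_eq_zero F 3
      have hp : r ^ 3 = r := hF ▸ FiniteField.pow_card r
      simp only [arithThree, Nat.cast_ofNat, Nat.cast_zero, zero_mul, add_zero] at hr
      have h0 : r = 0 := by linear_combination hp - r * hr
      have h2 : (2 : F) = 0 := by rw [← hr, h0]; ring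
      exact one_ne_zero (α := F) (by linear_combination h3 - h2)
    canonCheck := by decide +kernel }

/-- The coding of the field with five elements. -/
def baseCodingFive (hF : Fintype.card F = 5) : BaseCoding arithFive F :=
  have : Fact (Nat.Prime 5) := ⟨Nat.prime_five⟩
  have : CharP F 5 := charP_of_card_eq_prime hF
  { dec := fun a => a
    two_le := by decide
    c₀_lt := by decide
    c₁_lt := by decide
    dec_zero := Nat.cast_zero
    dec_one := Nat.cast_one
    dec_inj := natCast_inj_of_card (q := 5)
    dec_surj := exists_code_of_inj hF (natCast_inj_of_card (q := 5))
    add_lt := fun _ _ _ _ => Nat.mod_lt _ (by decide)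
    mul_lt := fun _ _ _ _ => Nat.mod_lt _ (by decide)
    dec_add := fun a _ b _ => (natCast_mod_card (a + b)).trans (Nat.cast_add a b)
    dec_mul := fun a _ b _ => (natCast_mod_card (a * b)).trans (Nat.cast_mul a b)
    irreducible := by
      intro r hr
      have h5 : (5 : F) = 0 := by exact_mod_cast CharP.cast_eq_zero F 5
      have hp : r ^ 5 = r := hF ▸ FiniteField.pow_card r
      simp only [arithFive, Nat.cast_ofNat, Nat.cast_zero, zero_mul, add_zero] at hr
      have h0 : r = 0 := by
        linear_combination 2 * hp - 2 * (r ^ 3 + 2 * r) * hr - r * h5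
      have h2 : (2 : F) = 0 := by rw [← hr, h0]; ring
      exact one_ne_zero (α := F) (by linear_combination h5 - 2 * h2)
    canonCheck := by decide +kernel }

theorem two_eq_zero_of_card_eq_four (hF : Fintype.card F = 4) : (2 : F) = 0 := by
  have : Fact (Nat.Prime 2) := ⟨Nat.prime_two⟩
  have : CharP F 2 := charP_of_card_eq_prime_pow (f := 2) hF
  exact_mod_cast CharP.cast_eq_zero F 2

theorem exists_sq_eq_of_card_eq_four (hF : Fintype.card F = 4) : ∃ α : F, α ^ 2 = α + 1 := by
  classical
  obtain ⟨α, hα⟩ : ∃ α : F, α ∉ ({0, 1} : Finset F) := by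
    by_contra! h
    have h1 := Finset.card_le_card (fun x _ => h x : Finset.univ ⊆ ({0, 1} : Finset F))
    have h2 := Finset.card_le_two (a := (0 : F)) (b := 1)
    rw [Finset.card_univ] at h1
    omega
  simp only [Finset.mem_insert, Finset.mem_singleton, not_or] at hα
  have hp : α ^ 4 = α := hF ▸ FiniteField.pow_card α
  have h2 := two_eq_zero_of_card_eq_four hF
  refine ⟨α, mul_left_cancel₀ (mul_ne_zero hα.1 (sub_ne_zero.2 hα.2)) ?_⟩
  linear_combination hp - (α ^ 3 - α) * h2

/-- The coding of the field with four elements. -/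
def baseCodingFour (hF : Fintype.card F = 4) {α : F} (hα : α ^ 2 = α + 1) :
    BaseCoding arithFour F :=
  have h2 := two_eq_zero_of_card_eq_four hF
  have h0 : α ≠ 0 := by rintro rfl; simp at hα
  have h1 : α ≠ 1 := by rintro rfl; simp at hα
  have hinj : ∀ a < 4, ∀ b < 4, (Nat.cast (a % 2) + Nat.cast (a / 2) * α : F) =
      Nat.cast (b % 2) + Nat.cast (b / 2) * α → a = b := by
    intro a ha b hb
    interval_cases a <;> interval_cases b <;> norm_num <;> grind
  { dec := fun a => (a % 2 : ℕ) + (a / 2 : ℕ) * α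
    two_le := by decide
    c₀_lt := by decide
    c₁_lt := by decide
    dec_zero := by simp
    dec_one := by simp
    dec_inj := hinj
    dec_surj := exists_code_of_inj hF hinj
    add_lt := by decide
    mul_lt := by decide
    dec_add := by
      change ∀ a < 4, ∀ b < 4, _
      intro a ha b hb
      interval_cases a <;> interval_cases b <;> norm_num [arithFour] <;> grind
    dec_mul := by
      change ∀ a < 4, ∀ b < 4, _
      intro a ha b hb
      interval_cases a <;> interval_cases b <;> norm_num [arithFour] <;> grind
    irreducible := by
      intro r hr
      have hp : r ^ 4 = r := hF ▸ FiniteField.pow_card r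
      norm_num [arithFour] at hr
      apply one_ne_zero (α := F)
      grind
    canonCheck := by decide +kernel }

end

/-- Representatives of the multiplicative group of the quadratic extension modulo that of the base
field. -/
def scalars (q : ℕ) : List ℕ := 1 :: List.range' q q

/-- The quotient of two elements of the quadratic extension. -/
def Arith.quot (A : Arith) (a b : ℕ) : ℕ :=
  ((List.range A.Q).find? fun w => (A.kmul w b).beq a).getD 0

/-- The quotients of the members of a list by its first member. -/
def Arith.normalize (A : Arith) : List ℕ → List ℕ
  | [] => []
  | w :: ws => (w :: ws).map fun w' => A.quot w' w

/-- A configuration that uses the affine lines of `M` with the given lists of multipliers. -/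
def Config.ofMaster (M : Master) (lines : List (ℕ × ℕ)) (ws : List (List ℕ)) : Config :=
  ⟨lines, (M.reguli.zip ws).filter fun r => !r.2.isEmpty⟩

/-- Lists of multipliers that break up at most `k` lines over the quadratic extension by means of
`R` affine lines with a single multiplier, apart from one affine line for the remaining points. -/
def Arith.splits (A : Arith) : ℕ → ℕ → List (List ℕ)
  | 0, _ => []
  | k + 1, R =>
    if R ≤ A.q then List.replicate R [1] ++ [A.normalize ((scalars A.q).drop R)] else
    List.replicate (A.q + 1) [1] ++ A.splits k (R - A.q)

/-- The data of a family of configurations in which `rest` lines of one of the reguli of lines of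
`K × K` are broken up, and `gaps` of the points on each of those lines remain uncovered. -/
structure Family where
  /-- The affine lines. -/
  master : Master
  /-- The number of uncovered points per line. -/
  gaps : ℕ
  /-- The number of lines of the regulus that are broken up. -/
  rest : ℕ

/-- The configuration of the family with deficiency `δ`. -/
def Family.member (A : Arith) (G : Family) (δ : ℕ) : Config :=
  let a := A.q + 1 - G.gaps
  let R := (δ - (if G.rest = 0 then 0 else G.rest + a * (A.q - G.rest))) / A.q
  let k := (R + A.q - 1) / A.q
  .ofMaster G.master
    (((scalars A.q).drop G.rest).map (fun w => (w, A.Q * w)) ++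
      (List.range' (A.q + k) (A.Q - A.q - k)).map fun z => (z + A.Q, A.emul A.q (z + A.Q)))
    (List.replicate a ((scalars A.q).take G.rest) ++ A.splits k R)

theorem map_fst_zip_sublist {α β : Type*} (l : List α) (l' : List β) :
    ((l.zip l').map Prod.fst).Sublist l := by
  induction l generalizing l' with
  | nil => simp
  | cons x l ih =>
    cases l' with
    | nil => simp
    | cons y l' => simpa using ih l'

theorem Config.ofMaster_sublist (M : Master) (lines : List (ℕ × ℕ)) (ws : List (List ℕ)) :
    ((Config.ofMaster M lines ws).reguli.map Prod.fst).Sublist M.reguli :=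
  (List.filter_sublist.map Prod.fst).trans (map_fst_zip_sublist _ _)

/-- The affine lines of a configuration, with its uncovered points as holes. -/
def Config.master (A : Arith) (C : Config) : Master :=
  let cov := mask (C.pts A)
  ⟨A.canonList.filter fun t => !cov.testBit t, C.reguli.map Prod.fst⟩

/-- The configurations with the given lines that are listed together with their deficiencies are
valid, where `N` is the size of a spread. -/
def sporadicCheck (A : Arith) (N : ℕ) (lines : List (ℕ × ℕ))
    (L : List (ℕ × List ((ℕ × ℕ) × List ℕ))) : Bool :=
  L.all fun x =>
    let C : Config := ⟨lines, x.2⟩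
    (C.master A).check A && C.check A (C.master A) (N - x.1)

/-- Each of the `k` deficiencies from `δ₀` on is listed or is attained by a valid configuration of
the corresponding family. -/
def spectrumCheck (A : Arith) (N : ℕ) (L : List (ℕ × List ((ℕ × ℕ) × List ℕ))) (G : ℕ → Family)
    (δ₀ k : ℕ) : Bool :=
  (List.range' δ₀ k).all fun δ =>
    L.any (fun x => x.1.beq δ) || ((G δ).member A δ).check A (G δ).master (N - δ)

theorem BaseCoding.exists_maximal_of_spectrumCheck {A : Arith} {F : Type*} [Field F]
    (B : BaseCoding A F) {N δ₀ k n : ℕ} {lines : List (ℕ × ℕ)}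
    {L : List (ℕ × List ((ℕ × ℕ) × List ℕ))} {G : ℕ → Family}
    (hG : ∀ δ, (G δ).master.check A = true) (hL : sporadicCheck A N lines L = true)
    (h : spectrumCheck A N L G δ₀ k = true) (hn : n + δ₀ ≤ N) (hn' : N < n + δ₀ + k) :
    ∃ S : Set (Submodule F (Fin 6 → F)), IsMaximalPartialLineSpread F 6 S ∧ S.ncard = n := by
  simp only [spectrumCheck, List.all_eq_true, List.mem_range'_1, Bool.or_eq_true,
    List.any_eq_true, Nat.beq_eq] at h
  simp only [sporadicCheck, List.all_eq_true, Bool.and_eq_true] at hL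
  have hsub : N - (N - n) = n := by omega
  rcases h (N - n) ⟨by omega, by omega⟩ with ⟨x, hx, hδ⟩ | h
  · obtain ⟨h1, h2⟩ := hL x hx
    rw [hδ, hsub] at h2
    exact B.exists_maximal h1 h2 (List.Sublist.refl _)
  · rw [hsub] at h
    exact B.exists_maximal (hG _) h (Config.ofMaster_sublist _ _ _)

/-- Affine lines over the field with three elements for configurations without holes. -/
def masterThreeZero : Master :=
  ⟨[], [(30, 12), (1, 29), (23, 41), (70, 53), (17, 13), (20, 32), (64, 42), (19, 46), (39, 14),
   (43, 35), (0, 37), (72, 48), (59, 15), (7, 28)]⟩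

/-- Affine lines over the field with three elements for configurations with one hole. -/
def masterThreeOne : Master :=
  ⟨[1], [(59, 9), (14, 10), (27, 11), (28, 12), (24, 29), (33, 41), (25, 53), (26, 13), (5, 32),
   (57, 42), (47, 46), (66, 14), (41, 35), (2, 37)]⟩

/-- Affine lines over the field with three elements for configurations with two holes. -/
def masterThreeTwo : Master :=
  ⟨[1, 9], [(24, 10), (31, 11), (25, 12), (22, 29), (64, 41), (26, 53), (66, 13), (68, 32), (59,
   42), (51, 46), (49, 14), (32, 35), (37, 37)]⟩

/-- Affine lines over the field with four elements. -/
def masterFour : Master :=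
  ⟨scalars 4, [(147, 16), (238, 17), (217, 18), (136, 19), (95, 20), (139, 70), (12, 82), (167,
   110), (87, 122), (112, 21), (89, 66), (195, 87), (241, 104), (74, 125), (216, 22), (224, 78),
   (51, 88), (157, 101), (183, 115), (28, 23), (212, 74), (188, 93), (182, 99), (124, 116), (42,
   24), (43, 75), (5, 83), (9, 103), (19, 127), (24, 25), (58, 79), (31, 86), (239, 97)]⟩

/-- Affine lines over the field with five elements. -/
def masterFive : Master :=
  ⟨scalars 5, [(603, 25), (375, 26), (361, 27), (133, 28), (520, 29), (81, 30), (41, 127), (255,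
   157), (616, 187), (475, 217), (576, 247), (394, 31), (588, 132), (582, 163), (460, 194), (153,
   220), (235, 226), (539, 32), (483, 137), (596, 169), (194, 196), (535, 203), (619, 230), (267,
   33), (139, 142), (450, 170), (446, 178), (213, 206), (359, 239), (159, 34), (189, 147), (490,
   151), (326, 180), (523, 214), (300, 243), (50, 35), (365, 129), (226, 164), (309, 199), (175,
   209), (351, 244), (227, 36), (35, 134), (368, 165), (187, 176), (415, 212), (464, 248), (492,
   37), (21, 139), (493, 171), (565, 183), (319, 215), (541, 227), (469, 38), (337, 144), (454,
   152), (253, 185), (340, 223), (613, 231), (374, 39), (59, 149), (397, 158), (52, 192), (609,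
   201)]⟩

/-- Lines of the configurations of small deficiency over the field with three elements. -/
def linesThree : List (ℕ × ℕ) :=
  [(1, 15), (4, 37), (10, 30), (11, 33), (12, 27), (13, 34), (14, 32)]

/-- Configurations of small deficiency over the field with three elements. -/
def sporadicThree : List (ℕ × List ((ℕ × ℕ) × List ℕ)) :=
  [(3, []), (4, [((0, 3), [1, 4])])]

/-- Lines of the configurations of small deficiency over the field with four elements. -/
def linesFour : List (ℕ × ℕ) :=
  [(1, 88), (4, 64), (5, 97), (6, 18), (7, 112), (16, 70), (17, 78), (19, 67), (21, 71), (22, 66),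
   (26, 79), (27, 74), (28, 75), (30, 77)]

/-- Configurations of small deficiency over the field with four elements. -/
def sporadicFour : List (ℕ × List ((ℕ × ℕ) × List ℕ)) :=
  [(3, []), (5, [((0, 23), [1, 5, 6]), ((1, 29), [1, 4, 7])]), (6, [((0, 24), [1])]), (9, [((0,
   24), [1]), ((1, 69), [1])])]

/-- Lines of the configurations of small deficiency over the field with five elements. -/
def linesFive : List (ℕ × ℕ) :=
  [(1, 145), (5, 225), (6, 202), (7, 179), (8, 153), (25, 141), (28, 126), (30, 138), (32, 128),
   (34, 142), (36, 129), (37, 136), (38, 132), (39, 143), (40, 134), (42, 139), (43, 144), (44,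
   125), (45, 127), (47, 140), (48, 135), (49, 131)]

/-- Configurations of small deficiency over the field with five elements. -/
def sporadicFive : List (ℕ × List ((ℕ × ℕ) × List ℕ)) :=
  [(4, []), (6, [((0, 26), [1, 5, 7])]), (7, [((0, 46), [1, 5])]), (8, [((0, 9), [1])]), (11,
   [((0, 46), [1, 5]), ((1, 9), [1])]), (12, [((0, 9), [1]), ((1, 27), [1])]), (16, [((0, 9),
   [1]), ((1, 27), [1]), ((5, 29), [1])])]

/-- The families of configurations over the field with three elements. -/
def familyThree (δ : ℕ) : Family :=
  match δ % 3 with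
  | 0 => ⟨masterThreeZero, 4, 0⟩
  | 1 => ⟨masterThreeOne, 1, 1⟩
  | _ => ⟨masterThreeTwo, 2, 1⟩

/-- The families of configurations over the field with four elements. -/
def familyFour (δ : ℕ) : Family := ⟨masterFour, 1, δ % 4⟩

/-- The families of configurations over the field with five elements. -/
def familyFive (δ : ℕ) : Family := ⟨masterFive, 1, δ % 5⟩

section

variable {F : Type*} [Field F] [Fintype F] {n : ℕ}

theorem exists_maximal_of_card_eq_three (hF : Fintype.card F = 3) (hn : n + 3 ≤ 91)
    (hn' : 60 ≤ n) :
    ∃ S : Set (Submodule F (Fin 6 → F)), IsMaximalPartialLineSpread F 6 S ∧ S.ncard = n := by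
  refine (baseCodingThree hF).exists_maximal_of_spectrumCheck (N := 91) (δ₀ := 3) (k := 29)
    (lines := linesThree) (L := sporadicThree) (G := familyThree) (fun δ => ?_)
    (by decide +kernel) (by decide +kernel) hn (by omega)
  rw [familyThree]
  split <;> decide +kernel

theorem exists_maximal_of_card_eq_four (hF : Fintype.card F = 4) (hn : n + 3 ≤ 273)
    (hn' : 178 ≤ n) :
    ∃ S : Set (Submodule F (Fin 6 → F)), IsMaximalPartialLineSpread F 6 S ∧ S.ncard = n := by
  obtain ⟨α, hα⟩ := exists_sq_eq_of_card_eq_four hF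
  have hM : masterFour.check arithFour = true := by decide +kernel
  exact (baseCodingFour hF hα).exists_maximal_of_spectrumCheck (N := 273) (δ₀ := 3) (k := 93)
    (lines := linesFour) (L := sporadicFour) (G := familyFour) (fun _ => hM)
    (by decide +kernel) (by decide +kernel) hn (by omega)

set_option maxHeartbeats 4000000 in
theorem exists_maximal_of_card_eq_five (hF : Fintype.card F = 5) (hn : n + 4 ≤ 651)
    (hn' : 403 ≤ n) :
    ∃ S : Set (Submodule F (Fin 6 → F)), IsMaximalPartialLineSpread F 6 S ∧ S.ncard = n := by
  have hM : masterFive.check arithFive = true := by decide +kernel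
  exact (baseCodingFive hF).exists_maximal_of_spectrumCheck (N := 651) (δ₀ := 4) (k := 245)
    (lines := linesFive) (L := sporadicFive) (G := familyFive) (fun _ => hM)
    (by decide +kernel) (by decide +kernel) hn (by omega)

end

theorem mul_log_two_le_mul_log {a j k : ℕ} (h : 2 ^ j ≤ a ^ k) :
    (j : ℝ) * Real.log 2 ≤ k * Real.log a := by
  rw [← Real.log_pow, ← Real.log_pow]
  exact Real.log_le_log (by positivity) (by exact_mod_cast h)

end LineSpread

/-- In PG(5,q) for q = 3, 4, 5, there exist maximal partial line spreads of
every integer size n with `2*q^3*log q ≤ n ≤ (q^6-1)/(q^2-1) - δ`, where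
δ = 3 for q = 3, δ = 3 for q = 4 and δ = 4 for q = 5. -/
theorem stmt15 (q δ : ℕ)
    (hqδ : (q = 3 ∧ δ = 3) ∨ (q = 4 ∧ δ = 3) ∨ (q = 5 ∧ δ = 4))
    (F : Type*) [Field F] [Fintype F] (hq : Fintype.card F = q)
    (n : ℕ) (h1 : 2 * (q : ℝ) ^ 3 * Real.log q ≤ (n : ℝ))
    (h2 : n ≤ (q ^ 6 - 1) / (q ^ 2 - 1) - δ) :
    ∃ S : Set (Submodule F (Fin 6 → F)),
      IsMaximalPartialLineSpread F 6 S ∧ S.ncard = n := by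
  have hlog := Real.log_two_gt_d9
  rcases hqδ with ⟨rfl, rfl⟩ | ⟨rfl, rfl⟩ | ⟨rfl, rfl⟩
  · have h3 := LineSpread.mul_log_two_le_mul_log (show 2 ^ 19 ≤ 3 ^ 12 by norm_num)
    push_cast at h1 h3
    have hn : 59 < n := by exact_mod_cast (by linarith : (59 : ℝ) < n)
    norm_num at h2
    exact LineSpread.exists_maximal_of_card_eq_three hq (by omega) hn
  · have h4 := LineSpread.mul_log_two_le_mul_log (show 2 ^ 2 ≤ 4 ^ 1 by norm_num)
    push_cast at h1 h4
    have hn : 177 < n := by exact_mod_cast (by linarith : (177 : ℝ) < n)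
    norm_num at h2
    exact LineSpread.exists_maximal_of_card_eq_four hq (by omega) hn
  · have h5 := LineSpread.mul_log_two_le_mul_log (show 2 ^ 65 ≤ 5 ^ 28 by norm_num)
    push_cast at h1 h5
    have hn : 402 < n := by exact_mod_cast (by linarith : (402 : ℝ) < n)
    norm_num at h2
    exact LineSpread.exists_maximal_of_card_eq_five hq (by omega) hn
end

section
/- Let q be a square prime power and N ≥ 3 odd. If S is a maximal partial line spread of PG(N,q) of deficiency δ > 0, i.e. |S| = (q^{N+1}−1)/(q^2−1) − δ with δ > 0, then δ ≥ √q + 1. -/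
section LineSums

open Finset Module

variable {F V ι : Type*} [Field F] [AddCommGroup V] [Module F V]

theorem mem_span_singleton_comm_of_ne_zero {x y : V} (hy : y ≠ 0)
    (h : y ∈ Submodule.span F {x}) : x ∈ Submodule.span F {y} := by
  obtain ⟨c, rfl⟩ := Submodule.mem_span_singleton.1 h
  have hc : c ≠ 0 := by rintro rfl; simp at hy
  exact Submodule.mem_span_singleton.2 ⟨c⁻¹, by rw [smul_smul, inv_mul_cancel₀ hc, one_smul]⟩

theorem finrank_span_pair_of_notMem {x y : V} (hx : x ≠ 0) (hy : y ∉ Submodule.span F {x}) :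
    finrank F (Submodule.span F {x, y}) = 2 := by
  have hli : LinearIndependent F ![x, y] := (LinearIndependent.pair_iff' hx).2
    fun a ha => hy (Submodule.mem_span_singleton.2 ⟨a, ha⟩)
  have := finrank_span_eq_card hli
  rwa [Matrix.range_cons_cons_empty, Fintype.card_fin] at this

theorem exists_mem_notMem_span_singleton [FiniteDimensional F V] {W : Submodule F V}
    (hW : 1 < finrank F W) (x : V) : ∃ y ∈ W, y ∉ Submodule.span F {x} := by
  refine SetLike.not_le_iff_exists.1 fun hle => ?_
  have := (Submodule.finrank_mono hle).trans (finrank_span_le_card (R := F) {x})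
  simp at this
  omega

theorem finrank_map_mkQ_span_singleton_add_one [FiniteDimensional F V] {M : Submodule F V} {x : V}
    (hx : x ≠ 0) (hxM : x ∈ M) :
    finrank F (M.map (Submodule.span F {x}).mkQ) + 1 = finrank F M := by
  have hker : (LinearMap.ker ((Submodule.span F {x}).mkQ.domRestrict M)) =
      Submodule.span F {(⟨x, hxM⟩ : M)} := by
    ext y
    simp [Submodule.mem_span_singleton, Subtype.ext_iff]
  have h := LinearMap.finrank_range_add_finrank_ker ((Submodule.span F {x}).mkQ.domRestrict M)
  rwa [hker, finrank_span_singleton (by simpa using hx), LinearMap.range_domRestrict] at h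

open Classical in
theorem card_mem_submodule [Fintype F] [Fintype V] (W : Submodule F V) :
    #{x : V | x ∈ W} = Fintype.card F ^ finrank F W := by
  rw [← Module.card_eq_pow_finrank (K := F) (V := W), Fintype.card_subtype]

open Classical in
theorem card_mem_submodule_ne_zero [Fintype F] [Fintype V] (W : Submodule F V) :
    #{x : V | x ∈ W ∧ x ≠ 0} + 1 = Fintype.card F ^ finrank F W := by
  rw [← card_mem_submodule W]
  have : ({x : V | x ∈ W ∧ x ≠ 0} : Finset V) = ({x : V | x ∈ W} : Finset V).erase 0 := by
    ext x; simp [and_comm]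
  rw [this, card_erase_add_one (by simp)]

open Classical in
/-- Counting the indices whose vector lies in `W` point by point; each point of `W` is counted
once for each of its `q - 1` nonzero vectors. -/
theorem card_mem_mul_eq_sum [Fintype F] [Fintype V] {s : Finset ι} {v : ι → V}
    (hv : ∀ i ∈ s, v i ≠ 0) (W : Submodule F V) :
    #{i ∈ s | v i ∈ W} * (Fintype.card F - 1) =
      ∑ x : V with x ∈ W ∧ x ≠ 0, #{i ∈ s | v i ∈ Submodule.span F {x}} := by
  refine Eq.trans ?_ (sum_card_bipartiteAbove_eq_sum_card_bipartiteBelow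
    fun i x => v i ∈ Submodule.span F {x})
  rw [card_filter, sum_mul]
  refine sum_congr rfl fun i hi => ?_
  have hi := hv i hi
  split_ifs with hW
  · have h1 := card_mem_submodule_ne_zero (F := F) (Submodule.span F {v i})
    rw [finrank_span_singleton hi, pow_one] at h1
    rw [← h1, one_mul, Nat.add_sub_cancel]
    congr 1
    ext x
    simp only [mem_filter, mem_univ, true_and, bipartiteAbove]
    constructor
    · rintro ⟨hx, hx0⟩
      exact ⟨⟨(Submodule.span_singleton_le_iff_mem _ _).2 hW hx, hx0⟩,
        mem_span_singleton_comm_of_ne_zero hx0 hx⟩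
    · rintro ⟨⟨_, hx0⟩, hx⟩
      exact ⟨mem_span_singleton_comm_of_ne_zero hi hx, hx0⟩
  · rw [zero_mul, eq_comm, card_eq_zero]
    ext x
    simp only [mem_filter, mem_univ, true_and, bipartiteAbove, notMem_empty, iff_false]
    rintro ⟨⟨hx, hx0⟩, hix⟩
    exact hW ((Submodule.span_singleton_le_iff_mem _ _).2 hx hix)

open Classical in
theorem exists_point_transversal {A : Finset ι} {v : ι → V} (hv : ∀ i ∈ A, v i ≠ 0) :
    ∃ t ⊆ A, ∀ x : V, x ≠ 0 → #{i ∈ t | v i ∈ Submodule.span F {x}} =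
      if ∃ i ∈ A, v i ∈ Submodule.span F {x} then 1 else 0 := by
  obtain ⟨t, htA, hinj, himg⟩ := exists_subset_injOn_image_eq_of_surjOn
    (A : Set ι) (A.image fun i => Submodule.span F {v i}) (by rw [coe_image]; exact Set.surjOn_image _ _)
  have key : ∀ i ∈ A, ∀ x, x ≠ 0 → (v i ∈ Submodule.span F {x} ↔
      Submodule.span F {v i} = Submodule.span F {x}) := by
    intro i hi x hx
    constructor
    · intro h
      exact le_antisymm ((Submodule.span_singleton_le_iff_mem _ _).2 h)
        ((Submodule.span_singleton_le_iff_mem _ _).2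
          (mem_span_singleton_comm_of_ne_zero (hv i hi) h))
    · intro h
      exact h ▸ Submodule.mem_span_singleton_self _
  refine ⟨t, htA, fun x hx => ?_⟩
  split_ifs with h
  · obtain ⟨i, hi, hix⟩ := h
    have : Submodule.span F {v i} ∈ t.image fun i => Submodule.span F {v i} :=
      himg ▸ mem_image_of_mem (fun i => Submodule.span F {v i}) hi
    obtain ⟨j, hj, hji⟩ := mem_image.1 this
    have hi' := (key i hi x hx).1 hix
    refine card_eq_one.2 ⟨j, ?_⟩
    ext l
    simp only [mem_filter, mem_singleton]
    constructor
    · rintro ⟨hl, hlx⟩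
      exact hinj hl hj (((key l (htA hl) x hx).1 hlx).trans (hi'.symm.trans hji.symm))
    · rintro rfl
      exact ⟨hj, (key l (htA hj) x hx).2 (hji.trans hi')⟩
  · rw [card_eq_zero, filter_eq_empty_iff]
    exact fun i hi hix => h ⟨i, htA hi, hix⟩

theorem card_dual_vanishing [Fintype F] [FiniteDimensional F V] [Fintype (Dual F V)]
    (W : Submodule F V) [DecidablePred fun φ : Dual F V => φ ∈ W.dualAnnihilator] :
    #{φ : Dual F V | φ ∈ W.dualAnnihilator} = Fintype.card F ^ (finrank F V - finrank F W) := by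
  classical
  have := Subspace.finrank_add_finrank_dualAnnihilator_eq W
  rw [← this, Nat.add_sub_cancel_left, ← card_mem_submodule]
  congr!

open Classical in
theorem card_dual_vanishing_pair [Fintype F] [FiniteDimensional F V] [Fintype (Dual F V)]
    (x y : V) : #{φ : Dual F V | φ x = 0 ∧ φ y = 0} =
      Fintype.card F ^ (finrank F V - finrank F (Submodule.span F {x, y})) := by
  rw [← card_dual_vanishing]
  congr 1
  ext φ
  simp only [mem_filter, mem_univ, true_and, Submodule.mem_dualAnnihilator]
  constructor
  · rintro ⟨hx, hy⟩ w hw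
    obtain ⟨a, b, rfl⟩ := Submodule.mem_span_pair.1 hw
    simp [hx, hy]
  · exact fun h => ⟨h x (Submodule.subset_span (by simp)), h y (Submodule.subset_span (by simp))⟩

open Classical in
theorem card_dual_vanishing_singleton [Fintype F] [FiniteDimensional F V] [Fintype (Dual F V)]
    {x : V} (hx : x ≠ 0) :
    #{φ : Dual F V | φ x = 0} = Fintype.card F ^ (finrank F V - 1) := by
  have := card_dual_vanishing_pair (F := F) x x
  rw [Set.pair_eq_singleton, finrank_span_singleton hx] at this
  simpa only [and_self] using this

open Classical in
theorem sum_card_dual_vanishing [Fintype F] [FiniteDimensional F V] [Fintype (Dual F V)]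
    {s : Finset ι} {v : ι → V} (hv : ∀ i ∈ s, v i ≠ 0) :
    ∑ φ : Dual F V, #{i ∈ s | φ (v i) = 0} = #s * Fintype.card F ^ (finrank F V - 1) := by
  refine (sum_card_bipartiteAbove_eq_sum_card_bipartiteBelow
    fun (φ : Dual F V) i => φ (v i) = 0).trans ?_
  rw [← smul_eq_mul, ← sum_const]
  exact sum_congr rfl fun i hi => card_dual_vanishing_singleton (hv i hi)

open Classical in
theorem le_sum_sq_card_dual_vanishing [Fintype F] [FiniteDimensional F V] [Fintype (Dual F V)]
    (hV : finrank F V = 3) {s : Finset ι} {v : ι → V} (hv : ∀ i ∈ s, v i ≠ 0) :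
    (#s * #s * Fintype.card F + #s * (Fintype.card F ^ 2 - Fintype.card F) : ℤ) ≤
      ∑ φ : Dual F V, (#{i ∈ s | φ (v i) = 0} : ℤ) ^ 2 := by
  have hsq : ∀ φ : Dual F V, (#{i ∈ s | φ (v i) = 0} : ℤ) ^ 2 =
      (#{p ∈ s ×ˢ s | φ (v p.1) = 0 ∧ φ (v p.2) = 0} : ℕ) := by
    intro φ
    rw [filter_product (fun i => φ (v i) = 0) (fun i => φ (v i) = 0), card_product, Nat.cast_mul, sq]
  rw [sum_congr rfl fun φ _ => hsq φ, ← Nat.cast_sum]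
  have hswap := sum_card_bipartiteAbove_eq_sum_card_bipartiteBelow (s := (univ : Finset (Dual F V)))
    (t := s ×ˢ s) fun φ p => φ (v p.1) = 0 ∧ φ (v p.2) = 0
  simp only [bipartiteAbove, bipartiteBelow] at hswap
  rw [hswap, Nat.cast_sum]
  have hpair : ∀ p ∈ s ×ˢ s, (Fintype.card F : ℤ) +
      (if p.1 = p.2 then (Fintype.card F ^ 2 - Fintype.card F : ℤ) else 0) ≤
      (#{φ : Dual F V | φ (v p.1) = 0 ∧ φ (v p.2) = 0} : ℕ) := by
    rintro ⟨i, j⟩ hp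
    obtain ⟨hi, hj⟩ := mem_product.1 hp
    dsimp only at hi hj ⊢
    split_ifs with h
    · subst h
      have := card_dual_vanishing_singleton (F := F) (hv i hi)
      rw [hV] at this
      simp [this]
    · rw [card_dual_vanishing_pair, hV, add_zero]
      have h2 : finrank F (Submodule.span F {v i, v j}) ≤ 2 := by
        have := finrank_span_finset_le_card (R := F) ({v i, v j} : Finset V)
        simp only [coe_insert, coe_singleton] at this
        exact this.trans card_le_two
      exact_mod_cast Nat.le_self_pow (by omega) _
  refine le_trans (le_of_eq ?_) (sum_le_sum hpair)
  rw [sum_add_distrib, sum_const, card_product, sum_product]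
  simp only [sum_ite_eq]
  rw [sum_congr rfl fun i hi => if_pos hi, sum_const]
  simp

open Classical in
/-- In a plane where every line misses some point of the family and carries at least `k` vectors
of it, no line carries more than `d` vectors, where `k * q + d` is the size of the family. -/
theorem card_line_le [Fintype F] [FiniteDimensional F V]
    (hV : finrank F V = 3) {s : Finset ι} {v : ι → V} {k d : ℕ}
    (hs : #s = k * Fintype.card F + d)
    (hk : ∀ φ : Dual F V, φ ≠ 0 → k ≤ #{i ∈ s | φ (v i) = 0})
    {φ : Dual F V} (hφ : φ ≠ 0) {x : V} (hx : x ≠ 0) (hφx : φ x = 0)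
    (hsx : ∀ i ∈ s, v i ∉ Submodule.span F {x}) :
    #{i ∈ s | φ (v i) = 0} ≤ d := by
  have : Finite V := Module.finite_of_finite F
  have : Finite (Dual F V) := Module.finite_of_finite F
  have := Fintype.ofFinite (Dual F V)
  set q := Fintype.card F with hq
  have hq1 : 1 < q := Fintype.one_lt_card
  set m : Dual F V → ℕ := fun ψ => #{i ∈ s | ψ (v i) = 0} with hm
  set T : Finset (Dual F V) := {ψ | ψ x = 0} with hT
  have hTcard : #T = q ^ 2 := by rw [hT, card_dual_vanishing_singleton hx, hV]
  have hTsum : ∑ ψ ∈ T, m ψ = #s * q := by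
    refine (sum_card_bipartiteAbove_eq_sum_card_bipartiteBelow
      fun (ψ : Dual F V) i => ψ (v i) = 0).trans ?_
    rw [← smul_eq_mul, ← sum_const]
    refine sum_congr rfl fun i hi => ?_
    rw [bipartiteBelow, hT, filter_filter, card_dual_vanishing_pair, hV]
    rw [finrank_span_pair_of_notMem hx (hsx i hi)]
    simp [hq]
  set R : Finset (Dual F V) := {ψ | ψ ∈ Submodule.span F {φ}} with hR
  have hRcard : #R = q := by rw [hR, card_mem_submodule, finrank_span_singleton hφ, pow_one]
  have h0R : (0 : Dual F V) ∈ R := by simp [hR]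
  have hRT : R ⊆ T := by
    intro ψ hψ
    obtain ⟨c, rfl⟩ := Submodule.mem_span_singleton.1 (mem_filter.1 hψ).2
    simp [hT, hφx]
  have hm0 : m 0 = #s := by simp [hm]
  have hks : k ≤ #s := (hk φ hφ).trans (card_filter_le _ _)
  have hsum : ∑ ψ ∈ R, ((m ψ : ℤ) - k) ≤ ∑ ψ ∈ T, ((m ψ : ℤ) - k) := by
    refine sum_le_sum_of_subset_of_nonneg hRT fun ψ _ hψ => ?_
    have := hk ψ (by rintro rfl; exact hψ h0R)
    have : k ≤ m ψ := this
    omega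
  have hRsum : ∑ ψ ∈ R, ((m ψ : ℤ) - k) = (q - 1) * (m φ - k) + (#s - k) := by
    rw [← sum_erase_add _ _ h0R, hm0]
    congr 1
    have : ∀ ψ ∈ R.erase 0, ((m ψ : ℤ) - k) = m φ - k := by
      intro ψ hψ
      obtain ⟨hψ0, hψ⟩ := mem_erase.1 hψ
      obtain ⟨c, rfl⟩ := Submodule.mem_span_singleton.1 (mem_filter.1 hψ).2
      have hc : c ≠ 0 := by rintro rfl; simp at hψ0
      simp [hm, hc]
    rw [sum_congr rfl this, sum_const, card_erase_of_mem h0R, hRcard, nsmul_eq_mul,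
      Nat.cast_sub hq1.le, Nat.cast_one]
  rw [hRsum, sum_sub_distrib, sum_const, hTcard, ← Nat.cast_sum, hTsum, hs] at hsum
  have hgoal : (q - 1 : ℤ) * m φ ≤ (q - 1) * d := by
    push_cast at hsum
    simp only [nsmul_eq_mul] at hsum
    push_cast at hsum
    linarith
  have := le_of_mul_le_mul_left hgoal (by have : (1 : ℤ) < q := by exact_mod_cast hq1
                                          linarith)
  exact_mod_cast this

open Classical in
theorem plane_inequality [Fintype F] [FiniteDimensional F V]
    (hV : finrank F V = 3) {s : Finset ι} {v : ι → V} (hv : ∀ i ∈ s, v i ≠ 0) {k d : ℕ}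
    (hs : #s = k * Fintype.card F + d)
    (hk : ∀ φ : Dual F V, φ ≠ 0 → k ≤ #{i ∈ s | φ (v i) = 0})
    (hx : ∀ φ : Dual F V, φ ≠ 0 → ∃ x, x ≠ 0 ∧ φ x = 0 ∧ ∀ i ∈ s, v i ∉ Submodule.span F {x}) :
    k ≤ d ∧ k * Fintype.card F + k * d + d ≤ k ^ 2 + d ^ 2 := by
  have : Finite (Dual F V) := Module.finite_of_finite F
  have := Fintype.ofFinite (Dual F V)
  have hd : ∀ φ : Dual F V, φ ≠ 0 → #{i ∈ s | φ (v i) = 0} ≤ d := by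
    intro φ hφ
    obtain ⟨x, hx0, hφx, hsx⟩ := hx φ hφ
    exact card_line_le hV hs hk hφ hx0 hφx hsx
  have hdual : finrank F (Dual F V) = 3 := by rw [Subspace.dual_finrank_eq, hV]
  have hdcard : Fintype.card (Dual F V) = Fintype.card F ^ 3 := by
    rw [Module.card_eq_pow_finrank (K := F), hdual]
  have : Nontrivial (Dual F V) := Module.nontrivial_of_finrank_pos (R := F) (by omega)
  obtain ⟨φ₀, hφ₀⟩ := exists_ne (0 : Dual F V)
  refine ⟨(hk φ₀ hφ₀).trans (hd φ₀ hφ₀), ?_⟩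
  have hsum := sum_card_dual_vanishing (F := F) hv
  have hsq := le_sum_sq_card_dual_vanishing hV hv
  set q := Fintype.card F with hq
  have hq1 : 1 < q := Fintype.one_lt_card
  set m : Dual F V → ℕ := fun ψ => #{i ∈ s | ψ (v i) = 0} with hm
  change ∑ φ, m φ = _ at hsum
  change _ ≤ ∑ φ, (m φ : ℤ) ^ 2 at hsq
  have hm0 : m 0 = #s := by simp [hm]
  have hle : ∑ φ, ((m φ : ℤ) - k) * (m φ - d) ≤ (#s - k) * (#s - d) := by
    rw [← add_sum_erase _ _ (mem_univ (0 : Dual F V)), hm0]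
    have : ∑ φ ∈ univ.erase 0, ((m φ : ℤ) - k) * (m φ - d) ≤ 0 := by
      refine sum_nonpos fun φ hφ => ?_
      have h1 : (k : ℤ) ≤ m φ := by exact_mod_cast hk φ (ne_of_mem_erase hφ)
      have h2 : (m φ : ℤ) ≤ d := by exact_mod_cast hd φ (ne_of_mem_erase hφ)
      exact mul_nonpos_of_nonneg_of_nonpos (by linarith) (by linarith)
    linarith
  have hexp : ∑ φ, ((m φ : ℤ) - k) * (m φ - d) =
      ∑ φ, (m φ : ℤ) ^ 2 - (k + d) * ((∑ φ, m φ : ℕ) : ℤ) + q ^ 3 * (k * d) := by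
    have : ∀ φ, ((m φ : ℤ) - k) * (m φ - d) = (m φ : ℤ) ^ 2 - (k + d) * m φ + k * d :=
      fun φ => by ring
    rw [sum_congr rfl fun φ _ => this φ, sum_add_distrib, sum_sub_distrib, ← mul_sum, sum_const,
      card_univ, hdcard]
    simp
  rw [hexp, hsum, hV, hs] at hle
  rw [hs] at hsq
  push_cast at hle hsq
  have hfin : ((q : ℤ) - 1) * q * (k * q + k * d + d) ≤ (q - 1) * q * (k ^ 2 + d ^ 2) := by
    norm_num at hle
    linarith
  have hpos : (0 : ℤ) < (q - 1) * q := by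
    have : (1 : ℤ) < q := by exact_mod_cast hq1
    exact mul_pos (by linarith) (by linarith)
  exact_mod_cast le_of_mul_le_mul_left hfin hpos

open Classical in
/-- A family of `δ * (q + 1)` points, repetitions allowed, all of whose hyperplane sections have
size congruent to `δ` modulo `q`. -/
structure IsMinihyper (F : Type*) {V ι : Type*} [Field F] [Fintype F] [AddCommGroup V] [Module F V]
    (s : Finset ι) (v : ι → V) (δ : ℕ) : Prop where
  ne_zero : ∀ i ∈ s, v i ≠ 0
  card_eq : #s = δ * (Fintype.card F + 1)
  modEq : ∀ φ : Dual F V, φ ≠ 0 → #{i ∈ s | φ (v i) = 0} ≡ δ [MOD Fintype.card F]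

open Classical in
/-- A family of points that is, with multiplicities, the union of the point sets of the lines
`L j`. -/
structure IsSumOfLines {F V ι κ : Type*} [Field F] [AddCommGroup V] [Module F V] [Fintype κ]
    (s : Finset ι) (v : ι → V) (L : κ → Submodule F V) : Prop where
  finrank_eq : ∀ j, finrank F (L j) = 2
  card_eq : ∀ x : V, x ≠ 0 → #{i ∈ s | v i ∈ Submodule.span F {x}} = #{j | x ∈ L j}

open Classical in
theorem IsSumOfLines.le_card_span_singleton {κ : Type*} [Fintype κ] {s : Finset ι} {v : ι → V}
    {L : κ → Submodule F V} (h : IsSumOfLines s v L) {l : Submodule F V} {y : V} (hy : y ∈ l)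
    (hy0 : y ≠ 0) : #{j | L j = l} ≤ #{i ∈ s | v i ∈ Submodule.span F {y}} := by
  rw [h.card_eq y hy0]
  refine card_le_card fun j hj => ?_
  simp only [mem_filter, mem_univ, true_and] at hj ⊢
  rwa [hj]

open Classical in
theorem IsSumOfLines.card_line [Fintype F] [FiniteDimensional F V] {κ : Type*} [Fintype κ]
    {s : Finset ι} {v : ι → V} {L : κ → Submodule F V} (h : IsSumOfLines s v L)
    (hv : ∀ i ∈ s, v i ≠ 0) {l : Submodule F V} (hl : finrank F l = 2) :
    #{j | L j = l} * Fintype.card F ≤ #{i ∈ s | v i ∈ l} ∧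
      #{i ∈ s | v i ∈ l} ≤ #{j | L j = l} * Fintype.card F + Fintype.card κ := by
  have : Finite V := Module.finite_of_finite F
  have := Fintype.ofFinite V
  have hq1 : 1 < Fintype.card F := Fintype.one_lt_card
  have hsum := card_mem_mul_eq_sum hv l
  rw [sum_congr rfl fun x hx => h.card_eq x (mem_filter.1 hx).2.2] at hsum
  have hswap := sum_card_bipartiteAbove_eq_sum_card_bipartiteBelow
    (s := ({x | x ∈ l ∧ x ≠ 0} : Finset V)) (t := (univ : Finset κ)) fun x j => x ∈ L j
  simp only [bipartiteAbove, bipartiteBelow] at hswap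
  rw [hswap] at hsum
  obtain ⟨r, hr⟩ : ∃ r, Fintype.card F = r + 1 := ⟨_, (Nat.succ_pred_eq_of_pos (by omega)).symm⟩
  have hr0 : 0 < r := by omega
  have hinter : ∀ j, #{x ∈ ({x | x ∈ l ∧ x ≠ 0} : Finset V) | x ∈ L j} + 1 =
      Fintype.card F ^ finrank F (l ⊓ L j : Submodule F V) := by
    intro j
    rw [← card_mem_submodule_ne_zero, filter_filter]
    congr 3
    ext x
    simp only [Submodule.mem_inf]
    tauto
  have heq : ∀ j, L j = l →
      #{x ∈ ({x | x ∈ l ∧ x ≠ 0} : Finset V) | x ∈ L j} = r * (r + 1) + r := by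
    intro j hj
    have := hinter j
    rw [hj, inf_idem, hl, hr] at this
    rw [hj]
    linarith
  have hne : ∀ j, L j ≠ l → #{x ∈ ({x | x ∈ l ∧ x ≠ 0} : Finset V) | x ∈ L j} ≤ r := by
    intro j hj
    have h1 : finrank F (l ⊓ L j : Submodule F V) ≤ 1 := by
      by_contra hcon
      have e1 := Submodule.eq_of_le_of_finrank_le (inf_le_left : l ⊓ L j ≤ l) (by omega)
      have e2 := Submodule.eq_of_le_of_finrank_le (inf_le_right : l ⊓ L j ≤ L j)
        (by rw [h.finrank_eq]; omega)
      exact hj (e2.symm.trans e1)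
    have := hinter j
    have h2 := Nat.pow_le_pow_right (show 0 < Fintype.card F by omega) h1
    rw [pow_one] at h2
    omega
  rw [hr] at hsum ⊢
  rw [Nat.add_sub_cancel] at hsum
  constructor
  · refine le_of_mul_le_mul_right ?_ hr0
    rw [hsum, card_filter, sum_mul, sum_mul]
    refine sum_le_sum fun j _ => ?_
    split_ifs with hj
    · rw [heq j hj]; linarith
    · simp
  · refine le_of_mul_le_mul_right ?_ hr0
    rw [hsum, card_filter, ← card_univ, card_eq_sum_ones, sum_mul, ← sum_add_distrib, sum_mul]
    refine sum_le_sum fun j _ => ?_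
    split_ifs with hj
    · rw [heq j hj]; linarith
    · have := hne j hj; linarith

theorem no_small_plane_parameters {q k d δ : ℕ} (hk : 0 < k) (hkd : k ≤ d) (hdδ : d ≤ δ)
    (hδ : (δ - 1) ^ 2 < q) (h : k * q + k * d + d ≤ k ^ 2 + d ^ 2) : False := by
  obtain ⟨a, rfl⟩ : ∃ a, k = a + 1 := ⟨k - 1, by omega⟩
  obtain ⟨c, rfl⟩ : ∃ c, d = a + 1 + c := ⟨d - (a + 1), by omega⟩
  have h1 : (a + c) ^ 2 ≤ (δ - 1) ^ 2 := Nat.pow_le_pow_left (by omega) 2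
  have h2 : (a + 1) * ((a + c) ^ 2 + 1) ≤ (a + 1) * q := Nat.mul_le_mul_left _ (by omega)
  nlinarith [Nat.zero_le (a * c), Nat.zero_le (a * a * c), Nat.zero_le (a * c * c),
    Nat.zero_le (a * a * a)]

open Classical in
/-- If each projection of the family from a point outside it is a sum of few lines, then the
family itself contains all points of some line. -/
theorem exists_full_line [Fintype F] [FiniteDimensional F V] (hV : 2 ≤ finrank F V)
    {s : Finset ι} {v : ι → V} {δ : ℕ} (hδ0 : 0 < δ) (hδ : (δ - 1) ^ 2 < Fintype.card F)
    (hδq : δ < Fintype.card F) (hv : ∀ i ∈ s, v i ≠ 0)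
    (hproj : ∀ x : V, x ≠ 0 → (∀ i ∈ s, v i ∉ Submodule.span F {x}) →
      ∃ L : Fin δ → Submodule F (V ⧸ Submodule.span F {x}),
        IsSumOfLines s ((Submodule.span F {x}).mkQ ∘ v) L) :
    ∃ l : Submodule F V, finrank F l = 2 ∧
      ∀ x ∈ l, x ≠ 0 → ∃ i ∈ s, v i ∈ Submodule.span F {x} := by
  by_contra! hcon
  set q := Fintype.card F with hq
  obtain ⟨x₀, hx₀, hsx₀⟩ : ∃ x : V, x ≠ 0 ∧ ∀ i ∈ s, v i ∉ Submodule.span F {x} := by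
    have : Nontrivial V := Module.nontrivial_of_finrank_pos (R := F) (by omega)
    obtain ⟨x, hx⟩ := exists_ne (0 : V)
    obtain ⟨y, -, hy⟩ := exists_mem_notMem_span_singleton (W := (⊤ : Submodule F V))
      (by rw [finrank_top]; omega) x
    obtain ⟨z, -, hz⟩ := hcon _ (finrank_span_pair_of_notMem hx hy)
    exact ⟨z, hz⟩
  obtain ⟨L₀, hL₀⟩ := hproj x₀ hx₀ hsx₀
  set M : Submodule F V := (L₀ ⟨0, hδ0⟩).comap (Submodule.span F {x₀}).mkQ with hMdef
  have hmap : M.map (Submodule.span F {x₀}).mkQ = L₀ ⟨0, hδ0⟩ :=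
    Submodule.map_comap_eq_of_surjective (Submodule.mkQ_surjective _) _
  have hx₀M : x₀ ∈ M := by
    have : (Submodule.span F {x₀}).mkQ x₀ = 0 := by
      simp
    rw [hMdef, Submodule.mem_comap, this]
    exact zero_mem _
  have hM : finrank F M = 3 := by
    rw [← finrank_map_mkQ_span_singleton_add_one hx₀ hx₀M, hmap, hL₀.finrank_eq]
  set b := #{i ∈ s | v i ∈ M} with hb
  have hcount : ∀ x, x ≠ 0 → x ∈ M → (∀ i ∈ s, v i ∉ Submodule.span F {x}) →
      ∀ L : Fin δ → Submodule F (V ⧸ Submodule.span F {x}),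
        IsSumOfLines s ((Submodule.span F {x}).mkQ ∘ v) L →
        b / q = #{j | L j = M.map (Submodule.span F {x}).mkQ} ∧ b % q ≤ δ := by
    intro x hx hxM hsx L hL
    have hbx : b = #{i ∈ s | ((Submodule.span F {x}).mkQ ∘ v) i ∈
        M.map (Submodule.span F {x}).mkQ} := by
      rw [hb]
      congr 1
      refine filter_congr fun i _ => ?_
      rw [Function.comp_apply, ← Submodule.mem_comap, Submodule.comap_map_mkQ,
        sup_eq_right.2 ((Submodule.span_singleton_le_iff_mem _ _).2 hxM)]
    have h2 := finrank_map_mkQ_span_singleton_add_one hx hxM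
    obtain ⟨hlo, hhi⟩ := hL.card_line (fun i hi => by simpa using hsx i hi)
      (l := M.map (Submodule.span F {x}).mkQ) (by omega)
    rw [← hbx, ← hq, Fintype.card_fin] at hhi
    rw [← hbx, ← hq] at hlo
    have hdiv : b / q = #{j | L j = M.map (Submodule.span F {x}).mkQ} :=
      Nat.div_eq_of_lt_le hlo (by rw [Nat.succ_mul]; omega)
    refine ⟨hdiv, ?_⟩
    have := Nat.div_add_mod b q
    rw [hdiv, mul_comm] at this
    omega
  obtain ⟨hk₀, hd₀⟩ := hcount x₀ hx₀ hx₀M hsx₀ L₀ hL₀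
  have hkpos : 0 < b / q := by
    rw [hk₀, hmap]
    exact card_pos.2 ⟨⟨0, hδ0⟩, by simp⟩
  obtain ⟨p, hp⟩ := LinearMap.exists_leftInverse_of_injective M.subtype M.ker_subtype
  have hp : ∀ i, v i ∈ M → (p (v i) : V) = v i := by
    intro i hi
    have := LinearMap.congr_fun hp ⟨v i, hi⟩
    exact congrArg Subtype.val this
  have hmiss : ∀ φ : Dual F M, φ ≠ 0 → ∃ x : M, x ≠ 0 ∧ φ x = 0 ∧
      ∀ i ∈ s, v i ∉ Submodule.span F {(x : V)} := by
    intro φ hφ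
    have h2 : finrank F ((LinearMap.ker φ).map M.subtype) = 2 := by
      rw [Submodule.finrank_map_subtype_eq]
      have := Dual.finrank_ker_add_one_of_ne_zero hφ
      omega
    obtain ⟨x, hx, hx0, hsx⟩ := hcon _ h2
    obtain ⟨y, hy, rfl⟩ := Submodule.mem_map.1 hx
    exact ⟨y, by rintro rfl; simp at hx0, hy, hsx⟩
  obtain ⟨hkd, hineq⟩ := plane_inequality (s := {i ∈ s | v i ∈ M}) (v := fun i => p (v i))
    (k := b / q) (d := b % q) hM
    (by
      intro i hi h0
      obtain ⟨hi, hiM⟩ := mem_filter.1 hi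
      have := hp i hiM
      rw [h0] at this
      exact hv i hi this.symm)
    (by rw [mul_comm]; exact (Nat.div_add_mod b q).symm)
    (by
      intro φ hφ
      obtain ⟨x, hx0, hφx, hsx⟩ := hmiss φ hφ
      have hx0' : (x : V) ≠ 0 := by simpa using hx0
      obtain ⟨L, hL⟩ := hproj x hx0' hsx
      obtain ⟨y, hy, hyx⟩ := exists_mem_notMem_span_singleton (W := LinearMap.ker φ)
        (by have := Dual.finrank_ker_add_one_of_ne_zero hφ; omega) x
      rw [(hcount x hx0' x.2 hsx L hL).1]
      refine (hL.le_card_span_singleton (y := (Submodule.span F {(x : V)}).mkQ y)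
        (Submodule.mem_map_of_mem y.2) ?_).trans (card_le_card fun i hi => ?_)
      · intro h
        refine hyx ?_
        rw [Submodule.mkQ_apply, Submodule.Quotient.mk_eq_zero, Submodule.mem_span_singleton] at h
        obtain ⟨c, hc⟩ := h
        exact Submodule.mem_span_singleton.2 ⟨c, Subtype.ext hc⟩
      · obtain ⟨hi, hiy⟩ := mem_filter.1 hi
        obtain ⟨c, hc⟩ := Submodule.mem_span_singleton.1 hiy
        rw [Function.comp_apply, ← map_smul, Submodule.mkQ_apply, Submodule.mkQ_apply, eq_comm,
          Submodule.Quotient.eq, Submodule.mem_span_singleton] at hc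
        obtain ⟨a, ha⟩ := hc
        have hvi : v i = ((a • x + c • y : M) : V) := by
          simp [ha]
        have hiM : v i ∈ M := hvi ▸ Subtype.coe_prop _
        have hpi : p (v i) = a • x + c • y := Subtype.ext ((hp i hiM).trans hvi)
        have hy' : φ y = 0 := hy
        simp only [mem_filter, hi, hiM, hpi, map_add, map_smul, hφx, hy', and_self, smul_zero,
          add_zero])
    (by
      intro φ hφ
      obtain ⟨x, hx0, hφx, hsx⟩ := hmiss φ hφ
      refine ⟨x, hx0, hφx, fun i hi h => ?_⟩
      obtain ⟨hi, hiM⟩ := mem_filter.1 hi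
      obtain ⟨c, hc⟩ := Submodule.mem_span_singleton.1 h
      refine hsx i hi (Submodule.mem_span_singleton.2 ⟨c, ?_⟩)
      rw [← hp i hiM, ← hc]
      rfl)
  exact no_small_plane_parameters hkpos hkd hd₀ hδ hineq

open Classical in
theorem IsMinihyper.exists_sdiff_line [Fintype F] [FiniteDimensional F V] {s : Finset ι}
    {v : ι → V} {δ : ℕ} (h : IsMinihyper F s v (δ + 1)) {l : Submodule F V} (hl : finrank F l = 2)
    (hfull : ∀ x ∈ l, x ≠ 0 → ∃ i ∈ s, v i ∈ Submodule.span F {x}) :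
    ∃ t ⊆ s, IsMinihyper F t v δ ∧ ∀ x : V, x ≠ 0 → #{i ∈ s | v i ∈ Submodule.span F {x}} =
      (if x ∈ l then 1 else 0) + #{i ∈ t | v i ∈ Submodule.span F {x}} := by
  have : Finite V := Module.finite_of_finite F
  have := Fintype.ofFinite V
  obtain ⟨u, hu, hux⟩ := exists_point_transversal (F := F) (A := {i ∈ s | v i ∈ l}) (v := v)
    fun i hi => h.ne_zero i (mem_filter.1 hi).1
  have hus : u ⊆ s := hu.trans (filter_subset _ _)
  have hpoint : ∀ x : V, x ≠ 0 →
      #{i ∈ u | v i ∈ Submodule.span F {x}} = if x ∈ l then 1 else 0 := by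
    intro x hx
    rw [hux x hx]
    refine if_congr ⟨?_, fun hxl => ?_⟩ rfl rfl
    · rintro ⟨i, hi, hix⟩
      obtain ⟨hi, hil⟩ := mem_filter.1 hi
      exact (Submodule.span_singleton_le_iff_mem _ _).2 hil
        (mem_span_singleton_comm_of_ne_zero (h.ne_zero i hi) hix)
    · obtain ⟨i, hi, hix⟩ := hfull x hxl hx
      exact ⟨i, mem_filter.2 ⟨hi, (Submodule.span_singleton_le_iff_mem _ _).2 hxl hix⟩, hix⟩
  have hsplit : ∀ P : ι → Prop, #{i ∈ s | P i} = #{i ∈ u | P i} + #{i ∈ s \ u | P i} := by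
    intro P
    rw [← card_union_of_disjoint (disjoint_filter_filter disjoint_sdiff), ← filter_union,
      union_sdiff_of_subset hus]
  obtain ⟨r, hr⟩ : ∃ r, Fintype.card F = r + 1 :=
    ⟨_, (Nat.succ_pred_eq_of_pos Fintype.card_pos).symm⟩
  have hr0 : 0 < r := by
    have : 1 < Fintype.card F := Fintype.one_lt_card
    omega
  have hsub : ∀ W : Submodule F V, #{i ∈ u | v i ∈ W} * r + 1 =
      (r + 1) ^ finrank F (l ⊓ W : Submodule F V) := by
    intro W
    have h1 := card_mem_mul_eq_sum (F := F) (fun i hi => h.ne_zero i (hus hi)) W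
    rw [sum_congr rfl fun x hx => hpoint x (mem_filter.1 hx).2.2, hr, Nat.add_sub_cancel,
      ← card_filter, filter_filter] at h1
    rw [← hr, ← card_mem_submodule_ne_zero, h1]
    congr 3
    ext x
    simp only [Submodule.mem_inf]
    tauto
  have hfull_sub : ∀ W : Submodule F V, l ≤ W → #{i ∈ u | v i ∈ W} = r + 1 + 1 := by
    intro W hW
    have := hsub W
    rw [inf_eq_left.2 hW, hl] at this
    refine Nat.eq_of_mul_eq_mul_right hr0 ?_
    linarith
  refine ⟨s \ u, sdiff_subset, ⟨fun i hi => h.ne_zero i (sdiff_subset hi), ?_, fun φ hφ => ?_⟩,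
    fun x hx => ?_⟩
  · have h1 := hfull_sub ⊤ le_top
    have h2 := h.card_eq
    have h3 := hsplit fun _ => True
    simp only [filter_true, Submodule.mem_top] at h1 h3
    rw [h3, h1, hr] at h2
    rw [hr]
    linarith
  · have hu1 : #{i ∈ u | φ (v i) = 0} ≡ 1 [MOD Fintype.card F] := by
      by_cases hlφ : l ≤ LinearMap.ker φ
      · have := hfull_sub _ hlφ
        simp only [LinearMap.mem_ker] at this
        rw [this, hr]
        simp [Nat.ModEq]
      · have h1 := hsub (LinearMap.ker φ)
        have h2 : finrank F (l ⊓ LinearMap.ker φ : Submodule F V) = 1 := by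
          have hlt := Submodule.finrank_lt_finrank_of_lt (inf_lt_left.2 hlφ)
          have h3 := Submodule.finrank_sup_add_finrank_inf_eq l (LinearMap.ker φ)
          have h4 := Dual.finrank_ker_add_one_of_ne_zero hφ
          have h5 := Submodule.finrank_le (l ⊔ LinearMap.ker φ)
          omega
        simp only [LinearMap.mem_ker] at h1
        rw [h2, pow_one] at h1
        have : #{i ∈ u | φ (v i) = 0} = 1 := Nat.eq_of_mul_eq_mul_right hr0 (by omega)
        rw [this]
    have h1 := h.modEq φ hφ
    rw [hsplit, add_comm] at h1
    exact Nat.ModEq.add_right_cancel hu1 h1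
  · rw [hsplit, hpoint x hx]

open Classical in
theorem IsSumOfLines.cons {s t : Finset ι} {v : ι → V} {δ : ℕ} {L : Fin δ → Submodule F V}
    (h : IsSumOfLines t v L) {l : Submodule F V} (hl : finrank F l = 2)
    (hcard : ∀ x : V, x ≠ 0 → #{i ∈ s | v i ∈ Submodule.span F {x}} =
      (if x ∈ l then 1 else 0) + #{i ∈ t | v i ∈ Submodule.span F {x}}) :
    IsSumOfLines s v (Fin.cons l L : Fin (δ + 1) → Submodule F V) := by
  refine ⟨Fin.cases hl h.finrank_eq, fun x hx => ?_⟩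
  rw [hcard x hx, h.card_eq x hx, Fin.card_filter_univ_succ']
  simp

theorem IsMinihyper.quotient [Fintype F] {s : Finset ι} {v : ι → V} {δ : ℕ}
    (h : IsMinihyper F s v δ) {x : V} (hsx : ∀ i ∈ s, v i ∉ Submodule.span F {x}) :
    IsMinihyper F s ((Submodule.span F {x}).mkQ ∘ v) δ where
  ne_zero i hi := by simpa using hsx i hi
  card_eq := h.card_eq
  modEq φ hφ := h.modEq (φ ∘ₗ (Submodule.span F {x}).mkQ) fun h0 =>
    hφ (LinearMap.cancel_right (Submodule.mkQ_surjective _) |>.1 (h0.trans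
      (LinearMap.zero_comp _).symm))

open Classical in
theorem IsMinihyper.isSumOfLines_of_finrank_eq_two [Fintype F] [FiniteDimensional F V]
    (hV : finrank F V = 2) {s : Finset ι} {v : ι → V} {δ : ℕ} (h : IsMinihyper F s v δ)
    (hδ : δ < Fintype.card F) : IsSumOfLines s v fun _ : Fin δ => (⊤ : Submodule F V) := by
  have : Finite V := Module.finite_of_finite F
  have := Fintype.ofFinite V
  refine ⟨fun _ => by rw [finrank_top, hV], fun x hx => ?_⟩
  have hlow : ∀ y : V, y ≠ 0 → δ ≤ #{i ∈ s | v i ∈ Submodule.span F {y}} := by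
    intro y hy
    obtain ⟨φ, hφ, hφy⟩ : ∃ φ : Dual F V, φ ≠ 0 ∧ Submodule.span F {y} = LinearMap.ker φ := by
      obtain ⟨z, -, hz⟩ := exists_mem_notMem_span_singleton (W := (⊤ : Submodule F V))
        (by rw [finrank_top]; omega) y
      obtain ⟨φ, hφz, hφ⟩ := Submodule.exists_le_ker_of_notMem hz
      have hφ0 : φ ≠ 0 := by rintro rfl; simp at hφz
      refine ⟨φ, hφ0, Submodule.eq_of_le_of_finrank_le hφ ?_⟩
      have := Dual.finrank_ker_add_one_of_ne_zero hφ0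
      rw [finrank_span_singleton hy]
      omega
    have h1 := h.modEq φ hφ
    simp only [hφy, LinearMap.mem_ker]
    exact ((Nat.mod_eq_of_lt hδ).symm.trans (Eq.symm h1)).trans_le (Nat.mod_le _ _)
  have hsum := card_mem_mul_eq_sum (F := F) h.ne_zero ⊤
  have hcard := card_mem_submodule_ne_zero (F := F) (⊤ : Submodule F V)
  rw [finrank_top, hV] at hcard
  simp only [Submodule.mem_top, filter_true, true_and] at hsum hcard
  obtain ⟨r, hr⟩ : ∃ r, Fintype.card F = r + 1 :=
    ⟨_, (Nat.succ_pred_eq_of_pos Fintype.card_pos).symm⟩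
  have htotal : ∑ y : V with y ≠ 0, δ =
      ∑ y : V with y ≠ 0, #{i ∈ s | v i ∈ Submodule.span F {y}} := by
    rw [← hsum, sum_const, h.card_eq, smul_eq_mul, hr, Nat.add_sub_cancel]
    rw [hr] at hcard
    have : #{y : V | y ≠ 0} = r * (r + 1 + 1) := by linarith
    rw [this]
    ring
  have := (sum_eq_sum_iff_of_le fun y hy => hlow y (mem_filter.1 hy).2).1 htotal x
    (mem_filter.2 ⟨mem_univ _, hx⟩)
  rw [← this]
  simp

/-- Minihypers of small deficiency are sums of lines. -/
theorem IsMinihyper.exists_isSumOfLines [Fintype F] (n : ℕ) :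
    ∀ {V : Type*} [AddCommGroup V] [Module F V] [FiniteDimensional F V], finrank F V = n + 2 →
    ∀ {δ : ℕ} {s : Finset ι} {v : ι → V}, IsMinihyper F s v δ → (δ - 1) ^ 2 < Fintype.card F →
    δ < Fintype.card F → ∃ L : Fin δ → Submodule F V, IsSumOfLines s v L := by
  induction n with
  | zero => exact fun hV _ _ _ h _ hδ => ⟨_, h.isSumOfLines_of_finrank_eq_two hV hδ⟩
  | succ n ihn =>
    intro V _ _ _ hV δ
    induction δ with
    | zero =>
      intro s v h _ _
      have hs : s = ∅ := by simpa using h.card_eq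
      exact ⟨Fin.elim0, fun j => j.elim0, fun x _ => by simp [hs]⟩
    | succ δ ihδ =>
      intro s v h hδ hδq
      obtain ⟨l, hl, hfull⟩ := exists_full_line (F := F) (by omega) δ.succ_pos hδ hδq h.ne_zero
        fun x hx hsx => ihn (by
          have := finrank_map_mkQ_span_singleton_add_one (F := F) hx (Submodule.mem_top (x := x))
          rw [Submodule.map_top, Submodule.range_mkQ, finrank_top, finrank_top] at this
          omega) (h.quotient hsx) hδ hδq
      obtain ⟨t, -, ht, hcard⟩ := h.exists_sdiff_line hl hfull
      obtain ⟨L, hL⟩ := ihδ ht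
        (lt_of_le_of_lt (Nat.pow_le_pow_left (Nat.sub_le_sub_right δ.le_succ 1) 2) hδ)
        (by omega)
      exact ⟨_, hL.cons hl hcard⟩

open Classical in
/-- The points not covered by a partial line spread form a minihyper. -/
theorem exists_isMinihyper_holes [Fintype F] [Fintype V] {S : Finset (Submodule F V)}
    (hrank : ∀ l ∈ S, finrank F l = 2) (hskew : ∀ l ∈ S, ∀ l' ∈ S, l ≠ l' → l ⊓ l' = ⊥)
    (hV : 2 ≤ finrank F V) {δ : ℕ}
    (hδ : (#S + δ) * (Fintype.card F ^ 2 - 1) = Fintype.card F ^ finrank F V - 1) :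
    ∃ t : Finset V, IsMinihyper F t id δ ∧ ∀ x : V, x ≠ 0 →
      (∃ i ∈ t, id i ∈ Submodule.span F {x}) → ∀ l ∈ S, x ∉ l := by
  have : FiniteDimensional F V := Module.Finite.of_finite
  obtain ⟨t, ht, htx⟩ := exists_point_transversal (F := F)
    (A := ({x : V | x ≠ 0 ∧ ∀ l ∈ S, x ∉ l} : Finset V)) (v := id)
    fun i hi => (mem_filter.1 hi).2.1
  have ht0 : ∀ i ∈ t, id i ≠ 0 := fun i hi => (mem_filter.1 (ht hi)).2.1
  have hpoint : ∀ x : V, x ≠ 0 →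
      #{i ∈ t | id i ∈ Submodule.span F {x}} = if ∀ l ∈ S, x ∉ l then 1 else 0 := by
    intro x hx
    rw [htx x hx]
    refine if_congr ⟨?_, fun h => ?_⟩ rfl rfl
    · rintro ⟨i, hi, hix⟩ l hl hxl
      exact (mem_filter.1 hi).2.2 l hl ((Submodule.span_singleton_le_iff_mem _ _).2 hxl hix)
    · exact ⟨x, by simpa [hx] using h, Submodule.mem_span_singleton_self x⟩
  obtain ⟨r, hr⟩ : ∃ r, Fintype.card F = r + 1 :=
    ⟨_, (Nat.succ_pred_eq_of_pos Fintype.card_pos).symm⟩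
  have hr0 : 0 < r := by
    have : 1 < Fintype.card F := Fintype.one_lt_card
    omega
  have hcovered : ∀ x : V, x ≠ 0 →
      (if ∀ l ∈ S, x ∉ l then 1 else 0) + #{l ∈ S | x ∈ l} = 1 := by
    intro x hx
    split_ifs with h
    · rw [filter_eq_empty_iff.2 fun l hl => h l hl]; simp
    · push Not at h
      obtain ⟨l, hl, hxl⟩ := h
      rw [zero_add, card_eq_one]
      refine ⟨l, ?_⟩
      ext l'
      simp only [mem_filter, mem_singleton]
      constructor
      · rintro ⟨hl', hxl'⟩
        by_contra hne
        have : x ∈ l' ⊓ l := ⟨hxl', hxl⟩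
        rw [hskew l' hl' l hl hne] at this
        exact hx ((Submodule.mem_bot F).1 this)
      · rintro rfl
        exact ⟨hl, hxl⟩
  have hsub : ∀ W : Submodule F V, #{i ∈ t | i ∈ W} * r +
      ∑ l ∈ S, ((r + 1) ^ finrank F (l ⊓ W : Submodule F V) - 1) + 1 = (r + 1) ^ finrank F W := by
    intro W
    have h1 := card_mem_mul_eq_sum (F := F) ht0 W
    rw [sum_congr rfl fun x hx => hpoint x (mem_filter.1 hx).2.2, hr, Nat.add_sub_cancel] at h1
    have hswap := sum_card_bipartiteAbove_eq_sum_card_bipartiteBelow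
      (s := ({x | x ∈ W ∧ x ≠ 0} : Finset V)) (t := S) fun x l => x ∈ l
    simp only [bipartiteAbove, bipartiteBelow] at hswap
    have h2 : ∀ l ∈ S, #{x ∈ ({x | x ∈ W ∧ x ≠ 0} : Finset V) | x ∈ l} =
        (r + 1) ^ finrank F (l ⊓ W : Submodule F V) - 1 := by
      intro l _
      rw [← hr, ← card_mem_submodule_ne_zero, filter_filter, Nat.add_sub_cancel]
      congr 2
      ext x
      simp only [Submodule.mem_inf]
      tauto
    rw [sum_congr rfl h2] at hswap
    have h3 := sum_congr rfl fun x (hx : x ∈ ({x | x ∈ W ∧ x ≠ 0} : Finset V)) =>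
      hcovered x (mem_filter.1 hx).2.2
    rw [sum_add_distrib, hswap, ← h1, ← card_eq_sum_ones] at h3
    rw [← hr, ← card_mem_submodule_ne_zero, hr, ← h3]
    rfl
  have hfull : ∀ l ∈ S, (r + 1) ^ finrank F l - 1 = r * (r + 2) := by
    intro l hl
    rw [hrank l hl]
    exact Nat.sub_eq_of_eq_add (by ring)
  have hsq : (r + 1) ^ 2 - 1 = r * (r + 2) := Nat.sub_eq_of_eq_add (by ring)
  have hpow : (r + 1) ^ finrank F V = (#S + δ) * (r * (r + 2)) + 1 := by
    rw [hr, hsq] at hδ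
    have := Nat.one_le_pow (finrank F V) (r + 1) r.succ_pos
    omega
  refine ⟨t, ⟨ht0, ?_, fun φ hφ => ?_⟩, fun x hx hi => ?_⟩
  · have h1 := hsub ⊤
    rw [finrank_top, sum_congr rfl fun l hl => by rw [inf_top_eq, hfull l hl], sum_const,
      smul_eq_mul, hpow] at h1
    simp only [Submodule.mem_top, filter_true] at h1
    rw [hr]
    refine Nat.eq_of_mul_eq_mul_right hr0 ?_
    linarith
  · have h1 := hsub (LinearMap.ker φ)
    have h4 := Dual.finrank_ker_add_one_of_ne_zero hφ
    have hmeet : ∀ l ∈ S, (r + 1) ^ finrank F (l ⊓ LinearMap.ker φ : Submodule F V) - 1 =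
        r + (if l ≤ LinearMap.ker φ then 1 else 0) * (r * (r + 1)) := by
      intro l hl
      split_ifs with hlφ
      · rw [inf_eq_left.2 hlφ, hfull l hl]
        ring
      · have hlt := Submodule.finrank_lt_finrank_of_lt (inf_lt_left.2 hlφ)
        have h3 := Submodule.finrank_sup_add_finrank_inf_eq l (LinearMap.ker φ)
        have h5 := Submodule.finrank_le (l ⊔ LinearMap.ker φ)
        have h6 := hrank l hl
        have : finrank F (l ⊓ LinearMap.ker φ : Submodule F V) = 1 := by omega
        rw [this]
        simp
    rw [sum_congr rfl hmeet, sum_add_distrib, sum_const, smul_eq_mul, ← sum_mul] at h1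
    simp only [LinearMap.mem_ker] at h1
    set c := #{i ∈ t | φ i = 0}
    set a := ∑ l ∈ S, if l ≤ LinearMap.ker φ then 1 else 0
    have hpow' : (r + 1) ^ finrank F V =
        (r + 1) * (r + 1) ^ (finrank F (LinearMap.ker φ) - 1 + 1) := by
      rw [← h4, pow_succ', Nat.sub_add_cancel (by omega)]
    have hker : (r + 1) ^ finrank F (LinearMap.ker φ) =
        (r + 1) * (r + 1) ^ (finrank F (LinearMap.ker φ) - 1) := by
      rw [← pow_succ', Nat.sub_add_cancel (by omega)]
    rw [← ZMod.natCast_eq_natCast_iff, hr]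
    change ((c : ℕ) : ZMod (r + 1)) = δ
    have hzero : (r : ZMod (r + 1)) = -1 := by
      have := ZMod.natCast_self (r + 1)
      push_cast at this
      exact eq_neg_of_add_eq_zero_left this
    have e1 := congrArg (Nat.cast : ℕ → ZMod (r + 1)) (h1.trans hker)
    have e2 := congrArg (Nat.cast : ℕ → ZMod (r + 1)) (hpow.symm.trans hpow')
    push_cast at e1 e2
    rw [hzero] at e1 e2
    linear_combination e2 - e1
  · by_contra h
    obtain ⟨i, hi, hix⟩ := hi
    have h1 := hpoint x hx
    rw [if_neg h, card_eq_zero] at h1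
    exact notMem_empty i (h1 ▸ mem_filter.2 ⟨hi, hix⟩)

end LineSums

/-- (Bruen) Let q be a square prime power and N ≥ 3 odd. A maximal partial line
spread of PG(N,q) of deficiency δ > 0 satisfies δ ≥ √q + 1. -/
theorem stmt16 (F : Type*) [Field F] [Fintype F] (q : ℕ) (hq : Fintype.card F = q)
    (hsq : IsSquare q) (N : ℕ) (hN3 : 3 ≤ N) (hNodd : Odd N)
    (S : Set (Submodule F (Fin (N + 1) → F)))
    (hS : IsMaximalPartialLineSpread F (N + 1) S)
    (δ : ℕ) (hδpos : 0 < δ)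
    (hdef : S.ncard + δ = (q ^ (N + 1) - 1) / (q ^ 2 - 1)) :
    Real.sqrt q + 1 ≤ (δ : ℝ) := by
  classical
  subst hq
  set q := Fintype.card F with hq
  have hq4 : 4 ≤ q := by
    obtain ⟨a, ha⟩ := hsq
    have : 1 < q := Fintype.one_lt_card
    have : 2 ≤ a := by
      by_contra! h
      interval_cases a <;> omega
    nlinarith
  by_contra! hlt
  have hsqrt : (δ : ℝ) - 1 < Real.sqrt q := by linarith
  have hδ1 : (1 : ℝ) ≤ δ := by exact_mod_cast hδpos
  have hsmall : (δ - 1) ^ 2 < q := by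
    have := (Real.lt_sqrt (by linarith)).1 hsqrt
    rw [← Nat.cast_one, ← Nat.cast_sub hδpos] at this
    exact_mod_cast this
  have hδq : δ < q := by
    obtain ⟨e, rfl⟩ : ∃ e, δ = e + 1 := ⟨δ - 1, by omega⟩
    rw [Nat.add_sub_cancel] at hsmall
    by_contra! h
    nlinarith
  obtain ⟨⟨hrank, hskew⟩, hmax⟩ := hS
  have hSfin : S.Finite := Set.toFinite S
  have hfinrank : Module.finrank F (Fin (N + 1) → F) = N + 1 := by simp
  have hdvd : q ^ 2 - 1 ∣ q ^ (N + 1) - 1 := by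
    obtain ⟨m, hm⟩ := hNodd.add_one
    rw [hm, ← two_mul, pow_mul]
    exact Nat.sub_one_dvd_pow_sub_one _ _
  obtain ⟨t, ht, hcover⟩ := exists_isMinihyper_holes (S := hSfin.toFinset) (δ := δ)
    (fun l hl => hrank l (hSfin.mem_toFinset.1 hl))
    (fun l hl l' hl' => hskew l (hSfin.mem_toFinset.1 hl) l' (hSfin.mem_toFinset.1 hl'))
    (by omega)
    (by rw [← Set.ncard_eq_toFinset_card S hSfin, hdef, hfinrank, Nat.div_mul_cancel hdvd])
  obtain ⟨L, hL⟩ := ht.exists_isSumOfLines (N - 1) (by omega) hsmall hδq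
  obtain ⟨l, hl, hmeet⟩ := hmax (L ⟨0, hδpos⟩) (hL.finrank_eq _)
  obtain ⟨x, hx, hx0⟩ := Submodule.exists_mem_ne_zero_of_ne_bot hmeet
  refine hcover x hx0 ?_ l (hSfin.mem_toFinset.2 hl) hx.2
  have hpos : 0 < (Finset.univ.filter fun j => x ∈ L j).card :=
    Finset.card_pos.2 ⟨⟨0, hδpos⟩, by simpa using hx.1⟩
  rw [← hL.card_eq x hx0] at hpos
  obtain ⟨i, hi⟩ := Finset.card_pos.1 hpos
  exact ⟨i, (Finset.mem_filter.1 hi).1, (Finset.mem_filter.1 hi).2⟩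
end
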